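/- arXiv:1002.0823 — 3 statements merged into one kernel-verified Lean document; each statement's English description precedes it below -/
import Mathlib

section
/- Let (a_n)_{n≥0} be a bounded sequence of complex numbers. Suppose there exist a strictly increasing sequence of natural numbers n_j → ∞ and constants C, D > 0 such that for every integer k < 0, limsup_{j→∞} |a_{n_j+k}| ≤ C e^{-D|k|}, while liminf_{j→∞} |a_{n_j}| > 0. Then f(z) = Σ_{n=0}^∞ a_n z^n has a strong natural boundary on ∂𝔻. -/
open Filter Metric Set MeasureTheory

/-- `b : ℤ → ℂ` is a right limit of `a : ℕ → ℂ`. -/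
def IsRightLimit (a : ℕ → ℂ) (b : ℤ → ℂ) : Prop :=
  ∃ n : ℕ → ℕ, StrictMono n ∧
    ∀ k : ℤ, Tendsto (fun j => a (k + n j).toNat) atTop (nhds (b k))

/-- `f_+` for a two-sided sequence. -/
noncomputable def fPlus (b : ℤ → ℂ) (z : ℂ) : ℂ := ∑' n : ℕ, b n * z ^ n

/-- `f_-` for a two-sided sequence. -/
noncomputable def fMinus (b : ℤ → ℂ) (z : ℂ) : ℂ :=
  ∑' n : ℕ, b (-(n : ℤ) - 1) * z ^ (-(n : ℤ) - 1)

/-- The open arc `{e^{iθ} : α < θ < β}` of the unit circle. -/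
def arc (α β : ℝ) : Set ℂ := {z | ∃ θ ∈ Set.Ioo α β, z = Complex.exp (θ * Complex.I)}

/-- The two-sided sequence `b` is reflectionless on the arc `I`. -/
def Reflectionless (b : ℤ → ℂ) (I : Set ℂ) : Prop :=
  ∃ g : ℂ → ℂ,
    DifferentiableOn ℂ g ((Metric.sphere (0 : ℂ) 1 \ I)ᶜ) ∧
    (∀ z ∈ Metric.ball (0 : ℂ) 1, g z = fPlus b z) ∧
    (∀ z : ℂ, 1 < ‖z‖ → g z = - fMinus b z)

/-- `f` has a strong natural boundary on the unit circle. -/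
def StrongNaturalBoundary (f : ℂ → ℂ) : Prop :=
  ∀ α β : ℝ, α < β →
    ¬ ∃ M : ℝ, ∀ r : ℝ, 0 < r → r < 1 →
      (∫ θ in α..β, ‖f (r * Complex.exp (θ * Complex.I))‖) / (2 * Real.pi) ≤ M

/-- `f` has a (classical) natural boundary on the unit circle. -/
def NaturalBoundary (f : ℂ → ℂ) : Prop :=
  ¬ ∃ z₀ : ℂ, ‖z₀‖ = 1 ∧ ∃ δ > (0 : ℝ), ∃ g : ℂ → ℂ,
    DifferentiableOn ℂ g (Metric.ball (0 : ℂ) 1 ∪ Metric.ball z₀ δ) ∧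
    ∀ z ∈ Metric.ball (0 : ℂ) 1, g z = f z


/-- the exponential e^{i n θ} -/
noncomputable def eE (n : ℤ) (θ : ℝ) : ℂ := Complex.exp (n * θ * Complex.I)

lemma eE_cont (n : ℤ) : Continuous (eE n) := by unfold eE; fun_prop

lemma eE_norm (n : ℤ) (θ : ℝ) : ‖eE n θ‖ = 1 := by
  have : eE n θ = Complex.exp (((n * θ : ℝ) : ℂ) * Complex.I) := by unfold eE; push_cast; rfl
  rw [this, Complex.norm_exp_ofReal_mul_I]

lemma eE_add (m n : ℤ) (θ : ℝ) : eE (m + n) θ = eE m θ * eE n θ := by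
  unfold eE; rw [← Complex.exp_add]; congr 1; push_cast; ring

lemma eE_add' (n : ℤ) (s t : ℝ) : eE n (s + t) = eE n s * eE n t := by
  unfold eE; rw [← Complex.exp_add]; congr 1; push_cast; ring

lemma eE_zero (θ : ℝ) : eE 0 θ = 1 := by simp [eE]

lemma eE_conj (n : ℤ) (θ : ℝ) : (starRingEnd ℂ) (eE n θ) = eE (-n) θ := by
  unfold eE; rw [← Complex.exp_conj]; congr 1; simp

lemma eE_nat (n : ℕ) (θ : ℝ) : eE n θ = Complex.exp (θ * Complex.I) ^ n := by
  unfold eE; rw [← Complex.exp_nat_mul]; congr 1; push_cast; ring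

lemma eE_int_eq (n : ℤ) : ∫ θ in (-Real.pi)..Real.pi, eE n θ = if n = 0 then 2 * (Real.pi : ℂ) else 0 := by
  split_ifs with h
  · subst h; simp [eE_zero]; ring
  · have h1 : (n : ℂ) * Complex.I ≠ 0 := by simp [h]
    have : ∀ θ : ℝ, eE n θ = Complex.exp ((n * Complex.I) * θ) := by
      intro θ; unfold eE; congr 1; ring
    simp_rw [this]
    rw [integral_exp_mul_complex h1]
    rw [div_eq_zero_iff]; left
    rw [sub_eq_zero, Complex.exp_eq_exp_iff_exists_int]
    refine ⟨n, ?_⟩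
    push_cast; ring

lemma eE_sum_int {ι : Type*} [Countable ι] (γ : ι → ℂ) (hγ : Summable (fun k => ‖γ k‖))
    (u : ℝ → ℂ) (hu : Continuous u) (e : ι → ℤ) :
    ∫ θ in (-Real.pi)..Real.pi, (∑' k, γ k * eE (e k) θ) * u θ
      = ∑' k, γ k * ∫ θ in (-Real.pi)..Real.pi, eE (e k) θ * u θ := by
  obtain ⟨B, hB⟩ := (isCompact_uIcc (a := -Real.pi) (b := Real.pi)).exists_bound_of_continuousOn
    hu.continuousOn
  have h := intervalIntegral.hasSum_integral_of_dominated_convergence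
    (μ := volume) (a := -Real.pi) (b := Real.pi) (F := fun k θ => γ k * eE (e k) θ * u θ)
    (f := fun θ => (∑' k, γ k * eE (e k) θ) * u θ)
    (fun k _ => ‖γ k‖ * B) ?_ ?_ ?_ ?_ ?_
  · rw [← h.tsum_eq]
    congr 1; ext k
    rw [← intervalIntegral.integral_const_mul]
    congr 1; ext θ; ring
  · intro k
    exact ((continuous_const.mul (eE_cont _)).mul hu).aestronglyMeasurable
  · intro k
    refine Eventually.of_forall fun θ hθ => ?_
    rw [norm_mul, norm_mul, eE_norm, mul_one]
    exact mul_le_mul_of_nonneg_left (hB θ (uIoc_subset_uIcc hθ)) (norm_nonneg _)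
  · exact Eventually.of_forall fun θ _ => hγ.mul_right B
  · exact continuous_const.intervalIntegrable _ _
  · refine Eventually.of_forall fun θ _ => ?_
    apply HasSum.mul_right
    apply Summable.hasSum
    apply Summable.of_norm
    simpa [eE_norm] using hγ

lemma eE_sum_cont {ι : Type*} (γ : ι → ℂ) (hγ : Summable (fun k => ‖γ k‖)) (e : ι → ℤ) :
    Continuous (fun θ => ∑' k, γ k * eE (e k) θ) := by
  refine continuous_tsum (fun k => continuous_const.mul (eE_cont _)) hγ ?_
  intro k θ; simp [eE_norm]

lemma eE_coeff {ι : Type*} [Countable ι] (γ : ι → ℂ) (hγ : Summable (fun k => ‖γ k‖))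
    (e : ι → ℤ) (he : Function.Injective e) (n : ι) :
    ∫ θ in (-Real.pi)..Real.pi, (∑' k, γ k * eE (e k) θ) * eE (-e n) θ = 2 * Real.pi * γ n := by
  rw [eE_sum_int γ hγ _ (eE_cont _) e, tsum_eq_single n]
  · simp_rw [← eE_add]; rw [eE_int_eq]; simp; ring
  · intro k hk
    simp_rw [← eE_add]; rw [eE_int_eq, if_neg, mul_zero]
    intro h; apply hk; apply he; linarith

lemma eE_parseval {ι : Type*} [Countable ι] (γ : ι → ℂ) (hγ : Summable (fun k => ‖γ k‖))
    (e : ι → ℤ) (he : Function.Injective e) :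
    ∫ θ in (-Real.pi)..Real.pi, ‖∑' k, γ k * eE (e k) θ‖ ^ 2 = 2 * Real.pi * ∑' k, ‖γ k‖ ^ 2 := by
  have hc := eE_sum_cont γ hγ e
  have h1 := eE_sum_int γ hγ (fun θ => (starRingEnd ℂ) (∑' k, γ k * eE (e k) θ))
    (Complex.continuous_conj.comp hc) e
  have h2 : ∀ k, ∫ θ in (-Real.pi)..Real.pi, eE (e k) θ * (starRingEnd ℂ) (∑' k, γ k * eE (e k) θ)
      = 2 * Real.pi * (starRingEnd ℂ) (γ k) := by
    intro k
    have := eE_coeff γ hγ e he k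
    have h3 := congrArg (starRingEnd ℂ) this
    have hle : -Real.pi ≤ Real.pi := by linarith [Real.pi_pos]
    rw [intervalIntegral.integral_of_le hle, ← integral_conj, ← intervalIntegral.integral_of_le hle] at h3
    simp only [map_mul, eE_conj, neg_neg, Complex.conj_ofReal] at h3
    rw [show (starRingEnd ℂ) 2 = 2 from Complex.conj_ofNat 2] at h3
    rw [← h3]
    congr 1; ext θ; ring
  simp_rw [h2] at h1
  have h4 : ∀ z : ℂ, z * (starRingEnd ℂ) z = ((‖z‖ ^ 2 : ℝ) : ℂ) := by
    intro z; rw [Complex.mul_conj, Complex.normSq_eq_norm_sq]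
  have h5 : ∀ k, γ k * (2 * Real.pi * (starRingEnd ℂ) (γ k)) = ((2 * Real.pi * ‖γ k‖ ^ 2 : ℝ) : ℂ) := by
    intro k; rw [show γ k * (2 * Real.pi * (starRingEnd ℂ) (γ k)) = 2 * Real.pi * (γ k * (starRingEnd ℂ) (γ k)) by ring, h4]
    push_cast; rfl
  simp_rw [h4, h5] at h1
  rw [intervalIntegral.integral_ofReal, ← Complex.ofReal_tsum, Complex.ofReal_inj, tsum_mul_left] at h1
  exact h1

lemma half_factor (w : ℂ) (hw : ‖w‖ ≤ 1) : ∃ s : ℂ → ℂ, DiffContOnCl ℂ s (ball 0 1) ∧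
    (∀ z ∈ closedBall (0 : ℂ) 1, s z * s z = 1 - w * z) := by
  have hre : ∀ z ∈ closedBall (0 : ℂ) 1, 0 ≤ (1 - w * z).re := by
    intro z hz
    have h1 : ‖w * z‖ ≤ 1 := by
      rw [norm_mul]; exact mul_le_one₀ hw (norm_nonneg _) (by simpa using hz)
    have := Complex.re_le_norm (w * z)
    simp only [Complex.sub_re, Complex.one_re]; linarith
  have hre' : ∀ z ∈ ball (0 : ℂ) 1, 0 < (1 - w * z).re := by
    intro z hz
    have hz' : ‖z‖ < 1 := by simpa using hz
    have h1 : ‖w * z‖ < 1 := by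
      rw [norm_mul]; nlinarith [norm_nonneg w, norm_nonneg z]
    have := Complex.re_le_norm (w * z)
    simp only [Complex.sub_re, Complex.one_re]; linarith
  refine ⟨fun z => (1 - w * z) ^ (1 / 2 : ℂ), ⟨?_, ?_⟩, ?_⟩
  · intro z hz
    refine DifferentiableAt.differentiableWithinAt ?_
    refine DifferentiableAt.cpow (by fun_prop) (by fun_prop) ?_
    left; exact hre' z hz
  · rw [closure_ball _ one_ne_zero]
    intro z hz
    refine ContinuousAt.continuousWithinAt ?_
    exact ContinuousAt.comp (f := fun z => 1 - w * z) (g := fun u : ℂ => u ^ (1 / 2 : ℂ))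
      (Complex.continuousAt_cpow_const_of_re_pos (Or.inl (hre z hz)) (by norm_num)) (by fun_prop)
  · intro z hz
    simp only
    rw [← sq, show (1 / 2 : ℂ) = ((2 : ℕ) : ℂ)⁻¹ by norm_num]
    exact Complex.cpow_nat_inv_pow _ two_ne_zero

def Fac (p : ℂ → ℂ) : Prop := ∃ g h : ℂ → ℂ, DiffContOnCl ℂ g (ball 0 1) ∧ DiffContOnCl ℂ h (ball 0 1) ∧
  (∀ z ∈ closedBall (0 : ℂ) 1, p z = g z * h z) ∧
  (∀ z ∈ sphere (0 : ℂ) 1, ‖g z‖ ^ 2 = ‖p z‖ ∧ ‖h z‖ ^ 2 = ‖p z‖)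

lemma DiffContOnCl.mul' {g h : ℂ → ℂ} {s : Set ℂ} (hg : DiffContOnCl ℂ g s) (hh : DiffContOnCl ℂ h s) :
    DiffContOnCl ℂ (fun z => g z * h z) s := ⟨hg.1.mul hh.1, hg.2.mul hh.2⟩

lemma Fac.mul {p q : ℂ → ℂ} (hp : Fac p) (hq : Fac q) : Fac (fun z => p z * q z) := by
  obtain ⟨g, h, h1, h2, h3, h4⟩ := hp
  obtain ⟨g', h', h1', h2', h3', h4'⟩ := hq
  refine ⟨fun z => g z * g' z, fun z => h z * h' z, h1.mul' h1', h2.mul' h2', ?_, ?_⟩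
  · intro z hz; simp only; rw [h3 z hz, h3' z hz]; ring
  · intro z hz
    simp only [norm_mul, mul_pow]
    rw [(h4 z hz).1, (h4 z hz).2, (h4' z hz).1, (h4' z hz).2]; exact ⟨rfl, rfl⟩

lemma Fac.const (c : ℂ) : Fac (fun _ => c) := by
  have h : (c ^ (1 / 2 : ℂ)) ^ 2 = c := by
    rw [show (1 / 2 : ℂ) = ((2 : ℕ) : ℂ)⁻¹ by norm_num]
    exact Complex.cpow_nat_inv_pow _ two_ne_zero
  refine ⟨fun _ => c ^ (1 / 2 : ℂ), fun _ => c ^ (1 / 2 : ℂ), diffContOnCl_const, diffContOnCl_const, ?_, ?_⟩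
  · intro z _; simp only; rw [← sq, h]
  · intro z _; simp only; rw [← norm_pow, h]; exact ⟨rfl, rfl⟩

lemma Fac.sqr (w : ℂ) (hw : ‖w‖ ≤ 1) : Fac (fun z => 1 - w * z) := by
  obtain ⟨s, hs, hs2⟩ := half_factor w hw
  refine ⟨s, s, hs, hs, fun z hz => (hs2 z hz).symm, fun z hz => ?_⟩
  simp only
  rw [← hs2 z (sphere_subset_closedBall hz), norm_mul, sq]; exact ⟨rfl, rfl⟩

lemma Fac.lin (ζ : ℂ) : Fac (fun z => z - ζ) := by
  by_cases hζ : 1 ≤ ‖ζ‖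
  · have h0 : ζ ≠ 0 := by intro h; rw [h, norm_zero] at hζ; linarith
    have := (Fac.const (-ζ)).mul (Fac.sqr ζ⁻¹ (by rw [norm_inv]; exact inv_le_one_of_one_le₀ hζ))
    convert this using 2 with z
    field_simp; ring
  · push Not at hζ
    set w := (starRingEnd ℂ) ζ with hw
    have hwn : ‖w‖ < 1 := by rw [hw, RCLike.norm_conj]; exact hζ
    obtain ⟨s, hs, hs2⟩ := half_factor w hwn.le
    have hne : ∀ z ∈ closedBall (0 : ℂ) 1, 1 - w * z ≠ 0 := by
      intro z hz h
      have hz' : ‖z‖ ≤ 1 := by simpa using hz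
      have : ‖w * z‖ = 1 := by rw [← sub_eq_zero.1 h, norm_one]
      rw [norm_mul] at this; nlinarith [norm_nonneg w, norm_nonneg z]
    have hb : DiffContOnCl ℂ (fun z => (z - ζ) * (1 - w * z)⁻¹) (ball 0 1) := by
      refine DifferentiableOn.diffContOnCl ?_
      rw [closure_ball _ one_ne_zero]
      intro z hz
      have := hne z hz
      refine DifferentiableAt.differentiableWithinAt ?_
      exact DifferentiableAt.mul (by fun_prop) (DifferentiableAt.inv (by fun_prop) this)
    refine ⟨fun z => (z - ζ) * (1 - w * z)⁻¹ * s z, s, hb.mul' hs, hs, ?_, ?_⟩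
    · intro z hz
      have := hne z hz
      simp only
      rw [mul_assoc, hs2 z hz, mul_assoc, inv_mul_cancel₀ this, mul_one]
    · intro z hz
      have hz1 := sphere_subset_closedBall hz
      have hzn : ‖z‖ = 1 := by simpa using hz
      have hz2 := hne z hz1
      have h1 : ‖s z‖ ^ 2 = ‖1 - w * z‖ := by rw [← hs2 z hz1, norm_mul, sq]
      have h2 : ‖1 - w * z‖ = ‖z - ζ‖ := by
        have hzz : (starRingEnd ℂ) z * z = 1 := by
          rw [mul_comm, Complex.mul_conj, Complex.normSq_eq_norm_sq, hzn]; simp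
        have : 1 - w * z = (starRingEnd ℂ) (z - ζ) * z := by
          rw [map_sub, sub_mul, hzz]
        rw [this, norm_mul, hzn, RCLike.norm_conj, mul_one]
      have h3 : ‖z - ζ‖ ≠ 0 := by rw [← h2]; exact norm_ne_zero_iff.2 hz2
      constructor
      · simp only [norm_mul, mul_pow, norm_inv, h1, h2]
        field_simp
      · rw [h1, h2]

lemma Fac.poly (p : Polynomial ℂ) : Fac (fun z => p.eval z) := by
  have hp := IsAlgClosed.splits p
  have h := hp.eq_prod_roots
  rw [h]
  simp only [Polynomial.eval_mul, Polynomial.eval_C]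
  refine (Fac.const _).mul ?_
  induction p.roots using Multiset.induction_on with
  | empty => simpa using Fac.const 1
  | cons a s ih => simpa using (Fac.lin a).mul ih

/-- the Cauchy-product estimate -/
lemma paley_alg (g h d : ℕ → ℂ) (A B : ℝ)
    (hg : ∀ s : Finset ℕ, ∑ k ∈ s, ‖g k‖ ^ 2 ≤ A) (hh : ∀ s : Finset ℕ, ∑ k ∈ s, ‖h k‖ ^ 2 ≤ B)
    (hd : ∀ n, d n = ∑ kl ∈ Finset.HasAntidiagonal.antidiagonal n, g kl.1 * h kl.2)
    (N : ℕ → ℕ) (hN : ∀ j, 2 * N j < N (j + 1)) (J : ℕ) :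
    ∑ j ∈ Finset.range J, ‖d (N j)‖ ^ 2 ≤ 4 * (A * B) := by
  have hA : 0 ≤ A := by simpa using hg ∅
  have hB : 0 ≤ B := by simpa using hh ∅
  let blk : ℕ → Finset ℕ := fun n => (Finset.range (n + 1)).filter (fun k => n ≤ 2 * k)
  have hmono : StrictMono N := strictMono_nat_of_lt_succ (fun j => by have := hN j; omega)
  have hdisj : ∀ i j, i < j → Disjoint (blk (N i)) (blk (N j)) := by
    intro i j hij
    rw [Finset.disjoint_left]
    intro k hk hk'
    simp only [blk, Finset.mem_filter, Finset.mem_range] at hk hk'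
    have h1 := hN i
    have h2 := hmono.monotone (Nat.succ_le_of_lt hij)
    simp only [Nat.succ_eq_add_one] at h2
    omega
  have hsum : ∀ (u : ℕ → ℂ) (K : ℝ), (∀ s : Finset ℕ, ∑ k ∈ s, ‖u k‖ ^ 2 ≤ K) →
      ∑ j ∈ Finset.range J, ∑ k ∈ blk (N j), ‖u k‖ ^ 2 ≤ K := by
    intro u K hu
    rw [← Finset.sum_biUnion]
    · exact hu _
    · intro i _ j _ hij
      rcases lt_or_gt_of_ne hij with h | h
      · exact hdisj i j h
      · exact (hdisj j i h).symm
  have key : ∀ n, ‖d n‖ ^ 2 ≤ 2 * (B * ∑ k ∈ blk n, ‖g k‖ ^ 2 + A * ∑ k ∈ blk n, ‖h k‖ ^ 2) := by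
    intro n
    have h1 : ‖d n‖ ≤ ∑ k ∈ blk n, ‖g k‖ * ‖h (n - k)‖ + ∑ k ∈ blk n, ‖h k‖ * ‖g (n - k)‖ := by
      rw [hd n]
      refine (norm_sum_le _ _).trans ?_
      simp_rw [norm_mul]
      rw [Finset.Nat.sum_antidiagonal_eq_sum_range_succ (fun i j => ‖g i‖ * ‖h j‖) n]
      rw [← Finset.sum_filter_add_sum_filter_not (Finset.range n.succ) (fun k => n ≤ 2 * k)]
      refine add_le_add le_rfl ?_
      have : ∑ k ∈ (Finset.range n.succ).filter (fun k => ¬ n ≤ 2 * k), ‖g k‖ * ‖h (n - k)‖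
          = ∑ k ∈ ((Finset.range n.succ).filter (fun k => ¬ n ≤ 2 * k)).image (fun k => n - k),
            ‖h k‖ * ‖g (n - k)‖ := by
        rw [Finset.sum_image]
        · refine Finset.sum_congr rfl fun k hk => ?_
          simp only [Finset.mem_filter, Finset.mem_range] at hk
          rw [show n - (n - k) = k by omega, mul_comm]
        · intro x hx y hy hxy
          simp only [Finset.coe_filter, Finset.mem_range, Set.mem_ofPred_eq] at hx hy hxy
          omega
      rw [this]
      refine Finset.sum_le_sum_of_subset_of_nonneg ?_ (fun _ _ _ => by positivity)
      intro k hk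
      simp only [Finset.mem_image, Finset.mem_filter, Finset.mem_range, blk] at hk ⊢
      obtain ⟨x, hx, rfl⟩ := hk
      omega
    have cs : ∀ (u v : ℕ → ℂ) (K : ℝ), (∀ s : Finset ℕ, ∑ k ∈ s, ‖v k‖ ^ 2 ≤ K) →
        (∑ k ∈ blk n, ‖u k‖ * ‖v (n - k)‖) ^ 2 ≤ K * ∑ k ∈ blk n, ‖u k‖ ^ 2 := by
      intro u v K hv
      refine (Finset.sum_mul_sq_le_sq_mul_sq _ _ _).trans ?_
      rw [mul_comm]
      refine mul_le_mul_of_nonneg_right ?_ (by positivity)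
      refine le_trans (le_of_eq ?_) (hv ((blk n).image (fun k => n - k)))
      rw [Finset.sum_image]
      intro x hx y hy hxy
      simp only [blk, Finset.coe_filter, Finset.mem_range, Set.mem_ofPred_eq] at hx hy hxy
      omega
    have c1 := cs g h B hh
    have c2 := cs h g A hg
    set X := ∑ k ∈ blk n, ‖g k‖ * ‖h (n - k)‖
    set Y := ∑ k ∈ blk n, ‖h k‖ * ‖g (n - k)‖
    have : ‖d n‖ ^ 2 ≤ (X + Y) ^ 2 := pow_le_pow_left₀ (norm_nonneg _) h1 2
    nlinarith [sq_nonneg (X - Y)]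
  calc ∑ j ∈ Finset.range J, ‖d (N j)‖ ^ 2
      ≤ ∑ j ∈ Finset.range J, 2 * (B * ∑ k ∈ blk (N j), ‖g k‖ ^ 2 + A * ∑ k ∈ blk (N j), ‖h k‖ ^ 2) :=
        Finset.sum_le_sum fun j _ => key _
    _ = 2 * (B * ∑ j ∈ Finset.range J, ∑ k ∈ blk (N j), ‖g k‖ ^ 2
        + A * ∑ j ∈ Finset.range J, ∑ k ∈ blk (N j), ‖h k‖ ^ 2) := by
        rw [← Finset.mul_sum, Finset.sum_add_distrib, Finset.mul_sum, Finset.mul_sum]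
    _ ≤ 2 * (B * A + A * B) := by
        have := hsum g A hg
        have := hsum h B hh
        gcongr
    _ = 4 * (A * B) := by ring

lemma coef_series (g : ℂ → ℂ) (hg : DiffContOnCl ℂ g (ball 0 1)) :
    ∃ c : ℕ → ℂ, ∀ r : ℝ, 0 < r → r < 1 → Summable (fun k => ‖c k * r ^ k‖) ∧
      ∀ θ : ℝ, g (r * Complex.exp (θ * Complex.I)) = ∑' k : ℕ, (c k * r ^ k) * eE k θ := by
  have h := DiffContOnCl.hasFPowerSeriesOnBall (R := 1) (c := 0) (f := g) (by simpa using hg) one_pos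
  refine ⟨fun k => (cauchyPowerSeries g 0 ((1 : NNReal) : ℝ)).coeff k, fun r hr hr1 => ?_⟩
  have hs : ∀ θ : ℝ, HasSum (fun k : ℕ => ((cauchyPowerSeries g 0 ((1 : NNReal) : ℝ)).coeff k * r ^ k) * eE k θ)
      (g (r * Complex.exp (θ * Complex.I))) := by
    intro θ
    have h1 := h.hasSum (y := r * Complex.exp (θ * Complex.I)) (by
      simp [← ofReal_norm, Complex.norm_exp_ofReal_mul_I, abs_of_pos hr, hr1])
    rw [zero_add] at h1
    have hfun : (fun k : ℕ => ((cauchyPowerSeries g 0 ((1 : NNReal) : ℝ)).coeff k * r ^ k) * eE k θ)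
        = fun k => (cauchyPowerSeries g 0 ((1 : NNReal) : ℝ) k) fun _ => r * Complex.exp (θ * Complex.I) := by
      funext k
      rw [FormalMultilinearSeries.apply_eq_pow_smul_coeff, eE_nat, smul_eq_mul, mul_pow]; ring
    rw [hfun]; exact h1
  refine ⟨?_, fun θ => (hs θ).tsum_eq.symm⟩
  have := (hs 0).summable.norm
  simpa [eE_norm] using this

lemma circ_tendsto (G : ℂ → ℝ) (hG : ContinuousOn G (closedBall 0 1)) :
    Tendsto (fun r : ℝ => ∫ θ in (-Real.pi)..Real.pi, G (r * Complex.exp (θ * Complex.I)))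
      (nhdsWithin 1 (Ioo 0 1)) (nhds (∫ θ in (-Real.pi)..Real.pi, G (Complex.exp (θ * Complex.I)))) := by
  obtain ⟨B, hB⟩ := (isCompact_closedBall (0 : ℂ) 1).exists_bound_of_continuousOn hG
  have hmem : ∀ r : ℝ, 0 ≤ r → r ≤ 1 → ∀ θ : ℝ, (r : ℂ) * Complex.exp (θ * Complex.I) ∈ closedBall (0 : ℂ) 1 := by
    intro r h0 h1 θ
    simp [Complex.norm_exp_ofReal_mul_I, abs_of_nonneg h0, h1]
  refine intervalIntegral.tendsto_integral_filter_of_dominated_convergence (fun _ => B) ?_ ?_ ?_ ?_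
  · filter_upwards [self_mem_nhdsWithin] with r hr
    refine Continuous.aestronglyMeasurable ?_
    exact hG.comp_continuous (by fun_prop) (hmem r hr.1.le hr.2.le)
  · filter_upwards [self_mem_nhdsWithin] with r hr
    exact Eventually.of_forall fun θ _ => hB _ (hmem r hr.1.le hr.2.le θ)
  · exact continuous_const.intervalIntegrable _ _
  · refine Eventually.of_forall fun θ _ => ?_
    have h1 : ContinuousWithinAt G (closedBall 0 1) (Complex.exp (θ * Complex.I)) :=
      hG _ (by simpa using hmem 1 zero_le_one le_rfl θ)
    refine h1.tendsto.comp ?_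
    rw [tendsto_nhdsWithin_iff]
    constructor
    · have : Continuous (fun r : ℝ => (r : ℂ) * Complex.exp (θ * Complex.I)) := by fun_prop
      have := (this.tendsto 1).mono_left (nhdsWithin_le_nhds (s := Ioo 0 1))
      simpa using this
    · filter_upwards [self_mem_nhdsWithin] with r hr
      exact hmem r hr.1.le hr.2.le θ

lemma bessel_finset (γ : ℕ → ℂ) (hγ : Summable (fun k => ‖γ k‖)) (s : Finset ℕ) :
    ∑ k ∈ s, ‖γ k‖ ^ 2 ≤ (2 * Real.pi)⁻¹ * ∫ θ in (-Real.pi)..Real.pi, ‖∑' k : ℕ, γ k * eE k θ‖ ^ 2 := by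
  rw [eE_parseval γ hγ (fun k => (k : ℤ)) Nat.cast_injective, ← mul_assoc,
    inv_mul_cancel₀ (by positivity), one_mul]
  refine Summable.sum_le_tsum s (fun _ _ => by positivity) ?_
  refine Summable.of_norm_bounded_eventually_nat hγ ?_
  have := hγ.tendsto_atTop_zero
  filter_upwards [this.eventually (gt_mem_nhds one_pos)] with k hk
  rw [Real.norm_of_nonneg (by positivity), sq]
  exact mul_le_of_le_one_left (norm_nonneg _) hk.le

instance : (nhdsWithin (1 : ℝ) (Ioo 0 1)).NeBot := by
  rw [← mem_closure_iff_nhdsWithin_neBot, closure_Ioo (by norm_num)]; simp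

lemma paley_poly (p : Polynomial ℂ) (N : ℕ → ℕ) (hN : ∀ j, 2 * N j < N (j + 1)) (J : ℕ) :
    ∑ j ∈ Finset.range J, ‖p.coeff (N j)‖ ^ 2 ≤
      4 * ((2 * Real.pi)⁻¹ * ∫ θ in (-Real.pi)..Real.pi, ‖p.eval (Complex.exp (θ * Complex.I))‖) ^ 2 := by
  obtain ⟨g, h, hg, hh, hp, hn⟩ := Fac.poly p
  beta_reduce at hp hn
  obtain ⟨cg, hcg⟩ := coef_series g hg
  obtain ⟨ch, hch⟩ := coef_series h hh
  have hmem : ∀ r : ℝ, 0 ≤ r → r ≤ 1 → ∀ θ : ℝ, (r : ℂ) * Complex.exp (θ * Complex.I) ∈ closedBall (0 : ℂ) 1 := by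
    intro r h0 h1 θ
    simp [Complex.norm_exp_ofReal_mul_I, abs_of_nonneg h0, h1]
  have hpr : ∀ r : ℝ, 0 < r → r < 1 → Summable (fun k => ‖p.coeff k * (r : ℂ) ^ k‖) ∧
      ∀ θ : ℝ, p.eval (r * Complex.exp (θ * Complex.I)) = ∑' k : ℕ, (p.coeff k * r ^ k) * eE k θ := by
    intro r hr hr1
    have hz : ∀ k ∉ Finset.range (p.natDegree + 1), p.coeff k = 0 := by
      intro k hk
      exact Polynomial.coeff_eq_zero_of_natDegree_lt (by simpa using hk)
    refine ⟨summable_of_ne_finset_zero (s := Finset.range (p.natDegree + 1)) fun k hk => by simp [hz k hk], fun θ => ?_⟩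
    rw [tsum_eq_sum (s := Finset.range (p.natDegree + 1)) fun k hk => by simp [hz k hk],
      Polynomial.eval_eq_sum_range]
    refine Finset.sum_congr rfl fun k _ => ?_
    rw [eE_nat, mul_pow]; ring
  have main : ∀ r ∈ Ioo (0 : ℝ) 1, ∑ j ∈ Finset.range J, ‖p.coeff (N j) * (r : ℂ) ^ (N j)‖ ^ 2 ≤
      4 * (((2 * Real.pi)⁻¹ * ∫ θ in (-Real.pi)..Real.pi, ‖g (r * Complex.exp (θ * Complex.I))‖ ^ 2) *
        ((2 * Real.pi)⁻¹ * ∫ θ in (-Real.pi)..Real.pi, ‖h (r * Complex.exp (θ * Complex.I))‖ ^ 2)) := by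
    intro r hr
    obtain ⟨sg, eg⟩ := hcg r hr.1 hr.2
    obtain ⟨sh, eh⟩ := hch r hr.1 hr.2
    obtain ⟨sp, ep⟩ := hpr r hr.1 hr.2
    simp_rw [eg, eh]
    refine paley_alg (fun k => cg k * r ^ k) (fun k => ch k * r ^ k) (fun k => p.coeff k * r ^ k) _ _
      (bessel_finset _ sg) (bessel_finset _ sh) ?_ N hN J
    have ss : Summable (fun n => ‖∑ kl ∈ Finset.HasAntidiagonal.antidiagonal n, (cg kl.1 * (r : ℂ) ^ kl.1) * (ch kl.2 * (r : ℂ) ^ kl.2)‖) :=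
      summable_norm_sum_mul_antidiagonal_of_summable_norm
        (f := fun k => cg k * (r : ℂ) ^ k) (g := fun k => ch k * (r : ℂ) ^ k) sg sh
    have heq : ∀ θ : ℝ, ∑' k : ℕ, (p.coeff k * (r : ℂ) ^ k) * eE k θ =
        ∑' n : ℕ, (∑ kl ∈ Finset.HasAntidiagonal.antidiagonal n, (cg kl.1 * (r : ℂ) ^ kl.1) * (ch kl.2 * (r : ℂ) ^ kl.2)) * eE n θ := by
      intro θ
      rw [← ep, hp _ (hmem r hr.1.le hr.2.le θ), eg, eh,
        tsum_mul_tsum_eq_tsum_sum_antidiagonal_of_summable_norm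
          (f := fun k => cg k * (r : ℂ) ^ k * eE k θ) (g := fun k => ch k * (r : ℂ) ^ k * eE k θ)
          (by simpa [eE_norm] using sg) (by simpa [eE_norm] using sh)]
      congr 1; ext n
      rw [Finset.sum_mul]
      refine Finset.sum_congr rfl fun kl hkl => ?_
      rw [← Finset.HasAntidiagonal.mem_antidiagonal.1 hkl]
      push_cast
      rw [eE_add]; ring
    intro n
    have h1 := eE_coeff _ sp (fun k => (k : ℤ)) Nat.cast_injective n
    have h2 := eE_coeff _ ss (fun k => (k : ℤ)) Nat.cast_injective n
    simp_rw [heq] at h1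
    rw [h2] at h1
    have : (2 * (Real.pi : ℂ)) ≠ 0 := by simp [Real.pi_ne_zero]
    exact (mul_left_cancel₀ this h1).symm
  have lim1 : Tendsto (fun r : ℝ => ∑ j ∈ Finset.range J, ‖p.coeff (N j) * (r : ℂ) ^ (N j)‖ ^ 2)
      (nhdsWithin 1 (Ioo 0 1)) (nhds (∑ j ∈ Finset.range J, ‖p.coeff (N j)‖ ^ 2)) := by
    have : Continuous (fun r : ℝ => ∑ j ∈ Finset.range J, ‖p.coeff (N j) * (r : ℂ) ^ (N j)‖ ^ 2) := by fun_prop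
    have := (this.tendsto 1).mono_left (nhdsWithin_le_nhds (s := Ioo 0 1))
    simpa using this
  have cg2 : ContinuousOn (fun z => ‖g z‖ ^ 2) (closedBall 0 1) := by
    have := hg.2; rw [closure_ball _ one_ne_zero] at this; exact this.norm.pow 2
  have ch2 : ContinuousOn (fun z => ‖h z‖ ^ 2) (closedBall 0 1) := by
    have := hh.2; rw [closure_ball _ one_ne_zero] at this; exact this.norm.pow 2
  have lim2 := ((((circ_tendsto _ cg2).const_mul (2 * Real.pi)⁻¹)).mul
    ((circ_tendsto _ ch2).const_mul (2 * Real.pi)⁻¹)).const_mul 4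
  have := le_of_tendsto_of_tendsto lim1 lim2 (by filter_upwards [self_mem_nhdsWithin] with r hr using main r hr)
  refine this.trans (le_of_eq ?_)
  have hs : ∀ θ : ℝ, Complex.exp (θ * Complex.I) ∈ sphere (0 : ℂ) 1 := by
    intro θ; simp [Complex.norm_exp_ofReal_mul_I]
  simp_rw [fun θ => (hn _ (hs θ)).1, fun θ => (hn _ (hs θ)).2]
  ring

lemma paley (d : ℕ → ℂ) (hd : Summable (fun k => ‖d k‖)) (N : ℕ → ℕ) (hN : ∀ j, 2 * N j < N (j + 1)) (J : ℕ) :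
    ∑ j ∈ Finset.range J, ‖d (N j)‖ ^ 2 ≤
      4 * ((2 * Real.pi)⁻¹ * ∫ θ in (-Real.pi)..Real.pi, ‖∑' k : ℕ, d k * eE k θ‖) ^ 2 := by
  let p : ℕ → Polynomial ℂ := fun M => ∑ k ∈ Finset.range M, Polynomial.monomial k (d k)
  have hpe : ∀ M (θ : ℝ), (p M).eval (Complex.exp (θ * Complex.I)) = ∑ k ∈ Finset.range M, d k * eE k θ := by
    intro M θ
    simp only [p, Polynomial.eval_finsetSum, Polynomial.eval_monomial, eE_nat]
  have hpc : ∀ M k, k < M → (p M).coeff k = d k := by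
    intro M k hk
    simp only [p, Polynomial.finsetSum_coeff, Polynomial.coeff_monomial]
    rw [Finset.sum_ite_eq' ]
    simp [hk]
  have h1 := fun M => paley_poly (p M) N hN J
  simp_rw [hpe] at h1
  have lim : Tendsto (fun M => ∫ θ in (-Real.pi)..Real.pi, ‖∑ k ∈ Finset.range M, d k * eE k θ‖) atTop
      (nhds (∫ θ in (-Real.pi)..Real.pi, ‖∑' k : ℕ, d k * eE k θ‖)) := by
    refine intervalIntegral.tendsto_integral_filter_of_dominated_convergence (fun _ => ∑' k, ‖d k‖) ?_ ?_ ?_ ?_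
    · refine Eventually.of_forall fun M => Continuous.aestronglyMeasurable ?_
      exact (continuous_finsetSum _ fun k _ => continuous_const.mul (eE_cont _)).norm
    · refine Eventually.of_forall fun M => Eventually.of_forall fun θ _ => ?_
      rw [norm_norm]
      refine (norm_sum_le _ _).trans ?_
      simp only [norm_mul, eE_norm, mul_one]
      exact hd.sum_le_tsum _ (fun _ _ => norm_nonneg _)
    · exact continuous_const.intervalIntegrable _ _
    · refine Eventually.of_forall fun θ _ => ?_
      refine Tendsto.norm ?_
      refine HasSum.tendsto_sum_nat (Summable.hasSum (Summable.of_norm ?_))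
      simpa [eE_norm] using hd
  refine ge_of_tendsto (((lim.const_mul (2 * Real.pi)⁻¹).pow 2).const_mul 4) ?_
  filter_upwards [eventually_gt_atTop (∑ j ∈ Finset.range J, N j)] with M hM
  refine le_trans (le_of_eq ?_) (h1 M)
  refine Finset.sum_congr rfl fun j hj => ?_
  rw [hpc]
  exact lt_of_le_of_lt (Finset.single_le_sum (f := N) (fun _ _ => Nat.zero_le _) hj) hM

/-- existence of a bump kernel with rapidly decaying Fourier coefficients -/
lemma exists_kernel (h : ℝ) (hh : 0 < h) (hh1 : h ≤ 1) : ∃ (q : ℤ → ℂ) (A : ℝ), q 0 ≠ 0 ∧ 0 ≤ A ∧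
    (∀ l, ‖q l‖ * (1 + |(l : ℝ)|) ^ 4 ≤ A) ∧
    (∀ θ ∈ Icc (-Real.pi) Real.pi, h ≤ |θ| → ∑' l, q l * eE l θ = 0) := by
  have hpi := Real.pi_pos
  have hpi3 := Real.pi_gt_three
  set ρ := h / (2 * Real.pi) with hρ
  have hρ0 : 0 < ρ := by positivity
  have hρ1 : ρ < 1 / 2 := by rw [hρ, div_lt_iff₀ (by positivity)]; nlinarith
  let φ : ContDiffBump (0 : ℝ) := ⟨ρ / 2, ρ, by positivity, by linarith⟩
  have hout : φ.rOut = ρ := rfl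
  let ψ : ℝ → ℂ := fun x => (φ x : ℂ)
  have hψc : HasCompactSupport ψ := φ.hasCompactSupport.comp_left (g := fun x : ℝ => (x : ℂ)) (by simp)
  have hψs : ContDiff ℝ (⊤ : ℕ∞) ψ := Complex.ofRealCLM.contDiff.comp φ.contDiff
  let S : SchwartzMap ℝ ℂ := hψc.toSchwartzMap hψs
  have hS : ∀ x, S x = (φ x : ℂ) := fun x => rfl
  let T := FourierTransform.fourier S
  obtain ⟨C0, hC0, h0⟩ := T.decay 0 0
  obtain ⟨C4, hC4, h4⟩ := T.decay 4 0
  refine ⟨fun l => T l, 8 * (C0 + C4), ?_, by positivity, ?_, ?_⟩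
  · have : T ((0 : ℤ) : ℝ) = ((∫ x, φ x : ℝ) : ℂ) := by
      simp only [T, SchwartzMap.fourier_coe, Real.fourier_eq]
      simp [hS]
      exact integral_ofReal
    change T ((0 : ℤ) : ℝ) ≠ 0
    rw [this]
    exact_mod_cast φ.integral_pos.ne'
  · intro l
    have a0 := h0 l
    have a4 := h4 l
    simp only [pow_zero, one_mul, norm_iteratedFDeriv_zero, Real.norm_eq_abs] at a0 a4
    have hb : (1 + |(l : ℝ)|) ^ 4 ≤ 8 * (1 + |(l : ℝ)| ^ 4) := by
      have := abs_nonneg (l : ℝ)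
      generalize |(l : ℝ)| = x at this
      nlinarith [sq_nonneg (x - 1), sq_nonneg (x ^ 2 - 1), sq_nonneg (x ^ 2 - x), sq_nonneg (x^2-2*x+1)]
    have := norm_nonneg (T l)
    calc ‖T l‖ * (1 + |(l : ℝ)|) ^ 4 ≤ ‖T l‖ * (8 * (1 + |(l : ℝ)| ^ 4)) := by gcongr
      _ ≤ _ := by linarith
  · intro θ hθ hhθ
    have hp := SchwartzMap.tsum_eq_tsum_fourier S (θ / (2 * Real.pi))
    have e1 : ∀ n : ℤ, fourier n ((θ / (2 * Real.pi) : ℝ) : UnitAddCircle) = eE n θ := by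
      intro n
      rw [fourier_coe_apply]
      unfold eE; congr 1
      have : (Real.pi : ℂ) ≠ 0 := by simp [Real.pi_ne_zero]
      push_cast; field_simp
    simp_rw [e1] at hp
    change ∑' l : ℤ, T l * eE l θ = 0
    rw [← hp]
    convert tsum_zero with n
    rw [hS]
    have : φ (θ / (2 * Real.pi) + n) = 0 := by
      apply φ.zero_of_le_dist
      rw [hout, Real.dist_eq, sub_zero]
      have hx1 : |θ / (2 * Real.pi)| ≤ 1 / 2 := by
        rw [abs_div, abs_of_pos (by positivity : 0 < 2 * Real.pi), div_le_iff₀ (by positivity)]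
        have := abs_le.2 hθ; linarith
      have hx2 : ρ ≤ |θ / (2 * Real.pi)| := by
        rw [abs_div, abs_of_pos (by positivity : 0 < 2 * Real.pi), hρ]
        gcongr
      rcases eq_or_ne n 0 with rfl | hn
      · simpa using hx2
      · have h1 : (1 : ℝ) ≤ |(n : ℝ)| := by exact_mod_cast Int.one_le_abs hn
        have h2 := abs_sub_abs_le_abs_sub (n : ℝ) (-(θ / (2 * Real.pi)))
        rw [abs_neg, sub_neg_eq_add, add_comm (n : ℝ)] at h2
        linarith
    simp [this]

lemma kernel_summable (q : ℤ → ℂ) (A : ℝ) (h : ∀ l, ‖q l‖ * (1 + |(l : ℝ)|) ^ 4 ≤ A) :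
    Summable (fun l => ‖q l‖) := by
  have hs : Summable (fun l : ℤ => A * (1 / |(l : ℝ)| ^ 2)) := by
    refine Summable.mul_left A ?_
    simpa using (Real.summable_one_div_int_pow (p := 2)).2 (by norm_num)
  refine Summable.of_norm_bounded_eventually hs ?_
  have : ∀ᶠ l : ℤ in cofinite, l ≠ 0 := by
    exact (Set.finite_singleton (0 : ℤ)).compl_mem_cofinite
  filter_upwards [this] with l hl
  rw [norm_norm]
  have h1 : (1 : ℝ) ≤ |(l : ℝ)| := by exact_mod_cast Int.one_le_abs hl
  have h2 := h l
  rw [mul_one_div, le_div_iff₀ (by positivity)]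
  refine le_trans ?_ h2
  gcongr
  calc |(l : ℝ)| ^ 2 ≤ (1 + |(l : ℝ)|) ^ 2 := by gcongr; linarith
    _ ≤ _ := pow_le_pow_right₀ (by linarith) (by norm_num)

open Complex.HadamardThreeLines in
/-- uniqueness: a Laurent series vanishing on an arc of the outer boundary -/
lemma strip_unique (β : ℤ → ℂ) (u : ℤ → ℝ) (hu : Summable u) (D : ℝ) (hD : 0 < D)
    (h1 : ∀ m, ‖β m‖ ≤ u m) (h2 : ∀ m, ‖β m‖ * Real.exp (-m * D) ≤ u m)
    (t₀ h : ℝ) (hh : 0 < h) (hz : ∀ t ∈ Icc (t₀ - h) (t₀ + h), ∑' m, β m * eE m t = 0) :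
    β 0 = 0 := by
  have hpi := Real.pi_pos
  -- the function on the strip
  let g : ℂ → ℂ := fun w => ∑' m : ℤ, β m * Complex.exp (-m * D * w)
  have hterm : ∀ m : ℤ, ∀ w ∈ verticalClosedStrip 0 1, ‖β m * Complex.exp (-m * D * w)‖ ≤ u m := by
    intro m w hw
    have hw0 : 0 ≤ w.re := hw.1
    have hw1 : w.re ≤ 1 := hw.2
    rw [norm_mul, Complex.norm_exp]
    have hre : (-m * D * w : ℂ).re = -m * D * w.re := by
      have : (-m * D * w : ℂ) = ((-m * D : ℝ) : ℂ) * w := by push_cast; ring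
      rw [this, Complex.re_ofReal_mul]
    rw [hre]
    rcases le_total 0 m with hm | hm
    · have hm' : (0 : ℝ) ≤ m := by exact_mod_cast hm
      refine le_trans ?_ (h1 m)
      refine mul_le_of_le_one_right (norm_nonneg _) ?_
      rw [Real.exp_le_one_iff]
      nlinarith [mul_nonneg (mul_nonneg hm' hD.le) hw0]
    · have hm' : (m : ℝ) ≤ 0 := by exact_mod_cast hm
      refine le_trans ?_ (h2 m)
      refine mul_le_mul_of_nonneg_left (Real.exp_le_exp.2 ?_) (norm_nonneg _)
      nlinarith [mul_nonneg (mul_nonneg (neg_nonneg.2 hm') hD.le) (sub_nonneg.2 hw1)]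
  have hopen : IsOpen (verticalStrip 0 1) := isOpen_Ioo.preimage Complex.continuous_re
  have hsub : verticalStrip 0 1 ⊆ verticalClosedStrip 0 1 := fun w hw => ⟨hw.1.le, hw.2.le⟩
  have hclos : closure (verticalStrip 0 1) ⊆ verticalClosedStrip 0 1 :=
    closure_minimal hsub (isClosed_Icc.preimage Complex.continuous_re)
  have hgd : DifferentiableOn ℂ g (verticalStrip 0 1) := by
    refine Complex.differentiableOn_tsum_of_summable_norm hu ?_ hopen ?_
    · intro m; exact Differentiable.differentiableOn (by fun_prop)
    · intro m w hw; exact hterm m w (hsub hw)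
  have hgc : ContinuousOn g (verticalClosedStrip 0 1) := by
    refine continuousOn_tsum ?_ hu hterm
    intro m; exact Continuous.continuousOn (by fun_prop)
  have hgb : ∀ w ∈ verticalClosedStrip 0 1, ‖g w‖ ≤ ∑' m, u m :=
    fun w hw => tsum_of_norm_bounded hu.hasSum (fun m => hterm m w hw)
  -- boundary values
  have hbd : ∀ y : ℝ, g (Complex.I * y) = ∑' m, β m * eE m (-(D * y)) := by
    intro y
    simp only [g, eE]
    congr 1; ext m; congr 2; push_cast; ring
  obtain ⟨N, hN⟩ := exists_nat_gt (2 * Real.pi / h)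
  have hN0 : 0 < N := by
    rcases Nat.eq_zero_or_pos N with h0 | h0
    · rw [h0] at hN; have : 0 < 2 * Real.pi / h := by positivity
      simp at hN; linarith
    · exact h0
  have hNr : (0 : ℝ) < N := by exact_mod_cast hN0
  set τ : ℝ := 2 * Real.pi / (D * N) with hτ
  have hτ0 : 0 < τ := by positivity
  let G : ℂ → ℂ := fun w => ∏ k ∈ Finset.range N, g (w + k * τ * Complex.I)
  have hshift : ∀ (k : ℕ) (w : ℂ), (w + k * τ * Complex.I).re = w.re := by
    intro k w; simp
  have hmap : ∀ k : ℕ, MapsTo (fun w : ℂ => w + k * τ * Complex.I) (verticalStrip 0 1) (verticalStrip 0 1) := by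
    intro k w hw
    simp only [verticalStrip, mem_preimage, hshift] at hw ⊢; exact hw
  have hmapc : ∀ k : ℕ, MapsTo (fun w : ℂ => w + k * τ * Complex.I) (verticalClosedStrip 0 1) (verticalClosedStrip 0 1) := by
    intro k w hw
    simp only [verticalClosedStrip, mem_preimage, hshift] at hw ⊢; exact hw
  have hGd : DiffContOnCl ℂ G (verticalStrip 0 1) := by
    constructor
    · refine DifferentiableOn.fun_finsetProd fun k _ => ?_
      exact hgd.comp (Differentiable.differentiableOn (by fun_prop)) (hmap k)
    · refine ContinuousOn.mono ?_ hclos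
      refine continuousOn_finsetProd _ fun k _ => ?_
      exact hgc.comp (Continuous.continuousOn (by fun_prop)) (hmapc k)
  have hGb : ∀ w ∈ verticalClosedStrip 0 1, ‖G w‖ ≤ (∑' m, u m) ^ N := by
    intro w hw
    simp only [G, norm_prod]
    calc _ ≤ ∏ k ∈ Finset.range N, (∑' m, u m) :=
          Finset.prod_le_prod (fun _ _ => norm_nonneg _) (fun k _ => hgb _ (hmapc k hw))
      _ = _ := by simp
  have hG0 : ∀ w ∈ Complex.re ⁻¹' {(0 : ℝ)}, ‖G w‖ ≤ 0 := by
    intro w hw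
    have hw' : w.re = 0 := hw
    -- find the k
    set y := w.im with hy
    have hwy : w = Complex.I * y := by
      apply Complex.ext <;> simp [hw', hy]
    -- want -(D (y + kτ)) ≡ in [t0 - h, t0 + h] mod 2π
    -- s := (-(D y) - t0)/(D τ); choose integer j = floor s
    set s := (-(D * y) - t₀) / (D * τ) with hs
    set j := ⌊s⌋ with hj
    have hDτ : 0 < D * τ := by positivity
    have hDτh : D * τ < h := by
      have : D * τ = 2 * Real.pi / N := by rw [hτ]; field_simp
      rw [this, div_lt_iff₀ hNr]
      rw [div_lt_iff₀ hh] at hN; linarith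
    have hj1 : (j : ℝ) ≤ s := Int.floor_le s
    have hj2 : s < j + 1 := Int.lt_floor_add_one s
    have hsD : s * (D * τ) = -(D * y) - t₀ := by rw [hs]; field_simp
    -- k = j mod N
    have hNz : (N : ℤ) ≠ 0 := by exact_mod_cast hN0.ne'
    set k := (j % N).toNat with hk
    have hkz : ((k : ℕ) : ℤ) = j % N := Int.toNat_of_nonneg (Int.emod_nonneg _ hNz)
    have hkN : k < N := by
      have := Int.emod_lt_of_pos j (by exact_mod_cast hN0 : (0 : ℤ) < N)
      zify; rw [hkz]; exact this
    have hjk : j = k + N * (j / N) := by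
      rw [hkz]; exact (Int.emod_add_mul_ediv j N).symm
    rw [norm_le_zero_iff]
    refine Finset.prod_eq_zero (Finset.mem_range.2 hkN) ?_
    have e1 : w + k * τ * Complex.I = Complex.I * ((y + k * τ : ℝ) : ℂ) := by
      rw [hwy]; push_cast; ring
    rw [e1, hbd]
    have e2 : ∀ m : ℤ, eE m (-(D * (y + k * τ))) = eE m (-(D * (y + j * τ))) := by
      intro m
      unfold eE
      rw [Complex.exp_eq_exp_iff_exists_int]
      refine ⟨m * (j / N), ?_⟩
      have hjr : (j : ℂ) = k + N * ((j / N : ℤ) : ℂ) := by exact_mod_cast congrArg (Int.cast : ℤ → ℂ) hjk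
      have hD' : (D : ℂ) ≠ 0 := by exact_mod_cast hD.ne'
      have hN' : (N : ℂ) ≠ 0 := by exact_mod_cast hN0.ne'
      rw [hτ]; push_cast; rw [hjr]; field_simp; ring
    simp_rw [e2]
    apply hz
    constructor
    · nlinarith
    · nlinarith
  have hGz : ∀ w ∈ verticalStrip 0 1, G w = 0 := by
    intro w hw
    have := norm_le_interp_of_mem_verticalClosedStrip' (f := G) (z := w) (a := 0) (b := (∑' m, u m) ^ N)
      (l := 0) (u := 1) one_pos (hsub hw) hGd ⟨(∑' m, u m) ^ N, by
        rintro _ ⟨z, hz, rfl⟩; exact hGb z hz⟩ hG0 (fun z hz => hGb z (by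
          have : z.re = 1 := hz
          simp [verticalClosedStrip, this]))
    rw [Real.zero_rpow, zero_mul, norm_le_zero_iff] at this
    · exact this
    · have : w.re < 1 := hw.2
      simp; linarith
  -- one factor vanishes identically
  have hgan : AnalyticOnNhd ℂ g (verticalStrip 0 1) := hgd.analyticOnNhd hopen
  have hpre : IsPreconnected (verticalStrip 0 1) :=
    ((convex_Ioo (0 : ℝ) 1).linear_preimage Complex.reLm).isPreconnected
  set w₀ : ℂ := ((1 / 2 : ℝ) : ℂ) with hw₀
  have hw₀m : w₀ ∈ verticalStrip 0 1 := by
    simp only [verticalStrip, mem_preimage, hw₀, Complex.ofReal_re]; norm_num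
  have hfreq : ∃ k ∈ Finset.range N, ∃ᶠ w in nhdsWithin w₀ {w₀}ᶜ, g (w + k * τ * Complex.I) = 0 := by
    by_contra hcon
    push Not at hcon
    have hall : ∀ᶠ w in nhdsWithin w₀ {w₀}ᶜ, ∀ k ∈ Finset.range N, ¬ g (w + k * τ * Complex.I) = 0 := by
      rw [Filter.eventually_all_finset]
      intro k hk
      exact hcon k hk
    have hin : ∀ᶠ w in nhdsWithin w₀ {w₀}ᶜ, w ∈ verticalStrip 0 1 :=
      nhdsWithin_le_nhds (hopen.mem_nhds hw₀m)
    obtain ⟨w, hw1, hw2⟩ := (hall.and hin).exists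
    have := hGz w hw2
    rw [Finset.prod_eq_zero_iff] at this
    obtain ⟨k, hk, hk0⟩ := this
    exact hw1 k hk hk0
  obtain ⟨k, hk, hfk⟩ := hfreq
  have hgkan : AnalyticOnNhd ℂ (fun w => g (w + k * τ * Complex.I)) (verticalStrip 0 1) :=
    DifferentiableOn.analyticOnNhd (hgd.comp (Differentiable.differentiableOn (by fun_prop)) (hmap k)) hopen
  have hgk := hgkan.eqOn_zero_of_preconnected_of_frequently_eq_zero hpre hw₀m hfk
  have hgz : ∀ w ∈ verticalStrip 0 1, g w = 0 := by
    intro w hw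
    have := hgk (x := w - k * τ * Complex.I) (by
      simp only [verticalStrip, mem_preimage] at hw ⊢
      simpa using hw)
    simpa using this
  -- extract the coefficient on the line re = 1/2
  have hsumm : Summable (fun m : ℤ => ‖β m * Complex.exp (-m * D * w₀)‖) :=
    Summable.of_nonneg_of_le (fun _ => norm_nonneg _) (fun m => hterm m w₀ (hsub hw₀m)) hu
  have hc := eE_coeff (fun m : ℤ => β m * Complex.exp (-m * D * w₀)) hsumm id Function.injective_id 0
  have hzero : ∀ θ : ℝ, ∑' m : ℤ, β m * Complex.exp (-m * D * w₀) * eE (id m) θ = 0 := by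
    intro θ
    have := hgz (w₀ - θ / D * Complex.I) (by
      simp only [verticalStrip, mem_preimage] at hw₀m ⊢
      have e : (w₀ - θ / D * Complex.I).re = w₀.re := by
        rw [← Complex.ofReal_div]; simp
      rw [e]; exact hw₀m)
    rw [← this]
    simp only [g, eE, id]
    congr 1; ext m
    rw [mul_assoc, ← Complex.exp_add]
    congr 2
    have hD' : (D : ℂ) ≠ 0 := by exact_mod_cast hD.ne'
    field_simp; ring
  simp only [hzero] at hc
  have : (Real.pi : ℂ) ≠ 0 := by simp [Real.pi_ne_zero]
  simpa [this] using hc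

lemma conv_decay (a : ℕ → ℂ) (C₀ : ℝ) (ha : ∀ m, ‖a m‖ ≤ C₀) (q : ℤ → ℂ) (A h M : ℝ)
    (hh : 0 < h) (hh1 : h ≤ 1) (hA : 0 ≤ A)
    (hq : ∀ l, ‖q l‖ * (1 + |(l : ℝ)|) ^ 4 ≤ A)
    (hsupp : ∀ θ ∈ Icc (-Real.pi) Real.pi, h ≤ |θ| → ∑' l, q l * eE l θ = 0)
    (hM : ∀ r : ℝ, 0 < r → r < 1 → ∫ θ in (-h)..h, ‖∑' m : ℕ, a m * (r : ℂ) ^ m * eE m θ‖ ≤ M)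
    (N : ℕ → ℕ) (hN : ∀ j, 2 * N j < N (j + 1)) :
    Tendsto (fun j => ∑' m : ℕ, a m * q (N j - m)) atTop (nhds 0) := by
  have hpi := Real.pi_pos
  have hpi3 := Real.pi_gt_three
  have hC₀ : 0 ≤ C₀ := (norm_nonneg _).trans (ha 0)
  have hqs := kernel_summable q A hq
  set Q := ∑' l, ‖q l‖ with hQ
  have hQ0 : 0 ≤ Q := tsum_nonneg fun _ => norm_nonneg _
  have hZs : Summable (fun m : ℕ => 1 / ((m : ℝ) + 1) ^ 2) := by
    have := (summable_nat_add_iff 1).2 (Real.summable_one_div_nat_pow (p := 2).2 (by norm_num))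
    simpa using this
  set Z := ∑' m : ℕ, 1 / ((m : ℝ) + 1) ^ 2 with hZ
  have hqneg : ∀ n m : ℕ, ‖q (-((n : ℤ) + 1) - m)‖ ≤ A * (1 / ((n : ℝ) + 1) ^ 2) * (1 / ((m : ℝ) + 1) ^ 2) := by
    intro n m
    have h1 := hq (-((n : ℤ) + 1) - m)
    have h2 : |((-((n : ℤ) + 1) - m : ℤ) : ℝ)| = n + m + 1 := by
      push_cast
      rw [abs_of_nonpos (by have : (0 : ℝ) ≤ n := n.cast_nonneg; have : (0 : ℝ) ≤ m := m.cast_nonneg; linarith)]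
      ring
    rw [h2] at h1
    have h3 : ((n : ℝ) + 1) ^ 2 * ((m : ℝ) + 1) ^ 2 ≤ (1 + ((n : ℝ) + m + 1)) ^ 4 := by
      have hn : (0 : ℝ) ≤ n := n.cast_nonneg
      have hm : (0 : ℝ) ≤ m := m.cast_nonneg
      calc ((n : ℝ) + 1) ^ 2 * ((m : ℝ) + 1) ^ 2 ≤ (1 + ((n : ℝ) + m + 1)) ^ 2 * (1 + ((n : ℝ) + m + 1)) ^ 2 := by
            have i1 : (n : ℝ) + 1 ≤ 1 + ((n : ℝ) + m + 1) := by linarith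
            have i2 : (m : ℝ) + 1 ≤ 1 + ((n : ℝ) + m + 1) := by linarith
            exact mul_le_mul (pow_le_pow_left₀ (by linarith) i1 2) (pow_le_pow_left₀ (by linarith) i2 2)
              (by positivity) (by positivity)
        _ = _ := by ring
    have h4 : ‖q (-((n : ℤ) + 1) - m)‖ * (((n : ℝ) + 1) ^ 2 * ((m : ℝ) + 1) ^ 2) ≤ A :=
      le_trans (mul_le_mul_of_nonneg_left h3 (norm_nonneg _)) h1
    rw [mul_one_div, mul_one_div, div_div, le_div_iff₀ (by positivity)]
    exact h4
  set K₁ := C₀ * A * Z * Z with hK₁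
  set K := (2 * Real.pi)⁻¹ * (Q * M + 2 * Real.pi * K₁) with hK
  -- main estimate for fixed r
  have main : ∀ r ∈ Ioo (0 : ℝ) 1, ∀ J, ∑ j ∈ Finset.range J, ‖∑' m : ℕ, a m * (r : ℂ) ^ m * q (N j - m)‖ ^ 2
      ≤ 4 * K ^ 2 := by
    intro r hr J
    have hr0 := hr.1
    have hr1 := hr.2
    let c : ℤ → ℂ := fun n => ∑' m : ℕ, a m * (r : ℂ) ^ m * q (n - m)
    have hrn : ∀ m : ℕ, ‖(r : ℂ) ^ m‖ = r ^ m := by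
      intro m; rw [norm_pow, Complex.norm_real, Real.norm_of_nonneg hr0.le]
    have has : Summable (fun m : ℕ => ‖a m * (r : ℂ) ^ m‖) := by
      refine Summable.of_nonneg_of_le (fun _ => norm_nonneg _) (fun m => ?_)
        ((summable_geometric_of_lt_one hr0.le hr1).mul_left C₀)
      rw [norm_mul, hrn]
      exact mul_le_mul_of_nonneg_right (ha m) (by positivity)
    let e : ℤ × ℕ ≃ ℤ × ℕ :=
      { toFun := fun x => (x.1 - x.2, x.2)
        invFun := fun x => (x.1 + x.2, x.2)
        left_inv := fun x => by simp
        right_inv := fun x => by simp }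
    have hTs : Summable (fun x : ℤ × ℕ => ‖a x.2 * (r : ℂ) ^ x.2 * q (x.1 - x.2)‖) := by
      have h1 : Summable (fun x : ℤ × ℕ => ‖q x.1‖ * ‖a x.2 * (r : ℂ) ^ x.2‖) :=
        hqs.mul_of_nonneg has (fun _ => norm_nonneg _) (fun _ => norm_nonneg _)
      have h2 := (e.summable_iff).2 h1
      refine h2.congr fun x => ?_
      simp only [Function.comp, e, Equiv.coe_fn_mk]
      rw [← norm_mul, mul_comm]
    have hcs : Summable (fun n => ‖c n‖) := by
      refine Summable.of_nonneg_of_le (fun _ => norm_nonneg _) (fun n => ?_) hTs.prod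
      exact norm_tsum_le_tsum_norm (hTs.prod_factor n)
    have hsum : ∀ θ : ℝ, ∑' n, c n * eE n θ
        = (∑' l, q l * eE l θ) * (∑' m : ℕ, a m * (r : ℂ) ^ m * eE m θ) := by
      intro θ
      have s1 : Summable (fun l => ‖q l * eE l θ‖) := by simpa [eE_norm] using hqs
      have s2 : Summable (fun m : ℕ => ‖a m * (r : ℂ) ^ m * eE m θ‖) := by
        refine has.congr fun m => ?_
        rw [norm_mul _ (eE _ _), eE_norm, mul_one]
      have s3 : Summable (fun x : ℤ × ℕ => a x.2 * (r : ℂ) ^ x.2 * q (x.1 - x.2) * eE x.1 θ) := by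
        refine Summable.of_norm (hTs.congr fun x => ?_)
        rw [norm_mul _ (eE _ _), eE_norm, mul_one]
      rw [tsum_mul_tsum_of_summable_norm s1 s2, ← e.tsum_eq]
      have : ∀ x : ℤ × ℕ, (q (e x).1 * eE (e x).1 θ) * (a (e x).2 * (r : ℂ) ^ (e x).2 * eE (e x).2 θ)
          = a x.2 * (r : ℂ) ^ x.2 * q (x.1 - x.2) * eE x.1 θ := by
        intro x
        simp only [e, Equiv.coe_fn_mk]
        have : eE x.1 θ = eE (x.1 - x.2) θ * eE x.2 θ := by rw [← eE_add]; congr 1; ring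
        rw [this]; ring
      simp_rw [this]
      rw [s3.tsum_prod]
      congr 1; ext n
      simp only [c]
      rw [← tsum_mul_right]
    have hneg : ∀ n : ℕ, ‖c (-((n : ℤ) + 1))‖ ≤ C₀ * A * Z * (1 / ((n : ℝ) + 1) ^ 2) := by
      intro n
      have : HasSum (fun m : ℕ => C₀ * (A * (1 / ((n : ℝ) + 1) ^ 2) * (1 / ((m : ℝ) + 1) ^ 2)))
          (C₀ * (A * (1 / ((n : ℝ) + 1) ^ 2) * Z)) := (hZs.hasSum.mul_left _).mul_left _
      refine (tsum_of_norm_bounded this fun m => ?_).trans (le_of_eq (by ring))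
      rw [norm_mul, norm_mul, hrn]
      refine mul_le_mul ?_ (hqneg n m) (norm_nonneg _) hC₀
      exact (mul_le_of_le_one_right (norm_nonneg _) (pow_le_one₀ hr0.le hr1.le)).trans (ha m)
    have hnegsum : ∀ θ : ℝ, ‖∑' n : ℕ, c (-((n : ℤ) + 1)) * eE (-((n : ℤ) + 1)) θ‖ ≤ K₁ := by
      intro θ
      refine tsum_of_norm_bounded (hZs.hasSum.mul_left (C₀ * A * Z)) fun n => ?_
      rw [norm_mul, eE_norm, mul_one]
      exact hneg n
    have hcN : Summable (fun n : ℕ => ‖c n‖) := hcs.comp_injective Nat.cast_injective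
    have hcneg : Summable (fun n : ℕ => ‖c (-((n : ℤ) + 1))‖) :=
      hcs.comp_injective (i := fun n : ℕ => -((n : ℤ) + 1)) (fun x y hxy => by simpa using hxy)
    have hsplit : ∀ θ : ℝ, ∑' n : ℕ, c n * eE n θ = (∑' l, q l * eE l θ) * (∑' m : ℕ, a m * (r : ℂ) ^ m * eE m θ)
        - ∑' n : ℕ, c (-((n : ℤ) + 1)) * eE (-((n : ℤ) + 1)) θ := by
      intro θ
      rw [← hsum θ, tsum_of_nat_of_neg_add_one (f := fun n : ℤ => c n * eE n θ)]
      · ring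
      · exact Summable.of_norm (by simpa [eE_norm] using hcN)
      · refine Summable.of_norm (hcneg.congr fun n => ?_)
        rw [norm_mul, eE_norm, mul_one]
    have hFc : Continuous (fun θ => ∑' m : ℕ, a m * (r : ℂ) ^ m * eE m θ) :=
      eE_sum_cont (fun m : ℕ => a m * (r : ℂ) ^ m) has (fun m => (m : ℤ))
    have hPc : Continuous (fun θ => ∑' l, q l * eE l θ) := eE_sum_cont q hqs id
    have hcc : Continuous (fun θ => ∑' n : ℕ, c n * eE n θ) :=
      eE_sum_cont (fun n : ℕ => c n) hcN (fun m => (m : ℤ))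
    have hPb : ∀ θ, ‖∑' l, q l * eE l θ‖ ≤ Q := by
      intro θ
      refine tsum_of_norm_bounded hqs.hasSum fun l => ?_
      rw [norm_mul, eE_norm, mul_one]
    set P : ℝ → ℂ := fun θ => ∑' l, q l * eE l θ with hP
    set F : ℝ → ℂ := fun θ => ∑' m : ℕ, a m * (r : ℂ) ^ m * eE m θ with hF
    have hI1 : ∫ θ in (-Real.pi)..Real.pi, ‖P θ * F θ‖ ≤ Q * M := by
      have hc : Continuous (fun θ => ‖P θ * F θ‖) := (hPc.mul hFc).norm
      have hii : ∀ x y, IntervalIntegrable (fun θ => ‖P θ * F θ‖) volume x y := fun x y => hc.intervalIntegrable x y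
      rw [← intervalIntegral.integral_add_adjacent_intervals (hii (-Real.pi) (-h)) (hii (-h) Real.pi),
        ← intervalIntegral.integral_add_adjacent_intervals (hii (-h) h) (hii h Real.pi)]
      have z1 : ∫ θ in (-Real.pi)..(-h), ‖P θ * F θ‖ = 0 := by
        rw [intervalIntegral.integral_congr (g := fun _ => 0), intervalIntegral.integral_zero]
        intro θ hθ
        rw [uIcc_of_le (by linarith)] at hθ
        have : P θ = 0 := hsupp θ ⟨hθ.1, by linarith [hθ.2]⟩ (by rw [abs_of_nonpos] <;> linarith [hθ.2])
        simp [this]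
      have z2 : ∫ θ in h..Real.pi, ‖P θ * F θ‖ = 0 := by
        rw [intervalIntegral.integral_congr (g := fun _ => 0), intervalIntegral.integral_zero]
        intro θ hθ
        rw [uIcc_of_le (by linarith)] at hθ
        have : P θ = 0 := hsupp θ ⟨by linarith [hθ.1], hθ.2⟩ (by rw [abs_of_nonneg] <;> linarith [hθ.1])
        simp [this]
      rw [z1, z2, zero_add, add_zero]
      calc ∫ θ in (-h)..h, ‖P θ * F θ‖ ≤ ∫ θ in (-h)..h, Q * ‖F θ‖ := by
            refine intervalIntegral.integral_mono_on (by linarith) (hii _ _)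
              ((continuous_const.mul hFc.norm).intervalIntegrable _ _) fun θ _ => ?_
            rw [norm_mul]
            exact mul_le_mul_of_nonneg_right (hPb θ) (norm_nonneg _)
        _ = Q * ∫ θ in (-h)..h, ‖F θ‖ := intervalIntegral.integral_const_mul _ _
        _ ≤ Q * M := mul_le_mul_of_nonneg_left (hM r hr0 hr1) hQ0
    have hI2 : ∫ θ in (-Real.pi)..Real.pi, ‖∑' n : ℕ, c n * eE n θ‖ ≤ Q * M + 2 * Real.pi * K₁ := by
      calc ∫ θ in (-Real.pi)..Real.pi, ‖∑' n : ℕ, c n * eE n θ‖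
          ≤ ∫ θ in (-Real.pi)..Real.pi, (‖P θ * F θ‖ + K₁) := by
            refine intervalIntegral.integral_mono_on (by linarith) (hcc.norm.intervalIntegrable _ _)
              (((hPc.mul hFc).norm.add continuous_const).intervalIntegrable _ _) fun θ _ => ?_
            rw [hsplit θ]
            exact (norm_sub_le _ _).trans (add_le_add le_rfl (hnegsum θ))
        _ = (∫ θ in (-Real.pi)..Real.pi, ‖P θ * F θ‖) + ∫ θ in (-Real.pi)..Real.pi, K₁ :=
            intervalIntegral.integral_add ((hPc.mul hFc).norm.intervalIntegrable _ _)
              (continuous_const.intervalIntegrable _ _)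
        _ ≤ Q * M + 2 * Real.pi * K₁ := by
            rw [intervalIntegral.integral_const, smul_eq_mul]
            linarith
    have hp := paley (fun n : ℕ => c n) hcN N hN J
    refine hp.trans ?_
    have hnn : 0 ≤ ∫ θ in (-Real.pi)..Real.pi, ‖∑' n : ℕ, c n * eE n θ‖ :=
      intervalIntegral.integral_nonneg (by linarith) fun _ _ => norm_nonneg _
    gcongr
    exact mul_le_mul_of_nonneg_left hI2 (by positivity)
  -- let r → 1
  have hlim : ∀ J, ∑ j ∈ Finset.range J, ‖∑' m : ℕ, a m * q (N j - m)‖ ^ 2 ≤ 4 * K ^ 2 := by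
    intro J
    have : Tendsto (fun r : ℝ => ∑ j ∈ Finset.range J, ‖∑' m : ℕ, a m * (r : ℂ) ^ m * q (N j - m)‖ ^ 2)
        (nhdsWithin 1 (Ioo 0 1)) (nhds (∑ j ∈ Finset.range J, ‖∑' m : ℕ, a m * q (N j - m)‖ ^ 2)) := by
      refine tendsto_finsetSum _ fun j _ => ?_
      refine (Tendsto.norm ?_).pow 2
      refine tendsto_tsum_of_dominated_convergence (bound := fun m : ℕ => C₀ * ‖q (N j - m)‖) ?_ ?_ ?_
      · refine Summable.mul_left _ ?_
        exact hqs.comp_injective (i := fun m : ℕ => (N j : ℤ) - m) (fun x y hxy => by simpa using hxy)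
      · intro m
        have hc : Continuous (fun r : ℝ => a m * (r : ℂ) ^ m * q (N j - m)) := by fun_prop
        have := (hc.tendsto 1).mono_left (nhdsWithin_le_nhds (s := Ioo 0 1))
        simpa using this
      · filter_upwards [self_mem_nhdsWithin] with r hr m
        rw [norm_mul, norm_mul, norm_pow, Complex.norm_real, Real.norm_of_nonneg hr.1.le]
        refine mul_le_mul_of_nonneg_right ?_ (norm_nonneg _)
        exact (mul_le_of_le_one_right (norm_nonneg _) (pow_le_one₀ hr.1.le hr.2.le)).trans (ha m)
    refine le_of_tendsto this ?_
    filter_upwards [self_mem_nhdsWithin] with r hr using main r hr J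
  have hsm : Summable (fun j => ‖∑' m : ℕ, a m * q (N j - m)‖ ^ 2) :=
    summable_of_sum_range_le (fun _ => by positivity) hlim
  have h0 := hsm.tendsto_atTop_zero
  rw [tendsto_zero_iff_norm_tendsto_zero]
  have h1 := h0.sqrt
  simpa [Real.sqrt_sq (norm_nonneg _)] using h1

lemma right_limit_vanish (a : ℕ → ℂ) (C₀ : ℝ) (ha : ∀ m, ‖a m‖ ≤ C₀) (q : ℤ → ℂ)
    (hqs : Summable (fun l => ‖q l‖)) (N : ℕ → ℕ) (hN : StrictMono N) (b : ℤ → ℂ)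
    (hb : ∀ k : ℤ, Tendsto (fun j => a ((N j : ℤ) + k).toNat) atTop (nhds (b k))) (t : ℝ)
    (h0 : Tendsto (fun j => ∑' m : ℕ, (a m * eE m t) * q (N j - m)) atTop (nhds 0)) :
    ∑' k : ℤ, (b k * q (-k)) * eE k t = 0 := by
  have hC₀ : 0 ≤ C₀ := (norm_nonneg _).trans (ha 0)
  let G : ℕ → ℤ → ℂ := fun j k =>
    (if 0 ≤ (N j : ℤ) + k then a ((N j : ℤ) + k).toNat else 0) * q (-k) * eE k t
  have hG : ∀ j, ∑' m : ℕ, (a m * eE m t) * q (N j - m) = eE (N j) t * ∑' k, G j k := by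
    intro j
    have hinj : Function.Injective (fun m : ℕ => (m : ℤ) - N j) := fun x y hxy => by simpa using hxy
    rw [← hinj.tsum_eq (f := G j)]
    · rw [← tsum_mul_left]
      congr 1; ext m
      simp only [G]
      have e1 : (N j : ℤ) + ((m : ℤ) - N j) = m := by ring
      have e2 : eE (m : ℤ) t = eE (N j) t * eE ((m : ℤ) - N j) t := by rw [← eE_add, e1]
      rw [e1, e2, if_pos (by positivity), Int.toNat_natCast, neg_sub]; ring
    · intro k hk
      simp only [Function.mem_support, G] at hk
      have : 0 ≤ (N j : ℤ) + k := by
        by_contra hcon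
        rw [if_neg hcon] at hk; simp at hk
      refine ⟨((N j : ℤ) + k).toNat, ?_⟩
      simp only
      rw [Int.toNat_of_nonneg this]; ring
  have hG0 : Tendsto (fun j => ∑' k, G j k) atTop (nhds 0) := by
    rw [tendsto_zero_iff_norm_tendsto_zero] at h0 ⊢
    refine h0.congr fun j => ?_
    rw [hG, norm_mul, eE_norm, one_mul]
  have hG1 : Tendsto (fun j => ∑' k, G j k) atTop (nhds (∑' k : ℤ, (b k * q (-k)) * eE k t)) := by
    refine tendsto_tsum_of_dominated_convergence (bound := fun k => C₀ * ‖q (-k)‖) ?_ ?_ ?_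
    · refine Summable.mul_left _ ?_
      exact hqs.comp_injective (i := fun k : ℤ => -k) neg_injective
    · intro k
      refine Tendsto.mul_const _ (Tendsto.mul_const _ ?_)
      refine (hb k).congr' ?_
      filter_upwards [hN.tendsto_atTop.eventually_ge_atTop k.natAbs] with j hj
      rw [if_pos]; omega
    · refine Eventually.of_forall fun j k => ?_
      simp only [G]
      rw [norm_mul, norm_mul, eE_norm, mul_one]
      refine mul_le_mul_of_nonneg_right ?_ (norm_nonneg _)
      split_ifs
      · exact ha _
      · simpa using hC₀
  exact tendsto_nhds_unique hG1 hG0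

lemma exists_right_limit (a : ℕ → ℂ) (C₀ : ℝ) (ha : ∀ m, ‖a m‖ ≤ C₀) (n : ℕ → ℕ) (hn : StrictMono n) :
    ∃ (b : ℤ → ℂ) (φ : ℕ → ℕ), StrictMono φ ∧ (∀ j, 2 * n (φ j) < n (φ (j + 1))) ∧
      (∀ k : ℤ, Tendsto (fun j => a ((n (φ j) : ℤ) + k).toNat) atTop (nhds (b k))) := by
  have hcomp : IsCompact (Set.pi univ fun _ : ℤ => closedBall (0 : ℂ) C₀) :=
    isCompact_univ_pi fun _ => isCompact_closedBall _ _
  obtain ⟨b, _, φ, hφ, hlim⟩ := hcomp.tendsto_subseq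
    (x := fun j (k : ℤ) => a ((n j : ℤ) + k).toNat) (fun j k _ => by simpa using ha _)
  rw [tendsto_pi_nhds] at hlim
  let s : ℕ → ℕ := fun i => 2 * n (φ i) + 1 + i
  let ψ : ℕ → ℕ := fun j => s^[j] 0
  have hψs : ∀ j, ψ (j + 1) = 2 * n (φ (ψ j)) + 1 + ψ j := by
    intro j; simp only [ψ, Function.iterate_succ_apply']; rfl
  have hψ : StrictMono ψ := strictMono_nat_of_lt_succ fun j => by rw [hψs]; omega
  refine ⟨b, φ ∘ ψ, hφ.comp hψ, ?_, ?_⟩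
  · intro j
    have h1 := (hn.comp hφ).le_apply (x := ψ (j + 1))
    simp only [Function.comp] at h1 ⊢
    have h2 := hψs j
    omega
  · intro k
    exact (hlim k).comp hψ.tendsto_atTop

theorem stmt13 (a : ℕ → ℂ) (C₀ : ℝ) (hC₀ : ∀ n, ‖a n‖ ≤ C₀)
    (n : ℕ → ℕ) (hn : StrictMono n)
    (C D : ℝ) (hC : 0 < C) (hD : 0 < D)
    (hdecay : ∀ k : ℤ, k < 0 →
      Filter.limsup (fun j => ‖a ((n j : ℤ) + k).toNat‖) atTop ≤ C * Real.exp (-D * |k|))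
    (hpos : 0 < Filter.liminf (fun j => ‖a (n j)‖) atTop)
    (f : ℂ → ℂ) (hf : ∀ z ∈ Metric.ball (0 : ℂ) 1, f z = ∑' m : ℕ, a m * z ^ m) :
    StrongNaturalBoundary f := by
  intro α β hαβ ⟨M, hM⟩
  have hC₀0 : 0 ≤ C₀ := (norm_nonneg _).trans (hC₀ 0)
  have hpi := Real.pi_pos
  set t₀ := (α + β) / 2 with ht₀
  set h := min ((β - α) / 4) 1 with hh
  have hh0 : 0 < h := lt_min (by linarith) one_pos
  have hh1 : h ≤ 1 := min_le_right _ _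
  have hh4 : h ≤ (β - α) / 4 := min_le_left _ _
  obtain ⟨q, A, hq0, hA, hq, hsupp⟩ := exists_kernel h hh0 hh1
  have hqs := kernel_summable q A hq
  obtain ⟨b, φ, hφ, hlac, hb⟩ := exists_right_limit a C₀ hC₀ n hn
  have hbC₀ : ∀ k, ‖b k‖ ≤ C₀ := fun k =>
    le_of_tendsto (hb k).norm (Eventually.of_forall fun j => hC₀ _)
  have hbdec : ∀ k : ℤ, k < 0 → ‖b k‖ ≤ C * Real.exp (-D * |k|) := by
    intro k hk
    refine le_of_forall_pos_lt_add fun ε hε => ?_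
    have h1 : Filter.limsup (fun j => ‖a ((n j : ℤ) + k).toNat‖) atTop < C * Real.exp (-D * |k|) + ε / 2 := by
      have := hdecay k hk; linarith
    have h2 := eventually_lt_of_limsup_lt h1 ⟨C₀, by simpa using ⟨0, fun _ _ => hC₀ _⟩⟩
    have h3 := hφ.tendsto_atTop.eventually h2
    have h4 := le_of_tendsto (hb k).norm (h3.mono fun j hj => hj.le)
    linarith
  have hb0 : b 0 ≠ 0 := by
    obtain ⟨L, hL0, hL⟩ := exists_between hpos
    have h2 := eventually_lt_of_lt_liminf hL ⟨0, by simp⟩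
    have h3 := hφ.tendsto_atTop.eventually h2
    have hb0' := hb 0
    simp only [add_zero, Int.toNat_natCast] at hb0'
    have h4 := ge_of_tendsto hb0'.norm (h3.mono fun j hj => hj.le)
    intro hcon; rw [hcon, norm_zero] at h4; linarith
  have hfE : ∀ r : ℝ, 0 < r → r < 1 → ∀ θ : ℝ, f (r * Complex.exp (θ * Complex.I))
      = ∑' m : ℕ, a m * (r : ℂ) ^ m * eE m θ := by
    intro r hr hr1 θ
    rw [hf _ (by simp [Complex.norm_exp_ofReal_mul_I, abs_of_pos hr, hr1])]
    congr 1; ext m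
    rw [eE_nat, mul_pow]; ring
  have hvan : ∀ t ∈ Icc (t₀ - h) (t₀ + h), ∑' k : ℤ, (b k * q (-k)) * eE k t = 0 := by
    intro t ht
    refine right_limit_vanish a C₀ hC₀ q hqs (fun j => n (φ j)) (hn.comp hφ) b hb t ?_
    refine conv_decay (fun m => a m * eE m t) C₀ (fun m => by rw [norm_mul, eE_norm, mul_one]; exact hC₀ m)
      q A h (M * (2 * Real.pi)) hh0 hh1 hA hq hsupp ?_ (fun j => n (φ j)) hlac
    intro r hr hr1
    have e1 : ∀ θ : ℝ, ∑' m : ℕ, a m * eE m t * (r : ℂ) ^ m * eE m θ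
        = f (r * Complex.exp ((θ + t : ℝ) * Complex.I)) := by
      intro θ
      rw [hfE r hr hr1]
      congr 1; ext m
      rw [eE_add']; ring
    simp_rw [e1]
    rw [intervalIntegral.integral_comp_add_right (fun θ : ℝ => ‖f (r * Complex.exp (θ * Complex.I))‖)]
    have hcont : Continuous (fun θ : ℝ => ‖f (r * Complex.exp (θ * Complex.I))‖) := by
      simp_rw [hfE r hr hr1]
      refine (eE_sum_cont (fun m : ℕ => a m * (r : ℂ) ^ m) ?_ (fun m => (m : ℤ))).norm
      refine Summable.of_nonneg_of_le (fun _ => norm_nonneg _) (fun m => ?_)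
        ((summable_geometric_of_lt_one hr.le hr1).mul_left C₀)
      rw [norm_mul, norm_pow, Complex.norm_real, Real.norm_of_nonneg hr.le]
      exact mul_le_mul_of_nonneg_right (hC₀ m) (by positivity)
    have h1 := hM r hr hr1
    rw [div_le_iff₀ (by positivity)] at h1
    refine le_trans ?_ h1
    refine intervalIntegral.integral_mono_interval ?_ ?_ ?_ ?_ (hcont.intervalIntegrable _ _)
    · linarith [ht.1]
    · linarith
    · linarith [ht.2]
    · exact Eventually.of_forall fun _ => norm_nonneg _
  have hfin := strip_unique (fun k => b k * q (-k)) (fun k => (C₀ + C) * ‖q (-k)‖)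
    ((hqs.comp_injective (i := fun k : ℤ => -k) neg_injective).mul_left _) D hD ?_ ?_ t₀ h hh0 hvan
  · simp [hb0, hq0] at hfin
  · intro m
    rw [norm_mul]
    exact mul_le_mul_of_nonneg_right (by linarith [hbC₀ m]) (norm_nonneg _)
  · intro m
    rw [norm_mul, mul_right_comm]
    refine mul_le_mul_of_nonneg_right ?_ (norm_nonneg _)
    rcases le_or_gt 0 m with hm | hm
    · have hm' : (0 : ℝ) ≤ m := by exact_mod_cast hm
      have : Real.exp (-m * D) ≤ 1 := by rw [Real.exp_le_one_iff]; nlinarith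
      have := mul_le_of_le_one_right (norm_nonneg (b m)) this
      linarith [hbC₀ m]
    · have hm' : (m : ℝ) < 0 := by exact_mod_cast hm
      have h1 := mul_le_mul_of_nonneg_right (hbdec m hm) (Real.exp_pos (-m * D)).le
      have h2 : C * Real.exp (-D * |m|) * Real.exp (-m * D) = C := by
        rw [mul_assoc, ← Real.exp_add]
        push_cast
        rw [abs_of_neg hm', show -D * -(m : ℝ) + -m * D = 0 by ring, Real.exp_zero, mul_one]
      linarith
end

section
/- (Strong form of Szegő's theorem.) Let (a_n)_{n≥0} be a sequence of complex numbers taking values in a finite set F ⊂ ℂ. Then either f(z) = Σ_{n=0}^∞ a_n z^n has a strong natural boundary on ∂𝔻, or (a_n) is eventually periodic, i.e., there exist p ≥ 1 and N ≥ 0 with a_{n+p} = a_n for all n ≥ N (in which case f is a rational function whose poles lie among the p-th roots of unity). -/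
open Filter Metric Set MeasureTheory

lemma szego_rep {V : Type*} [SeminormedAddCommGroup V] [InnerProductSpace ℂ V]
    (L : V →ₗ[ℂ] ℂ) (C : ℝ) (hL : ∀ x, ‖L x‖ ≤ C * ‖x‖) :
    ∃ R : ℝ, ∀ τ : ℝ, 0 < τ → ∃ q : V, ‖q‖ ≤ R + τ ∧ ∀ w, ‖inner ℂ q w - L w‖ ≤ τ * ‖w‖ := by
  let Lc : V →L[ℂ] ℂ := L.mkContinuous C hL
  let e : V →L[ℂ] UniformSpace.Completion V := UniformSpace.Completion.toComplL
  let Le : UniformSpace.Completion V →L[ℂ] ℂ := Lc.extend e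
  have hext : ∀ w : V, Le (w : UniformSpace.Completion V) = L w := fun w =>
    ContinuousLinearMap.extend_eq Lc (e := e) UniformSpace.Completion.denseRange_coe
      (UniformSpace.Completion.isUniformInducing_coe V) w
  let v := (InnerProductSpace.toDual ℂ (UniformSpace.Completion V)).symm Le
  have hv : ∀ w, inner ℂ v w = Le w := fun w => InnerProductSpace.toDual_symm_apply
  refine ⟨‖v‖, fun τ hτ => ?_⟩
  obtain ⟨q, hq⟩ := (UniformSpace.Completion.denseRange_coe (α := V)).exists_dist_lt v hτ
  rw [dist_comm, dist_eq_norm] at hq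
  refine ⟨q, ?_, fun w => ?_⟩
  · rw [← UniformSpace.Completion.norm_coe q]
    have := norm_le_norm_add_norm_sub' (q : UniformSpace.Completion V) v
    linarith
  · rw [← hext, ← hv, ← UniformSpace.Completion.inner_coe, ← inner_sub_left]
    refine (norm_inner_le_norm _ _).trans ?_
    rw [UniformSpace.Completion.norm_coe]
    gcongr

lemma szego_hilbert {V : Type*} [SeminormedAddCommGroup V] [InnerProductSpace ℂ V]
    (L : V →ₗ[ℂ] ℂ) (C : ℝ) (hL : ∀ x, ‖L x‖ ≤ C * ‖x‖) (S : ℤ → V → V)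
    (hS : ∀ n m x y, inner ℂ (S n x) (S m y) = inner ℂ x (S (m - n) y))
    (hS' : ∀ n x y, inner ℂ (S n x) y = inner ℂ x (S (-n) y))
    (hSn : ∀ n x, ‖S n x‖ = ‖x‖)
    (h0 : ∀ x, Tendsto (fun n : ℕ => L (S n x)) atTop (nhds 0)) (x : V) :
    Tendsto (fun n : ℕ => L (S (-n) x)) atTop (nhds 0) := by
  obtain ⟨R, hR⟩ := szego_rep L C hL
  rw [NormedAddGroup.tendsto_nhds_zero]
  intro δ hδ
  by_contra hcon
  have hfreq : ∃ᶠ n : ℕ in atTop, δ ≤ ‖L (S (-n) x)‖ := by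
    simpa [Filter.Frequently] using hcon
  -- choose τ
  have hR0 : ∃ τ : ℝ, 0 < τ ∧ τ < 1 ∧ τ * ‖x‖ ≤ δ / 2 ∧ τ * (|R| + 2) * ‖x‖ ^ 2 < (δ / 2) ^ 2 := by
    have h1 : ∀ᶠ τ : ℝ in nhdsWithin 0 (Ioi 0), τ * ‖x‖ < δ / 2 :=
      (((continuous_id.mul continuous_const).tendsto' (0:ℝ) 0 (by simp)).eventually
        (gt_mem_nhds (by positivity))).filter_mono nhdsWithin_le_nhds
    have h2 : ∀ᶠ τ : ℝ in nhdsWithin 0 (Ioi 0), τ * (|R| + 2) * ‖x‖ ^ 2 < (δ / 2) ^ 2 :=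
      ((((continuous_id.mul continuous_const).mul continuous_const).tendsto' (0:ℝ) 0
        (by simp)).eventually (gt_mem_nhds (by positivity))).filter_mono nhdsWithin_le_nhds
    have h3 : ∀ᶠ τ : ℝ in nhdsWithin 0 (Ioi 0), τ < 1 :=
      (gt_mem_nhds one_pos).filter_mono nhdsWithin_le_nhds
    obtain ⟨τ, a, b, c, d⟩ := (h1.and (h2.and (h3.and self_mem_nhdsWithin))).exists
    exact ⟨τ, d, c, a.le, b⟩
  obtain ⟨τ, hτ, hτ1, hτx, hτ2⟩ := hR0
  obtain ⟨q, hqn, hq⟩ := hR τ hτ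
  set σ := τ * (|R| + 2) with hσ
  have hqn' : ‖q‖ ≤ |R| + 1 := hqn.trans (by linarith [le_abs_self R])
  have hσ0 : 0 < σ := by positivity
  have hcross : ∀ᶠ n : ℕ in atTop, ‖(inner ℂ q (S n q) : ℂ)‖ ≤ σ := by
    have := (NormedAddGroup.tendsto_nhds_zero.1 (h0 q)) τ hτ
    filter_upwards [this] with n hn
    have h1 := hq (S n q)
    rw [hSn] at h1
    have h2 := norm_le_norm_add_norm_sub' (inner ℂ q (S n q) : ℂ) (L (S n q))
    have : τ * ‖q‖ ≤ τ * (|R| + 1) := by gcongr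
    rw [hσ]; nlinarith
  have hfreq' : ∃ᶠ n : ℕ in atTop, δ / 2 ≤ ‖(inner ℂ (S n q) x : ℂ)‖ := by
    refine hfreq.mono fun n hn => ?_
    rw [hS']
    have h1 := hq (S (-n) x)
    rw [hSn] at h1
    have h2 := norm_le_norm_add_norm_sub (inner ℂ q (S (-n) x) : ℂ) (L (S (-n) x))
    linarith
  have key : ∀ K : ℕ, ∃ y : V, K * (δ / 2) ≤ (inner ℂ y x : ℂ).re ∧
      ‖y‖ ^ 2 ≤ K * ‖q‖ ^ 2 + K ^ 2 * σ ∧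
      ∀ᶠ n : ℕ in atTop, ‖(inner ℂ y (S n q) : ℂ)‖ ≤ K * σ := by
    intro K
    induction K with
    | zero => exact ⟨0, by simp⟩
    | succ K ih =>
      obtain ⟨y, hy1, hy2, hy3⟩ := ih
      obtain ⟨n, hn1, hn2⟩ := (hfreq'.and_eventually hy3).exists
      set w : ℂ := inner ℂ (S n q) x with hw
      have hw0 : 0 < ‖w‖ := by linarith
      have hwne : (‖w‖ : ℂ) ≠ 0 := by exact_mod_cast hw0.ne'
      let c : ℂ := w / ‖w‖
      have hc : ‖c‖ = 1 := by simp [c, hw0.ne']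
      have hcw : (starRingEnd ℂ) c * w = ‖w‖ := by
        simp only [c, map_div₀, Complex.conj_ofReal]
        rw [div_mul_eq_mul_div, div_eq_iff hwne, mul_comm, Complex.mul_conj,
          Complex.normSq_eq_norm_sq]
        push_cast; ring
      refine ⟨y + c • S n q, ?_, ?_, ?_⟩
      · rw [inner_add_left, inner_smul_left, ← hw, hcw]
        simp only [Complex.add_re, Complex.ofReal_re]
        push_cast; linarith
      · rw [@norm_add_sq ℂ]
        have h1 : RCLike.re (inner ℂ y (c • S n q) : ℂ) ≤ K * σ := by
          refine (RCLike.re_le_norm _).trans ?_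
          rw [inner_smul_right, norm_mul, hc, one_mul]; exact hn2
        rw [norm_smul, hc, one_mul, hSn]
        push_cast; nlinarith
      · have h4 : ∀ᶠ m : ℕ in atTop, ‖(inner ℂ q (S ((m:ℤ) - n) q) : ℂ)‖ ≤ σ := by
          obtain ⟨N, hN⟩ := eventually_atTop.1 hcross
          filter_upwards [eventually_ge_atTop (N + n)] with m hm
          have := hN (m - n) (by omega)
          rwa [Nat.cast_sub (by omega)] at this
        filter_upwards [h4, hy3] with m hm1 hm2
        rw [inner_add_left, inner_smul_left, hS]
        refine (norm_add_le _ _).trans ?_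
        rw [norm_mul, RCLike.norm_conj, hc, one_mul]
        push_cast; linarith
  -- contradiction
  have hK : ∀ K : ℕ, 0 < K → K * ((δ / 2) ^ 2 - σ * ‖x‖ ^ 2) ≤ ‖q‖ ^ 2 * ‖x‖ ^ 2 := by
    intro K hK
    obtain ⟨y, h1, h2, -⟩ := key K
    have h3 : K * (δ / 2) ≤ ‖y‖ * ‖x‖ :=
      h1.trans ((Complex.re_le_norm _).trans (norm_inner_le_norm _ _))
    have h4 : (K * (δ / 2)) ^ 2 ≤ (K * ‖q‖ ^ 2 + K ^ 2 * σ) * ‖x‖ ^ 2 := by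
      calc (K * (δ / 2)) ^ 2 ≤ (‖y‖ * ‖x‖) ^ 2 := by gcongr
        _ = ‖y‖ ^ 2 * ‖x‖ ^ 2 := by ring
        _ ≤ _ := by gcongr
    have hKp : (0:ℝ) < K := by exact_mod_cast hK
    refine le_of_mul_le_mul_left ?_ hKp
    nlinarith
  obtain ⟨K, hKK⟩ := exists_nat_gt (‖q‖ ^ 2 * ‖x‖ ^ 2 / ((δ / 2) ^ 2 - σ * ‖x‖ ^ 2))
  have hpos : 0 < (δ / 2) ^ 2 - σ * ‖x‖ ^ 2 := by linarith
  rw [div_lt_iff₀ hpos] at hKK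
  have hK0 : 0 < K := by
    rcases Nat.eq_zero_or_pos K with h | h
    · subst h; simp at hKK
      have : 0 ≤ ‖q‖ ^ 2 * ‖x‖ ^ 2 := by positivity
      linarith
    · exact h
  linarith [hK K hK0]

noncomputable def szegoT : (ℤ →₀ ℂ) →ₗ[ℂ] (ℝ → ℂ) :=
  Finsupp.linearCombination ℂ (fun (k : ℤ) (u : ℝ) => Complex.exp (k * u * Complex.I))

noncomputable def szegoS (n : ℤ) : (ℤ →₀ ℂ) →ₗ[ℂ] (ℤ →₀ ℂ) :=
  Finsupp.lmapDomain ℂ ℂ (fun k => k + n)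

lemma szegoT_single (k : ℤ) (z : ℂ) (u : ℝ) :
    szegoT (Finsupp.single k z) u = z * Complex.exp (k * u * Complex.I) := by
  simp [szegoT]

lemma szegoS_single (n k : ℤ) (z : ℂ) :
    szegoS n (Finsupp.single k z) = Finsupp.single (k + n) z := by
  simp [szegoS]

lemma szegoT_continuous (p : ℤ →₀ ℂ) : Continuous (szegoT p) := by
  induction p using Finsupp.induction_linear with
  | zero => rw [map_zero]; exact continuous_const
  | add f g hf hg => rw [map_add]; exact hf.add hg
  | single k z =>
    have : szegoT (Finsupp.single k z) = fun u : ℝ => z * Complex.exp (k * u * Complex.I) := by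
      funext u; exact szegoT_single k z u
    rw [this]; fun_prop

lemma szegoT_S (n : ℤ) (p : ℤ →₀ ℂ) (u : ℝ) :
    szegoT (szegoS n p) u = Complex.exp (n * u * Complex.I) * szegoT p u := by
  induction p using Finsupp.induction_linear with
  | zero => simp
  | add f g hf hg => simp only [map_add, Pi.add_apply, hf, hg]; ring
  | single k z =>
    rw [szegoS_single, szegoT_single, szegoT_single]
    have : (((k + n : ℤ) : ℂ) * u * Complex.I) = k * u * Complex.I + n * u * Complex.I := by
      push_cast; ring
    rw [this, Complex.exp_add]; ring

lemma szego_conj_exp (n : ℤ) (u : ℝ) :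
    (starRingEnd ℂ) (Complex.exp (n * u * Complex.I)) = Complex.exp ((-n : ℤ) * u * Complex.I) := by
  rw [← Complex.exp_conj]; simp

/-- The approximating forms. -/
noncomputable def szegoB (ε : ℝ) (G : ℝ → ℂ) (p q : ℤ →₀ ℂ) : ℂ :=
  ∫ u in -ε..ε, (starRingEnd ℂ) (szegoT p u) * szegoT q u * (‖G u‖ : ℂ)

lemma szegoB_int (ε : ℝ) {G : ℝ → ℂ} (hG : Continuous G) (p q : ℤ →₀ ℂ) :
    IntervalIntegrable (fun u => (starRingEnd ℂ) (szegoT p u) * szegoT q u * (‖G u‖ : ℂ))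
      volume (-ε) ε := by
  have h1 := szegoT_continuous p
  have h2 := szegoT_continuous q
  have h3 : Continuous fun u => (starRingEnd ℂ) (szegoT p u) := Complex.continuous_conj.comp h1
  have h4 : Continuous fun u => (‖G u‖ : ℂ) := Complex.continuous_ofReal.comp hG.norm
  exact ((h3.mul h2).mul h4).intervalIntegrable _ _

lemma szegoB_bound (ε : ℝ) (hε : 0 < ε) (M : ℝ) (p q : ℤ →₀ ℂ) :
    ∃ C : ℝ, ∀ G : ℝ → ℂ, Continuous G → (∫ u in -ε..ε, ‖G u‖) ≤ M → ‖szegoB ε G p q‖ ≤ C := by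
  obtain ⟨C1, h1⟩ := isCompact_Icc.exists_bound_of_continuousOn (s := Icc (-ε) ε)
    (szegoT_continuous p).continuousOn
  obtain ⟨C2, h2⟩ := isCompact_Icc.exists_bound_of_continuousOn (s := Icc (-ε) ε)
    (szegoT_continuous q).continuousOn
  have hC1 : 0 ≤ C1 := (norm_nonneg _).trans (h1 0 (by constructor <;> linarith))
  have hC2 : 0 ≤ C2 := (norm_nonneg _).trans (h2 0 (by constructor <;> linarith))
  refine ⟨C1 * C2 * M, fun G hG hM => ?_⟩
  have : ‖szegoB ε G p q‖ ≤ ∫ u in -ε..ε, C1 * C2 * ‖G u‖ := by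
    refine intervalIntegral.norm_integral_le_of_norm_le (by linarith) ?_
      ((continuous_const.mul hG.norm).intervalIntegrable _ _)
    refine Eventually.of_forall fun u hu => ?_
    have hu' : u ∈ Icc (-ε) ε := Ioc_subset_Icc_self hu
    rw [norm_mul, norm_mul, RCLike.norm_conj, Complex.norm_real, norm_norm]
    have := h1 u hu'
    have := h2 u hu'
    gcongr
  refine this.trans ?_
  rw [intervalIntegral.integral_const_mul]
  gcongr

lemma szegoB_add (ε : ℝ) {G : ℝ → ℂ} (hG : Continuous G) (p q s : ℤ →₀ ℂ) :
    szegoB ε G (p + q) s = szegoB ε G p s + szegoB ε G q s := by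
  unfold szegoB
  rw [← intervalIntegral.integral_add (szegoB_int ε hG p s) (szegoB_int ε hG q s)]
  congr 1; funext u; simp only [map_add, Pi.add_apply]; ring

lemma szegoB_smul (ε : ℝ) {G : ℝ → ℂ} (p s : ℤ →₀ ℂ) (r : ℂ) :
    szegoB ε G (r • p) s = (starRingEnd ℂ) r * szegoB ε G p s := by
  unfold szegoB
  rw [← intervalIntegral.integral_const_mul]
  congr 1; funext u; simp only [map_smul, Pi.smul_apply, smul_eq_mul, map_mul]; ring

lemma szegoB_conj (ε : ℝ) {G : ℝ → ℂ} (p q : ℤ →₀ ℂ) :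
    (starRingEnd ℂ) (szegoB ε G q p) = szegoB ε G p q := by
  unfold szegoB
  rw [← intervalIntegral.intervalIntegral_conj]
  congr 1; funext u
  simp only [map_mul, Complex.conj_conj, Complex.conj_ofReal]; ring

lemma szegoB_self (ε : ℝ) (G : ℝ → ℂ) (p : ℤ →₀ ℂ) :
    szegoB ε G p p = ((∫ u in -ε..ε, ‖szegoT p u‖ ^ 2 * ‖G u‖ : ℝ) : ℂ) := by
  unfold szegoB
  rw [← intervalIntegral.integral_ofReal]
  congr 1; funext u
  rw [mul_comm ((starRingEnd ℂ) _), Complex.mul_conj, Complex.normSq_eq_norm_sq]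
  push_cast; ring

lemma szegoB_S (ε : ℝ) (G : ℝ → ℂ) (p q : ℤ →₀ ℂ) (n m : ℤ) :
    szegoB ε G (szegoS n p) (szegoS m q) = szegoB ε G p (szegoS (m - n) q) := by
  unfold szegoB
  congr 1; funext u
  rw [szegoT_S, szegoT_S, szegoT_S, map_mul, szego_conj_exp]
  have : (((m - n : ℤ) : ℂ) * u * Complex.I) = (-n : ℤ) * u * Complex.I + m * u * Complex.I := by
    push_cast; ring
  rw [this, Complex.exp_add]; ring

lemma szegoS_zero (p : ℤ →₀ ℂ) : szegoS 0 p = p := by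
  induction p using Finsupp.induction_linear with
  | zero => simp
  | add f g hf hg => simp only [map_add, hf, hg]
  | single k z => rw [szegoS_single, add_zero]

lemma szego_L_bound (ε : ℝ) (hε : 0 < ε) (M : ℝ) {G : ℝ → ℂ} (hG : Continuous G)
    (hM : (∫ u in -ε..ε, ‖G u‖) ≤ M) (p : ℤ →₀ ℂ) :
    2 * ‖∫ u in -ε..ε, szegoT p u * G u‖ ≤ M + (szegoB ε G p p).re := by
  have hT := szegoT_continuous p
  rw [szegoB_self, Complex.ofReal_re]
  have i1 : IntervalIntegrable (fun u => ‖szegoT p u * G u‖) volume (-ε) ε :=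
    (hT.mul hG).norm.intervalIntegrable _ _
  have i2 : IntervalIntegrable (fun u => ‖szegoT p u‖ ^ 2 * ‖G u‖) volume (-ε) ε :=
    ((hT.norm.pow 2).mul hG.norm).intervalIntegrable _ _
  have i3 : IntervalIntegrable (fun u => ‖G u‖) volume (-ε) ε := hG.norm.intervalIntegrable _ _
  have h1 : ‖∫ u in -ε..ε, szegoT p u * G u‖ ≤ ∫ u in -ε..ε, ‖szegoT p u * G u‖ :=
    intervalIntegral.norm_integral_le_integral_norm (by linarith)
  have h2 : (∫ u in -ε..ε, 2 * ‖szegoT p u * G u‖) ≤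
      ∫ u in -ε..ε, (‖G u‖ + ‖szegoT p u‖ ^ 2 * ‖G u‖) := by
    refine intervalIntegral.integral_mono_on (by linarith) (i1.const_mul 2) (i3.add i2) ?_
    intro u _
    rw [norm_mul]
    nlinarith [mul_nonneg (sq_nonneg (‖szegoT p u‖ - 1)) (norm_nonneg (G u))]
  rw [intervalIntegral.integral_const_mul, intervalIntegral.integral_add i3 i2] at h2
  linarith

lemma szego_rajchman (ε : ℝ) (hε : 0 < ε) {ι : Type*} (l : Filter ι) [NeBot l] (G : ι → ℝ → ℂ)
    (hG : ∀ i, Continuous (G i)) (M : ℝ) (hM : ∀ i, (∫ u in -ε..ε, ‖G i u‖) ≤ M) (c : ℤ → ℂ)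
    (hc : ∀ k : ℤ, Tendsto (fun i => ∫ u in -ε..ε, Complex.exp (k * u * Complex.I) * G i u) l
      (nhds (c k)))
    (h0 : Tendsto (fun n : ℕ => c n) atTop (nhds 0)) :
    Tendsto (fun n : ℕ => c (-n)) atTop (nhds 0) := by
  let 𝒰 : Ultrafilter ι := Ultrafilter.of l
  have h𝒰 : (𝒰 : Filter ι) ≤ l := Ultrafilter.of_le l
  have hB : ∀ p q, ∃ b : ℂ, Tendsto (fun i => szegoB ε (G i) p q) 𝒰 (nhds b) := by
    intro p q
    obtain ⟨C, hC⟩ := szegoB_bound ε hε M p q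
    obtain ⟨b, -, hb⟩ := (isCompact_closedBall (0 : ℂ) C).ultrafilter_le_nhds
      (𝒰.map fun i => szegoB ε (G i) p q) (by
        rw [le_principal_iff]
        rw [Ultrafilter.coe_map, Filter.mem_map]
        exact Eventually.of_forall fun i => by simpa using hC (G i) (hG i) (hM i))
    exact ⟨b, hb⟩
  choose B hB using hB
  let L : (ℤ →₀ ℂ) →ₗ[ℂ] ℂ := Finsupp.linearCombination ℂ c
  have hLs : ∀ k z, L (Finsupp.single k z) = z * c k := by intro k z; simp [L]
  have hL : ∀ p, Tendsto (fun i => ∫ u in -ε..ε, szegoT p u * G i u) l (nhds (L p)) := by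
    intro p
    induction p using Finsupp.induction_linear with
    | zero => simp
    | add f g hf hg =>
      rw [map_add L]
      refine (hf.add hg).congr fun i => ?_
      rw [← intervalIntegral.integral_add]
      · congr 1; funext u; simp only [map_add, Pi.add_apply]; ring
      · exact ((szegoT_continuous f).mul (hG i)).intervalIntegrable _ _
      · exact ((szegoT_continuous g).mul (hG i)).intervalIntegrable _ _
    | single k z =>
      rw [hLs]
      refine ((hc k).const_mul z).congr fun i => ?_
      rw [← intervalIntegral.integral_const_mul]
      congr 1; funext u; rw [szegoT_single]; ring
  let cd : PreInnerProductSpace.Core ℂ (ℤ →₀ ℂ) :=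
    { inner := B
      conj_inner_symm := fun p q => by
        refine tendsto_nhds_unique ((Complex.continuous_conj.tendsto _).comp (hB q p)) ?_
        refine (hB p q).congr fun i => (szegoB_conj ε p q).symm
      re_inner_nonneg := fun p => by
        refine ge_of_tendsto' ((Complex.continuous_re.tendsto _).comp (hB p p)) fun i => ?_
        simp only [Function.comp, szegoB_self, Complex.ofReal_re]
        exact intervalIntegral.integral_nonneg (by linarith) fun u _ => by positivity
      add_left := fun p q s => by
        refine tendsto_nhds_unique (hB _ _) ?_
        exact ((hB p s).add (hB q s)).congr fun i => (szegoB_add ε (hG i) p q s).symm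
      smul_left := fun p s r => by
        refine tendsto_nhds_unique (hB _ _) ?_
        exact ((hB p s).const_mul _).congr fun i => (szegoB_smul ε p s r).symm }
  have hBS : ∀ n m p q, B (szegoS n p) (szegoS m q) = B p (szegoS (m - n) q) := by
    intro n m p q
    refine tendsto_nhds_unique (hB _ _) ?_
    exact (hB _ _).congr fun i => (szegoB_S ε (G i) p q n m).symm
  have hLB : ∀ p, 2 * ‖L p‖ ≤ M + (B p p).re := by
    intro p
    refine le_of_tendsto_of_tendsto' (((hL p).mono_left h𝒰).norm.const_mul 2)
      (((Complex.continuous_re.tendsto _).comp (hB p p)).const_add M) fun i => ?_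
    exact szego_L_bound ε hε M (hG i) (hM i) p
  let _ : SeminormedAddCommGroup (ℤ →₀ ℂ) := 
    @InnerProductSpace.Core.toSeminormedAddCommGroup ℂ (ℤ →₀ ℂ) _ _ _ cd
  let _ : InnerProductSpace ℂ (ℤ →₀ ℂ) := InnerProductSpace.ofCore cd
  have hin : ∀ p q : ℤ →₀ ℂ, inner ℂ p q = B p q := fun p q => rfl
  have hnorm : ∀ p : ℤ →₀ ℂ, (B p p).re = ‖p‖ ^ 2 := fun p => by
    rw [← hin]; exact (norm_sq_eq_re_inner (𝕜 := ℂ) p).symm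
  have hM0 : 0 ≤ M := by
    have := hLB 0
    rw [hnorm] at this
    simpa using this
  have hLC : ∀ p, ‖L p‖ ≤ Real.sqrt M * ‖p‖ := by
    intro p
    have hq : ∀ s : ℝ, 0 ≤ ‖p‖ ^ 2 * (s * s) + (-2 * ‖L p‖) * s + M := by
      intro s
      have h := hLB ((s : ℂ) • p)
      rw [hnorm, norm_smul, map_smul, norm_smul, Complex.norm_real, Real.norm_eq_abs] at h
      have : s * ‖L p‖ ≤ |s| * ‖L p‖ := by gcongr; exact le_abs_self s
      have h2 : (|s| * ‖p‖) ^ 2 = ‖p‖ ^ 2 * (s * s) := by rw [mul_pow, sq_abs]; ring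
      rw [h2] at h
      linarith
    have := discrim_le_zero hq
    rw [discrim] at this
    refine abs_le_of_sq_le_sq' ?_ (by positivity) |>.2
    rw [mul_pow, Real.sq_sqrt hM0]
    nlinarith
  have hSL : ∀ p, Tendsto (fun n : ℕ => L (szegoS n p)) atTop (nhds 0) := by
    intro p
    induction p using Finsupp.induction_linear with
    | zero => simp
    | add f g hf hg => simpa only [map_add, add_zero] using hf.add hg
    | single k z =>
      have h1 : Tendsto (fun n : ℕ => c (k + n)) atTop (nhds 0) := by
        rw [NormedAddGroup.tendsto_nhds_zero] at h0 ⊢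
        intro e he
        obtain ⟨N, hN⟩ := eventually_atTop.1 (h0 e he)
        filter_upwards [eventually_ge_atTop (N + k.natAbs)] with n hn
        have := hN (k + n).toNat (by omega)
        rwa [Int.toNat_of_nonneg (by omega)] at this
      simpa [szegoS_single, hLs] using h1.const_mul z
  have := szego_hilbert L (Real.sqrt M) hLC (fun n p => szegoS n p)
    (fun n m p q => hBS n m p q)
    (fun n p q => by
      have := hBS n 0 p q
      rw [szegoS_zero, zero_sub] at this
      exact this)
    (fun n p => by
      have h : ‖szegoS n p‖ ^ 2 = ‖p‖ ^ 2 := by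
        rw [← hnorm, ← hnorm, hBS, sub_self, szegoS_zero]
      exact (sq_eq_sq₀ (norm_nonneg _) (norm_nonneg _)).1 h)
    hSL (Finsupp.single 0 1)
  simpa [szegoS_single, hLs] using this

noncomputable def szegoPsi (ε : ℝ) (j : ℤ) : ℂ :=
  ∫ u in -ε..ε, Complex.exp (j * u * Complex.I) * ((ε : ℂ) ^ 2 - (u : ℂ) ^ 2) ^ 2

lemma szegoPsi_zero (ε : ℝ) (hε : 0 < ε) : szegoPsi ε 0 ≠ 0 := by
  have h1 : szegoPsi ε 0 = ((∫ u in -ε..ε, (ε ^ 2 - u ^ 2) ^ 2 : ℝ) : ℂ) := by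
    rw [szegoPsi, ← intervalIntegral.integral_ofReal]
    congr 1; funext u; simp
  rw [h1]
  have : 0 < ∫ u in -ε..ε, (ε ^ 2 - u ^ 2) ^ 2 := by
    refine intervalIntegral.intervalIntegral_pos_of_pos_on
      (by apply Continuous.intervalIntegrable; fun_prop) ?_ (by linarith)
    intro u hu
    have h1 := hu.1
    have h2 := hu.2
    have : 0 < ε ^ 2 - u ^ 2 := by nlinarith
    positivity
  exact_mod_cast this.ne'

lemma szegoPsi_bound (ε : ℝ) (hε : 0 < ε) :
    ∃ C : ℝ, ∀ j : ℤ, j ≠ 0 → ‖szegoPsi ε j‖ ≤ C * (1 / (j : ℝ) ^ 2) := by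
  refine ⟨16 * ε ^ 2 * (2 * ε), fun j hj => ?_⟩
  have hjc : (j : ℂ) * Complex.I ≠ 0 := by simp [hj]
  have hE : ∀ u : ℝ, HasDerivAt (fun u : ℝ => Complex.exp (j * u * Complex.I) / (j * Complex.I))
      (Complex.exp (j * u * Complex.I)) u := by
    intro u
    have h1 : HasDerivAt (fun u : ℂ => Complex.exp (j * u * Complex.I) / (j * Complex.I))
        (Complex.exp (j * u * Complex.I) * (j * 1 * Complex.I) / (j * Complex.I)) (u : ℂ) :=
      ((((hasDerivAt_id _).const_mul (j:ℂ)).mul_const Complex.I).cexp).div_const _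
    have h2 := h1.comp_ofReal
    convert h2 using 1
    field_simp
  have hE2 : ∀ u : ℝ, HasDerivAt (fun u : ℝ => Complex.exp (j * u * Complex.I) / (j * Complex.I) ^ 2)
      (Complex.exp (j * u * Complex.I) / (j * Complex.I)) u := by
    intro u
    have := (hE u).div_const (j * Complex.I)
    refine this.congr_of_eventuallyEq (Eventually.of_forall fun u => ?_)
    simp only
    field_simp
  have hp1 : ∀ u : ℝ, HasDerivAt (fun u : ℝ => ((ε : ℂ) ^ 2 - (u : ℂ) ^ 2) ^ 2)
      (-4 * u * ((ε : ℂ) ^ 2 - (u : ℂ) ^ 2)) u := by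
    intro u
    have h1 : HasDerivAt (fun u : ℂ => ((ε : ℂ) ^ 2 - u ^ 2) ^ 2) _ (u : ℂ) :=
      (((hasDerivAt_id (u:ℂ)).pow 2).const_sub ((ε:ℂ)^2)).pow 2
    convert h1.comp_ofReal using 1
    simp; ring
  have hp2 : ∀ u : ℝ, HasDerivAt (fun u : ℝ => -4 * (u : ℂ) * ((ε : ℂ) ^ 2 - (u : ℂ) ^ 2))
      (-4 * (ε : ℂ) ^ 2 + 12 * (u : ℂ) ^ 2) u := by
    intro u
    have h1 : HasDerivAt (fun u : ℂ => -4 * u * ((ε : ℂ) ^ 2 - u ^ 2)) _ (u : ℂ) :=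
      ((hasDerivAt_id (u:ℂ)).const_mul (-4)).mul
        (((hasDerivAt_id (u:ℂ)).pow 2).const_sub ((ε:ℂ)^2))
    convert h1.comp_ofReal using 1
    simp; ring
  have s1 := intervalIntegral.integral_mul_deriv_eq_deriv_mul (a := -ε) (b := ε)
    (fun u _ => hp1 u) (fun u _ => hE u)
    (by apply Continuous.intervalIntegrable; fun_prop)
    (by apply Continuous.intervalIntegrable; fun_prop)
  have s2 := intervalIntegral.integral_mul_deriv_eq_deriv_mul (a := -ε) (b := ε)
    (fun u _ => hp2 u) (fun u _ => hE2 u)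
    (by apply Continuous.intervalIntegrable; fun_prop)
    (by apply Continuous.intervalIntegrable; fun_prop)
  rw [s2] at s1
  have e1 : szegoPsi ε j = ∫ u in -ε..ε, ((ε : ℂ) ^ 2 - (u : ℂ) ^ 2) ^ 2 * Complex.exp (j * u * Complex.I) := by
    rw [szegoPsi]; congr 1; funext u; ring
  rw [e1, s1]
  simp only [Complex.ofReal_neg, neg_sq, sub_self, mul_zero, zero_mul, zero_sub, neg_neg, ne_eq,
    OfNat.ofNat_ne_zero, not_false_eq_true, zero_pow]
  have hb : ∀ u ∈ Set.uIoc (-ε) ε, ‖(-4 * (ε : ℂ) ^ 2 + 12 * (u : ℂ) ^ 2) *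
      (Complex.exp (j * u * Complex.I) / (j * Complex.I) ^ 2)‖ ≤ 16 * ε ^ 2 * (1 / (j : ℝ) ^ 2) := by
    intro u hu
    rw [uIoc_of_le (by linarith)] at hu
    have hu2 : u ^ 2 ≤ ε ^ 2 := by nlinarith [hu.1, hu.2]
    rw [norm_mul, norm_div]
    have h1 : ‖Complex.exp (j * u * Complex.I)‖ = 1 := by
      have := Complex.norm_exp_ofReal_mul_I ((j : ℝ) * u)
      push_cast at this; exact this
    have h2 : ‖((j : ℂ) * Complex.I) ^ 2‖ = (j : ℝ) ^ 2 := by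
      rw [norm_pow, norm_mul, Complex.norm_I, mul_one, Complex.norm_intCast, sq_abs]
    rw [h1, h2]
    gcongr
    have h3 : (-4 * (ε : ℂ) ^ 2 + 12 * (u : ℂ) ^ 2) = ((-4 * ε ^ 2 + 12 * u ^ 2 : ℝ) : ℂ) := by
      push_cast; ring
    rw [h3, Complex.norm_real, Real.norm_eq_abs, abs_le]
    constructor <;> nlinarith [sq_nonneg u]
  have := intervalIntegral.norm_integral_le_of_norm_le_const hb
  refine this.trans (le_of_eq ?_)
  rw [abs_of_pos (by linarith)]; ring

lemma szegoPsi_summable (ε : ℝ) (hε : 0 < ε) : Summable fun j : ℤ => ‖szegoPsi ε j‖ := by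
  obtain ⟨C, hC⟩ := szegoPsi_bound ε hε
  refine Summable.of_norm_bounded_eventually
    (g := fun j : ℤ => C * (1 / (j : ℝ) ^ 2))
    ((Real.summable_one_div_int_pow.2 one_lt_two).mul_left C) ?_
  have : ({0}ᶜ : Set ℤ) ∈ cofinite := (Set.finite_singleton (0:ℤ)).compl_mem_cofinite
  filter_upwards [this] with j hj
  rw [norm_norm]; exact hC j hj

lemma szego_cont (a : ℕ → ℂ) (A : ℝ) (ha : ∀ m, ‖a m‖ ≤ A) (r : ℝ) (hr : 0 < r) (hr1 : r < 1) :
    Continuous fun u : ℝ => ∑' m : ℕ, a m * (r * Complex.exp (u * Complex.I)) ^ m := by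
  refine continuous_tsum (u := fun m => A * r ^ m) (fun m => by fun_prop)
    ((summable_geometric_of_lt_one hr.le hr1).mul_left A) fun m u => ?_
  rw [norm_mul, norm_pow, norm_mul, Complex.norm_exp_ofReal_mul_I, mul_one, Complex.norm_real,
    Real.norm_eq_abs, abs_of_pos hr]
  gcongr; exact ha m

lemma szego_fourier (a : ℕ → ℂ) (A : ℝ) (ha : ∀ m, ‖a m‖ ≤ A) (r : ℝ) (hr : 0 < r) (hr1 : r < 1)
    (ε : ℝ) (hε : 0 < ε) (k : ℤ) :
    ∫ u in -ε..ε, Complex.exp (k * u * Complex.I) * (((ε : ℂ) ^ 2 - (u : ℂ) ^ 2) ^ 2 *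
      ∑' m : ℕ, a m * (r * Complex.exp (u * Complex.I)) ^ m)
      = ∑' m : ℕ, a m * r ^ m * szegoPsi ε (m + k) := by
  have hnorm : ∀ (m : ℕ) (u : ℝ), ‖a m * (r * Complex.exp (u * Complex.I)) ^ m‖ ≤ A * r ^ m := by
    intro m u
    rw [norm_mul, norm_pow, norm_mul, Complex.norm_exp_ofReal_mul_I, mul_one, Complex.norm_real,
      Real.norm_eq_abs, abs_of_pos hr]
    gcongr; exact ha m
  have hsum : Summable fun m : ℕ => A * r ^ m :=
    (summable_geometric_of_lt_one hr.le hr1).mul_left A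
  have hphi : ∀ u ∈ Set.uIoc (-ε) ε, ‖Complex.exp (k * u * Complex.I) *
      ((ε : ℂ) ^ 2 - (u : ℂ) ^ 2) ^ 2‖ ≤ ε ^ 4 := by
    intro u hu
    rw [uIoc_of_le (by linarith)] at hu
    have hu2 : u ^ 2 ≤ ε ^ 2 := by nlinarith [hu.1, hu.2]
    have h1 : ‖Complex.exp (k * u * Complex.I)‖ = 1 := by
      have := Complex.norm_exp_ofReal_mul_I ((k : ℝ) * u)
      push_cast at this; exact this
    rw [norm_mul, h1, one_mul, norm_pow]
    have h3 : ((ε : ℂ) ^ 2 - (u : ℂ) ^ 2) = ((ε ^ 2 - u ^ 2 : ℝ) : ℂ) := by push_cast; ring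
    rw [h3, Complex.norm_real, Real.norm_eq_abs, sq_abs]
    nlinarith [sq_nonneg u]
  have key := intervalIntegral.hasSum_integral_of_dominated_convergence (μ := volume)
    (a := -ε) (b := ε)
    (F := fun (m : ℕ) (u : ℝ) => (Complex.exp (k * u * Complex.I) *
      ((ε : ℂ) ^ 2 - (u : ℂ) ^ 2) ^ 2) * (a m * (r * Complex.exp (u * Complex.I)) ^ m))
    (f := fun u : ℝ => (Complex.exp (k * u * Complex.I) *
      ((ε : ℂ) ^ 2 - (u : ℂ) ^ 2) ^ 2) * ∑' m : ℕ, (a m * (r * Complex.exp (u * Complex.I)) ^ m))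
    (fun m _ => ε ^ 4 * (A * r ^ m))
    (fun m => by
      apply Continuous.aestronglyMeasurable
      fun_prop)
    (fun m => Eventually.of_forall fun u hu => by
      rw [norm_mul]
      exact mul_le_mul (hphi u hu) (hnorm m u) (norm_nonneg _) (by positivity))
    (Eventually.of_forall fun u _ => hsum.mul_left _)
    (by simp)
    (Eventually.of_forall fun u _ =>
      ((Summable.of_norm_bounded hsum (fun m => hnorm m u)).hasSum).mul_left _)
  have h1 := key.tsum_eq
  simp only [mul_assoc] at h1 ⊢
  rw [← h1]
  congr 1; funext m
  rw [szegoPsi, ← intervalIntegral.integral_const_mul, ← intervalIntegral.integral_const_mul]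
  congr 1; funext u
  have : (((m + k : ℤ) : ℂ) * (u * Complex.I)) = k * (u * Complex.I) + m * (u * Complex.I) := by
    push_cast; ring
  rw [mul_pow, ← Complex.exp_nat_mul, mul_assoc ((_ : ℤ) : ℂ), this, Complex.exp_add]; ring

lemma szego_A (a : ℕ → ℂ) (A : ℝ) (ha : ∀ m, ‖a m‖ ≤ A) (ε : ℝ) (hε : 0 < ε) (M : ℝ)
    (hM : ∀ r : ℝ, 0 < r → r < 1 →
      ∫ u in -ε..ε, ‖∑' m : ℕ, a m * (r * Complex.exp (u * Complex.I)) ^ m‖ ≤ M) :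
    Tendsto (fun n : ℕ => ∑' m : ℕ, a m * szegoPsi ε (m - n)) atTop (nhds 0) := by
  have hA : 0 ≤ A := (norm_nonneg _).trans (ha 0)
  let ρ : ℕ → ℝ := fun j => 1 - 1 / ((j : ℝ) + 2)
  have hρ1 : ∀ j, ρ j < 1 := fun j => by
    have : 0 < 1 / ((j : ℝ) + 2) := by positivity
    simp only [ρ]; linarith
  have hρ0 : ∀ j, 0 < ρ j := fun j => by
    have : 1 / ((j : ℝ) + 2) < 1 := by
      rw [div_lt_one (by positivity)]
      have : (0:ℝ) ≤ j := Nat.cast_nonneg j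
      linarith
    simp only [ρ]; linarith
  have hρ : Tendsto ρ atTop (nhds 1) := by
    have h1 : Tendsto (fun j : ℕ => 1 / ((j : ℝ) + 2)) atTop (nhds 0) := by
      refine tendsto_const_nhds.div_atTop ?_
      exact tendsto_atTop_add_const_right _ _ tendsto_natCast_atTop_atTop
    simpa [ρ] using h1.const_sub 1
  have hsumm : ∀ k : ℤ, Summable fun m : ℕ => ‖szegoPsi ε (m + k)‖ := fun k =>
    (szegoPsi_summable ε hε).comp_injective
      (i := fun m : ℕ => (m : ℤ) + k) (fun x y h => by simpa using h)
  have := szego_rajchman ε hε atTop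
    (fun (j : ℕ) (u : ℝ) => ((ε : ℂ) ^ 2 - (u : ℂ) ^ 2) ^ 2 *
      ∑' m : ℕ, a m * (ρ j * Complex.exp (u * Complex.I)) ^ m)
    (fun j => (by fun_prop : Continuous fun u : ℝ => ((ε : ℂ) ^ 2 - (u : ℂ) ^ 2) ^ 2).mul
      (szego_cont a A ha (ρ j) (hρ0 j) (hρ1 j)))
    (ε ^ 4 * M)
    (fun j => by
      have hc := (szego_cont a A ha (ρ j) (hρ0 j) (hρ1 j))
      have : ∫ u in -ε..ε, ‖((ε : ℂ) ^ 2 - (u : ℂ) ^ 2) ^ 2 *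
          ∑' m : ℕ, a m * (ρ j * Complex.exp (u * Complex.I)) ^ m‖ ≤
          ∫ u in -ε..ε, ε ^ 4 * ‖∑' m : ℕ, a m * (ρ j * Complex.exp (u * Complex.I)) ^ m‖ := by
        refine intervalIntegral.integral_mono_on (by linarith) ?_ ?_ ?_
        · exact (((by fun_prop : Continuous fun u : ℝ =>
            ((ε : ℂ) ^ 2 - (u : ℂ) ^ 2) ^ 2).mul hc).norm).intervalIntegrable _ _
        · exact (continuous_const.mul hc.norm).intervalIntegrable _ _
        · intro u hu
          rw [norm_mul]
          gcongr
          have hu2 : u ^ 2 ≤ ε ^ 2 := by nlinarith [hu.1, hu.2]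
          have h3 : ((ε : ℂ) ^ 2 - (u : ℂ) ^ 2) = ((ε ^ 2 - u ^ 2 : ℝ) : ℂ) := by push_cast; ring
          rw [norm_pow, h3, Complex.norm_real, Real.norm_eq_abs, sq_abs]
          nlinarith [sq_nonneg u]
      refine this.trans ?_
      rw [intervalIntegral.integral_const_mul]
      gcongr
      exact hM _ (hρ0 j) (hρ1 j))
    (fun k => ∑' m : ℕ, a m * szegoPsi ε (m + k))
    (fun k => by
      simp_rw [szego_fourier a A ha _ (hρ0 _) (hρ1 _) ε hε k]
      refine tendsto_tsum_of_dominated_convergence ((hsumm k).mul_left A) ?_ ?_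
      · intro m
        have h1 : Tendsto (fun j => ((ρ j : ℂ)) ^ m) atTop (nhds 1) := by
          have := ((Complex.continuous_ofReal.tendsto 1).comp hρ).pow m
          simpa using this
        have := (h1.const_mul (a m)).mul_const (szegoPsi ε (m + k))
        simpa using this
      · refine Eventually.of_forall fun j m => ?_
        rw [norm_mul, norm_mul, norm_pow, Complex.norm_real, Real.norm_eq_abs, abs_of_pos (hρ0 j)]
        gcongr
        exact (mul_le_of_le_one_right (norm_nonneg _)
          (pow_le_one₀ (hρ0 j).le (hρ1 j).le)).trans (ha m))
    (by
      have h1 := (tendsto_sum_nat_add fun i : ℕ => ‖szegoPsi ε i‖).const_mul A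
      rw [mul_zero] at h1
      refine squeeze_zero_norm (fun n => ?_) h1
      rw [← tsum_mul_left]
      refine tsum_of_norm_bounded (Summable.hasSum ?_) fun m => ?_
      · have := (hsumm n).mul_left A
        simpa using this
      · rw [norm_mul]
        push_cast
        gcongr
        exact ha m)
  simpa [sub_eq_add_neg] using this

lemma szego_vanish (c : ℕ → ℂ) (hc : Summable fun k => ‖c k‖) (t₀ η : ℝ) (hη : 0 < η)
    (h : ∀ t : ℝ, |t - t₀| < η → ∑' k : ℕ, c k * Complex.exp (t * Complex.I) ^ k = 0) : c 0 = 0 := by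
  let K : ℂ → ℂ := fun z => ∑' k : ℕ, c k * z ^ k
  have hbd : ∀ k : ℕ, ∀ z : ℂ, z ∈ closedBall (0:ℂ) 1 → ‖c k * z ^ k‖ ≤ ‖c k‖ := by
    intro k z hz
    rw [norm_mul, norm_pow]
    have : ‖z‖ ≤ 1 := by simpa using hz
    exact mul_le_of_le_one_right (norm_nonneg _) (pow_le_one₀ (norm_nonneg _) this)
  have hKd : DiffContOnCl ℂ K (ball 0 1) := by
    constructor
    · exact Complex.differentiableOn_tsum_of_summable_norm hc
        (fun i => by fun_prop) isOpen_ball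
        (fun i w hw => hbd i w (ball_subset_closedBall hw))
    · rw [closure_ball _ one_ne_zero]
      exact continuousOn_tsum (fun i => by fun_prop) hc hbd
  obtain ⟨N, hN⟩ := exists_nat_gt (2 * Real.pi / η)
  have hpi := Real.pi_pos
  have hN0 : (0:ℝ) < N := lt_trans (by positivity) hN
  let ω : ℤ → ℂ := fun j => Complex.exp (((2 * Real.pi * j / N : ℝ) : ℂ) * Complex.I)
  have hω : ∀ j, ‖ω j‖ = 1 := fun j => Complex.norm_exp_ofReal_mul_I _
  have hωmod : ∀ j : ℤ, ω (j % N) = ω j := by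
    intro j
    have h1 : j = j % N + N * (j / N) := (Int.emod_add_mul_ediv j N).symm
    have h2 : (j : ℝ) = (j % N : ℤ) + N * (j / N : ℤ) := by exact_mod_cast h1
    have h3 : (2 * Real.pi * j / N : ℝ) = 2 * Real.pi * (j % N : ℤ) / N + (j / N : ℤ) * (2 * Real.pi) := by
      rw [h2]; field_simp
    simp only [ω]
    rw [h3]
    have h4 : (((2 * Real.pi * (j % N : ℤ) / N + (j / N : ℤ) * (2 * Real.pi) : ℝ) : ℂ) * Complex.I) =
        ((2 * Real.pi * (j % N : ℤ) / N : ℝ) : ℂ) * Complex.I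
          + ((j / N : ℤ) : ℂ) * (2 * Real.pi * Complex.I) := by push_cast; ring
    rw [h4, Complex.exp_add, Complex.exp_int_mul_two_pi_mul_I, mul_one]
  let P : ℂ → ℂ := fun z => ∏ j ∈ Finset.range N, K (ω j * z)
  have hP : DiffContOnCl ℂ P (ball 0 1) := by
    have h1 : ∀ j : ℤ, DiffContOnCl ℂ (fun z => K (ω j * z)) (ball 0 1) := by
      intro j
      refine hKd.comp (g := fun z => ω j * z) ?_ ?_
      · exact (by fun_prop : Differentiable ℂ fun z => ω j * z).diffContOnCl
      · intro z hz
        simpa [hω] using hz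
    constructor
    · exact DifferentiableOn.fun_finsetProd fun j _ => (h1 j).1
    · exact continuousOn_finsetProd _ fun j _ => (h1 j).2
  have hfr : ∀ z ∈ frontier (ball (0:ℂ) 1), ‖P z‖ ≤ 0 := by
    intro z hz
    rw [frontier_ball _ one_ne_zero] at hz
    have hz1 : ‖z‖ = 1 := by simpa using hz
    obtain ⟨θ, hθ⟩ := (Complex.norm_eq_one_iff z).1 hz1
    let j : ℤ := ⌊(t₀ - θ) * N / (2 * Real.pi)⌋
    have hj1 : (j : ℝ) ≤ (t₀ - θ) * N / (2 * Real.pi) := Int.floor_le _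
    have hj2 : (t₀ - θ) * N / (2 * Real.pi) < j + 1 := Int.lt_floor_add_one _
    rw [le_div_iff₀ (by positivity)] at hj1
    rw [div_lt_iff₀ (by positivity)] at hj2
    rw [div_lt_iff₀ hη] at hN
    have hab : |(θ + 2 * Real.pi * j / N) - t₀| < η := by
      rw [abs_lt]
      have e : θ + 2 * Real.pi * j / N - t₀ = (j * (2 * Real.pi) - (t₀ - θ) * N) / N := by
        field_simp; ring
      rw [e, lt_div_iff₀ hN0, div_lt_iff₀ hN0]
      constructor <;> nlinarith
    have hK0 : K (ω j * z) = 0 := by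
      have := h _ hab
      have e : ω j * z = Complex.exp (((θ + 2 * Real.pi * j / N : ℝ) : ℂ) * Complex.I) := by
        rw [← hθ, ← Complex.exp_add]
        congr 1; push_cast; ring
      simp only [K]
      rw [e]; exact this
    have hPz : P z = 0 := by
      have hNz : (N : ℤ) ≠ 0 := by exact_mod_cast hN0.ne'
      have hnn : 0 ≤ j % N := Int.emod_nonneg _ hNz
      refine Finset.prod_eq_zero (i := (j % N).toNat) ?_ ?_
      · have := Int.emod_lt_of_pos j (by exact_mod_cast hN0 : (0:ℤ) < N)
        rw [Finset.mem_range]; omega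
      · rw [Int.toNat_of_nonneg hnn, hωmod]; exact hK0
    rw [hPz]; simp
  have hP0 := Complex.norm_le_of_forall_mem_frontier_norm_le isBounded_ball hP hfr
    (subset_closure (mem_ball_self (x := (0:ℂ)) one_pos))
  have hP0' : P 0 = 0 := norm_le_zero_iff.1 hP0
  simp only [P, mul_zero, Finset.prod_const] at hP0'
  have hK00 : K 0 = 0 := eq_zero_of_pow_eq_zero hP0'
  have : K 0 = c 0 := by
    simp only [K]
    rw [tsum_eq_single 0]
    · simp
    · intro k hk; simp [hk]
  rw [← this, hK00]

noncomputable def szegoExt (a : ℕ → ℂ) (k : ℤ) : ℂ := if 0 ≤ k then a k.toNat else 0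

lemma szegoExt_norm (a : ℕ → ℂ) (A : ℝ) (ha : ∀ m, ‖a m‖ ≤ A) (k : ℤ) : ‖szegoExt a k‖ ≤ A := by
  unfold szegoExt
  split_ifs
  · exact ha _
  · rw [norm_zero]; exact (norm_nonneg _).trans (ha 0)

lemma szego_two_sided (a : ℕ → ℂ) (ε : ℝ) (w : ℂ) (hw : ‖w‖ = 1)
    (h : Tendsto (fun n : ℕ => ∑' m : ℕ, a m * w ^ m * szegoPsi ε (m - n)) atTop (nhds 0)) :
    Tendsto (fun n : ℕ => ∑' k : ℤ, szegoExt a (n + k) * w ^ k * szegoPsi ε k) atTop (nhds 0) := by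
  have hw0 : w ≠ 0 := by rintro rfl; simp at hw
  have key : ∀ n : ℕ, ∑' k : ℤ, szegoExt a (n + k) * w ^ k * szegoPsi ε k =
      w ^ (-(n : ℤ)) * ∑' m : ℕ, a m * w ^ m * szegoPsi ε (m - n) := by
    intro n
    rw [← tsum_mul_left]
    let g : ℤ → ℂ := fun k => szegoExt a k * w ^ (k - n) * szegoPsi ε (k - n)
    have h1 : ∑' m : ℕ, g m = ∑' k : ℤ, g k := by
      refine Function.Injective.tsum_eq (g := fun m : ℕ => (m : ℤ)) Nat.cast_injective ?_
      intro k hk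
      by_cases hk0 : 0 ≤ k
      · exact ⟨k.toNat, Int.toNat_of_nonneg hk0⟩
      · exact absurd (by simp [g, szegoExt, hk0]) hk
    have h2 : ∑' k : ℤ, g (n + k) = ∑' k : ℤ, g k := (Equiv.addLeft (n : ℤ)).tsum_eq g
    calc _ = ∑' k : ℤ, g (n + k) := by simp [g]
      _ = ∑' m : ℕ, g m := by rw [h1, h2]
      _ = _ := by
        congr 1; funext m
        simp only [g, szegoExt, Int.natCast_nonneg, if_true, Int.toNat_natCast]
        rw [sub_eq_neg_add, zpow_add₀ hw0, zpow_natCast]; ring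
  rw [tendsto_zero_iff_norm_tendsto_zero] at h ⊢
  refine h.congr fun n => ?_
  rw [key, norm_mul, norm_zpow, hw, one_zpow, one_mul]

lemma szego_det (a : ℕ → ℂ) (F : Finset ℂ) (hF : ∀ n, a n ∈ F) (ε : ℝ) (hε : 0 < ε) (t₀ η : ℝ)
    (hη : 0 < η)
    (h : ∀ t : ℝ, |t - t₀| < η → Tendsto (fun n : ℕ => ∑' k : ℤ,
      szegoExt a (n + k) * Complex.exp (t * Complex.I) ^ k * szegoPsi ε k) atTop (nhds 0)) :
    ∃ p : ℕ, ∀ n n', p ≤ n → p ≤ n' → (∀ i, 1 ≤ i → i ≤ p → a (n - i) = a (n' - i)) →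
      a n = a n' := by
  by_contra! hcon
  choose N N' hN hN' hblock hne using hcon
  let A : ℝ := ∑ z ∈ F, ‖z‖
  have ha : ∀ m, ‖a m‖ ≤ A := fun m =>
    Finset.single_le_sum (f := fun z : ℂ => ‖z‖) (fun z _ => norm_nonneg z) (hF m)
  have hA : 0 ≤ A := (norm_nonneg _).trans (ha 0)
  let D : ℕ → ℤ → ℂ := fun p k => szegoExt a (N p + k) - szegoExt a (N' p + k)
  have hDb : ∀ p k, ‖D p k‖ ≤ A + A := fun p k =>
    (norm_sub_le _ _).trans (add_le_add (szegoExt_norm a A ha _) (szegoExt_norm a A ha _))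
  obtain ⟨d, -, ψ, hψ, hd⟩ := (isCompact_univ_pi
    (fun _ : ℤ => isCompact_closedBall (0 : ℂ) (A + A))).tendsto_subseq (x := D)
    (fun p k _ => by simpa using hDb p k)
  have hd' : ∀ k, Tendsto (fun j => D (ψ j) k) atTop (nhds (d k)) := tendsto_pi_nhds.1 hd
  have hdneg : ∀ k : ℤ, k < 0 → d k = 0 := by
    intro k hk
    refine tendsto_nhds_unique (hd' k) (tendsto_const_nhds.congr' ?_)
    filter_upwards [eventually_ge_atTop k.natAbs] with j hj
    have h1 : j ≤ ψ j := hψ.id_le j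
    have h2 := hN (ψ j)
    have h3 := hN' (ψ j)
    have h4 := hblock (ψ j) k.natAbs (by omega) (by omega)
    simp only [D, szegoExt]
    rw [if_pos (by omega), if_pos (by omega)]
    have e1 : ((N (ψ j) : ℤ) + k).toNat = N (ψ j) - k.natAbs := by omega
    have e2 : ((N' (ψ j) : ℤ) + k).toNat = N' (ψ j) - k.natAbs := by omega
    rw [e1, e2, h4, sub_self]
  have hd0 : d 0 ≠ 0 := by
    let T : Finset ℂ := ((F ×ˢ F).image fun x => x.1 - x.2).erase 0
    have hT : IsClosed (T : Set ℂ) := T.finite_toSet.isClosed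
    have : d 0 ∈ (T : Set ℂ) := by
      refine hT.mem_of_tendsto (hd' 0) (Eventually.of_forall fun j => ?_)
      have e : D (ψ j) 0 = a (N (ψ j)) - a (N' (ψ j)) := by simp [D, szegoExt]
      rw [e, Finset.mem_coe, Finset.mem_erase]
      exact ⟨sub_ne_zero.2 (hne _),
        Finset.mem_image.2 ⟨(_, _), Finset.mem_product.2 ⟨hF _, hF _⟩, rfl⟩⟩
    exact (Finset.mem_erase.1 this).1
  have hsum := szegoPsi_summable ε hε
  have hzero : ∀ t : ℝ, |t - t₀| < η →
      ∑' k : ℤ, d k * Complex.exp (t * Complex.I) ^ k * szegoPsi ε k = 0 := by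
    intro t ht
    set w := Complex.exp (t * Complex.I) with hwdef
    have hw : ‖w‖ = 1 := Complex.norm_exp_ofReal_mul_I t
    have hbd : ∀ (x : ℂ) (B : ℝ) (k : ℤ), ‖x‖ ≤ B →
        ‖x * w ^ k * szegoPsi ε k‖ ≤ B * ‖szegoPsi ε k‖ := by
      intro x B k hx
      rw [norm_mul, norm_mul, norm_zpow, hw, one_zpow, mul_one]
      gcongr
    have hs : ∀ n : ℕ, Summable fun k : ℤ => szegoExt a (n + k) * w ^ k * szegoPsi ε k := fun n =>
      Summable.of_norm_bounded (hsum.mul_left A) fun k => hbd _ _ k (szegoExt_norm a A ha _)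
    have t1 : Tendsto (fun j => ∑' k : ℤ, D (ψ j) k * w ^ k * szegoPsi ε k) atTop
        (nhds (∑' k : ℤ, d k * w ^ k * szegoPsi ε k)) :=
      tendsto_tsum_of_dominated_convergence (hsum.mul_left (A + A))
        (fun k => ((hd' k).mul_const _).mul_const _)
        (Eventually.of_forall fun j k => hbd _ _ k (hDb _ _))
    have hNt : Tendsto (fun j => N (ψ j)) atTop atTop :=
      tendsto_atTop_mono (fun j => (hψ.id_le j).trans (hN (ψ j))) tendsto_id
    have hNt' : Tendsto (fun j => N' (ψ j)) atTop atTop :=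
      tendsto_atTop_mono (fun j => (hψ.id_le j).trans (hN' (ψ j))) tendsto_id
    have t2 := ((h t ht).comp hNt).sub ((h t ht).comp hNt')
    rw [sub_zero] at t2
    refine tendsto_nhds_unique t1 (t2.congr fun j => ?_)
    simp only [Function.comp]
    rw [← (hs _).tsum_sub (hs _)]
    congr 1; funext k; simp only [D]; ring
  have hc0 := szego_vanish (fun k : ℕ => d k * szegoPsi ε k) (by
      have hdb : ∀ k, ‖d k‖ ≤ A + A := fun k =>
        le_of_tendsto' (hd' k).norm fun j => hDb _ _
      refine Summable.of_nonneg_of_le (fun _ => norm_nonneg _) (fun k => ?_)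
        ((hsum.comp_injective (i := fun m : ℕ => (m : ℤ)) Nat.cast_injective).mul_left (A + A))
      rw [norm_mul]
      simp only [Function.comp]
      gcongr
      exact hdb _) t₀ η hη (by
    intro t ht
    rw [← hzero t ht]
    rw [← Function.Injective.tsum_eq (g := fun m : ℕ => (m : ℤ)) Nat.cast_injective]
    · congr 1; funext m
      rw [zpow_natCast]; ring
    · intro k hk
      by_cases hk0 : 0 ≤ k
      · exact ⟨k.toNat, Int.toNat_of_nonneg hk0⟩
      · exact absurd (by simp [hdneg k (by omega)]) hk)
  simp only [Nat.cast_zero, mul_eq_zero] at hc0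
  exact hc0.elim hd0 (szegoPsi_zero ε hε)

lemma szego_periodic (a : ℕ → ℂ) (F : Finset ℂ) (hF : ∀ n, a n ∈ F)
    (h : ∃ p : ℕ, ∀ n n', p ≤ n → p ≤ n' → (∀ i, 1 ≤ i → i ≤ p → a (n - i) = a (n' - i)) →
      a n = a n') :
    ∃ p : ℕ, 1 ≤ p ∧ ∃ N : ℕ, ∀ n, N ≤ n → a (n + p) = a n := by
  obtain ⟨p, hp⟩ := h
  obtain ⟨n₁, n₂, hne, heq⟩ := Finite.exists_ne_map_eq_of_infinite
    (fun (n : ℕ) (i : Fin p) => (⟨a (n + i), hF _⟩ : F))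
  have main : ∀ n n' : ℕ, n < n' → (∀ i < p, a (n + i) = a (n' + i)) →
      ∃ p : ℕ, 1 ≤ p ∧ ∃ N : ℕ, ∀ n, N ≤ n → a (n + p) = a n := by
    intro n n' hlt hb
    have hall : ∀ k, a (n + k) = a (n' + k) := by
      intro k
      induction k using Nat.strong_induction_on with
      | _ k ih =>
        by_cases hk : k < p
        · exact hb k hk
        · refine hp _ _ (by omega) (by omega) fun i hi1 hi2 => ?_
          have := ih (k - i) (by omega)
          rwa [← Nat.add_sub_assoc (by omega), ← Nat.add_sub_assoc (by omega)] at this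
    refine ⟨n' - n, by omega, n, fun m hm => ?_⟩
    have := hall (m - n)
    rw [show n + (m - n) = m by omega, show n' + (m - n) = m + (n' - n) by omega] at this
    exact this.symm
  have hb : ∀ i < p, a (n₁ + i) = a (n₂ + i) := fun i hi => by
    have := congrFun heq ⟨i, hi⟩
    simpa using this
  rcases lt_or_gt_of_ne hne with h | h
  · exact main _ _ h hb
  · exact main _ _ h fun i hi => (hb i hi).symm

lemma szego_rational (a : ℕ → ℂ) (A : ℝ) (ha : ∀ m, ‖a m‖ ≤ A) (p : ℕ) (hp : 1 ≤ p) (N : ℕ)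
    (hper : ∀ n, N ≤ n → a (n + p) = a n) :
    ∃ P Q : Polynomial ℂ, Q ≠ 0 ∧ (∀ z : ℂ, Q.eval z = 0 → z ^ p = 1) ∧
      ∀ z ∈ Metric.ball (0 : ℂ) 1, ∑' n : ℕ, a n * z ^ n = P.eval z / Q.eval z := by
  let P1 : Polynomial ℂ := ∑ i ∈ Finset.range N, Polynomial.C (a i) * Polynomial.X ^ i
  let P2 : Polynomial ℂ := ∑ i ∈ Finset.range p, Polynomial.C (a (i + N)) * Polynomial.X ^ i
  refine ⟨P1 * (1 - Polynomial.X ^ p) + Polynomial.X ^ N * P2, 1 - Polynomial.X ^ p, ?_, ?_, ?_⟩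
  · intro h0
    have := congrArg (Polynomial.eval 0) h0
    simp [show p ≠ 0 by omega] at this
  · intro z hz
    simp only [Polynomial.eval_sub, Polynomial.eval_one, Polynomial.eval_pow, Polynomial.eval_X] at hz
    exact (sub_eq_zero.1 hz).symm
  · intro z hz
    have hz1 : ‖z‖ < 1 := by simpa using hz
    have hs : ∀ b : ℕ → ℂ, (∀ m, ‖b m‖ ≤ A) → Summable fun n => b n * z ^ n := fun b hb => by
      refine Summable.of_norm_bounded
        ((summable_geometric_of_lt_one (norm_nonneg z) hz1).mul_left A) fun n => ?_
      rw [norm_mul, norm_pow]; gcongr; exact hb n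
    let g : ℂ := ∑' n : ℕ, a (n + N) * z ^ n
    have h1 : ∑' n : ℕ, a n * z ^ n = P1.eval z + z ^ N * g := by
      rw [← (hs a ha).sum_add_tsum_nat_add N, ← tsum_mul_left]
      congr 1
      · simp [P1, Polynomial.eval_finsetSum]
      · congr 1; funext n; ring
    have h2 : g = P2.eval z + z ^ p * g := by
      have := (hs (fun n => a (n + N)) fun m => ha _).sum_add_tsum_nat_add p
      conv_lhs => rw [show g = _ from this.symm]
      simp only [g]
      rw [← tsum_mul_left]
      congr 1
      · simp [P2, Polynomial.eval_finsetSum]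
      · congr 1; funext n
        rw [show n + p + N = (n + N) + p by ring, hper _ (by omega)]; ring
    have hne : 1 - z ^ p ≠ 0 := by
      intro h
      have h3 : z ^ p = 1 := (sub_eq_zero.1 h).symm
      have h4 : ‖z‖ ^ p = 1 := by rw [← norm_pow, h3, norm_one]
      have := pow_lt_one₀ (norm_nonneg z) hz1 (by omega : p ≠ 0)
      linarith
    simp only [Polynomial.eval_add, Polynomial.eval_mul, Polynomial.eval_sub, Polynomial.eval_one,
      Polynomial.eval_pow, Polynomial.eval_X]
    rw [h1, eq_div_iff hne]
    have h5 : g * (1 - z ^ p) = P2.eval z := by linear_combination h2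
    rw [← h5]; ring

theorem stmt14 (a : ℕ → ℂ) (F : Finset ℂ) (hF : ∀ n, a n ∈ F)
    (f : ℂ → ℂ) (hf : ∀ z ∈ Metric.ball (0 : ℂ) 1, f z = ∑' n : ℕ, a n * z ^ n) :
    StrongNaturalBoundary f ∨
    ∃ p : ℕ, 1 ≤ p ∧ ∃ N : ℕ, (∀ n, N ≤ n → a (n + p) = a n) ∧
      ∃ P Q : Polynomial ℂ, Q ≠ 0 ∧ (∀ z : ℂ, Q.eval z = 0 → z ^ p = 1) ∧
        ∀ z ∈ Metric.ball (0 : ℂ) 1, f z = P.eval z / Q.eval z := by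
  by_cases hB : StrongNaturalBoundary f
  · exact Or.inl hB
  right
  let A : ℝ := ∑ z ∈ F, ‖z‖
  have ha : ∀ m, ‖a m‖ ≤ A := fun m =>
    Finset.single_le_sum (f := fun z : ℂ => ‖z‖) (fun z _ => norm_nonneg z) (hF m)
  suffices hper : ∃ p : ℕ, 1 ≤ p ∧ ∃ N : ℕ, ∀ n, N ≤ n → a (n + p) = a n by
    obtain ⟨p, hp, N, hN⟩ := hper
    obtain ⟨P, Q, hQ, hQ', hPQ⟩ := szego_rational a A ha p hp N hN
    exact ⟨p, hp, N, hN, P, Q, hQ, hQ', fun z hz => (hf z hz).trans (hPQ z hz)⟩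
  apply szego_periodic a F hF
  unfold StrongNaturalBoundary at hB
  push Not at hB
  obtain ⟨α, β, hαβ, M, hM⟩ := hB
  have hε : 0 < (β - α) / 4 := by linarith
  refine szego_det a F hF ((β - α) / 4) hε ((α + β) / 2) ((β - α) / 4) hε fun t ht => ?_
  have hw : ‖Complex.exp (t * Complex.I)‖ = 1 := Complex.norm_exp_ofReal_mul_I t
  apply szego_two_sided a _ _ hw
  refine szego_A (fun m => a m * Complex.exp (t * Complex.I) ^ m) A (fun m => ?_) _ hε
    (2 * Real.pi * M) fun r hr hr1 => ?_
  · rw [norm_mul, norm_pow, hw, one_pow, mul_one]; exact ha m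
  · set ε := (β - α) / 4 with hεdef
    let g : ℝ → ℝ := fun θ => ‖f (r * Complex.exp (θ * Complex.I))‖
    have hg : ∀ θ : ℝ, g θ = ‖∑' m : ℕ, a m * (r * Complex.exp (θ * Complex.I)) ^ m‖ := by
      intro θ
      simp only [g]
      rw [hf]
      simpa [abs_of_pos hr, Complex.norm_exp_ofReal_mul_I] using hr1
    have hgc : Continuous g := by
      have : g = fun θ : ℝ => ‖∑' m : ℕ, a m * (r * Complex.exp (θ * Complex.I)) ^ m‖ := funext hg
      rw [this]; exact (szego_cont a A ha r hr hr1).norm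
    have e1 : ∫ u in -ε..ε, ‖∑' m : ℕ, a m * Complex.exp (t * Complex.I) ^ m *
        (r * Complex.exp (u * Complex.I)) ^ m‖ = ∫ u in -ε..ε, g (u + t) := by
      congr 1; funext u
      rw [hg]
      congr 2; funext m
      rw [mul_assoc, ← mul_pow]
      congr 2
      push_cast
      rw [add_mul, Complex.exp_add]; ring
    rw [e1, intervalIntegral.integral_comp_add_right]
    rw [abs_lt] at ht
    have h1 : ∫ u in (-ε + t)..(ε + t), g u ≤ ∫ u in α..β, g u :=
      intervalIntegral.integral_mono_interval (by linarith) (by linarith) (by linarith)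
        (Eventually.of_forall fun u => norm_nonneg _) (hgc.intervalIntegrable _ _)
    have h2 := hM r hr hr1
    rw [div_le_iff₀ (by positivity)] at h2
    refine h1.trans ?_
    linarith
end

section
/- Let (a_n)_{n≥0} be a bounded sequence of complex numbers whose set of limit points is finite. Then either f(z) = Σ_{n=0}^∞ a_n z^n has a strong natural boundary on ∂𝔻, or there exists a periodic sequence (c_n)_{n≥0} (i.e., c_{n+p} = c_n for some p ≥ 1 and all n ≥ 0) such that |a_n − c_n| → 0 as n → ∞. -/
open Filter Metric Set MeasureTheory

lemma near_conj {X : Type*} [TopologicalSpace X] [CompactSpace X]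
    (L : C(X, ℂ) →L[ℂ] ℂ) (ε : ℝ) (hε : 0 < ε) :
    ∃ χ : C(X, ℂ), ∀ v : C(X, ℂ), ‖v‖ ≤ 1 →
      ‖L v - (starRingEnd ℂ) (L (χ * star v))‖ ≤ ε := by
  set K := ‖L‖ with hK
  have hK0 : 0 ≤ K := norm_nonneg _
  -- choose η
  obtain ⟨η, hη0, hη⟩ : ∃ η : ℝ, 0 < η ∧ 2 * η ^ 2 + 4 * η * (1 + K / 2) ≤ ε := by
    refine ⟨min 1 (ε / (6 + 2 * K)), by positivity, ?_⟩
    set m := min 1 (ε / (6 + 2 * K))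
    have h1 : m ≤ 1 := min_le_left _ _
    have h2 : m ≤ ε / (6 + 2 * K) := min_le_right _ _
    have h0 : 0 < m := by positivity
    rw [le_div_iff₀ (by positivity)] at h2
    nlinarith
  have hphase : ∀ z : ℂ, ∃ l : ℂ, ‖l‖ = 1 ∧ l * z = (‖z‖ : ℂ) := by
    intro z
    by_cases hz : z = 0
    · exact ⟨1, by simp, by simp [hz]⟩
    · have hz' : (‖z‖ : ℂ) ≠ 0 := by simpa using hz
      refine ⟨(starRingEnd ℂ) z / ‖z‖, by simp [hz], ?_⟩
      rw [div_mul_eq_mul_div, mul_comm, Complex.mul_conj, Complex.normSq_eq_norm_sq]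
      push_cast
      field_simp
  obtain ⟨ψ, hψ1, hψ⟩ : ∃ ψ : C(X, ℂ), ‖ψ‖ ≤ 1 ∧ K - η ^ 2 ≤ (L ψ).re := by
    by_cases hK' : K - η ^ 2 < 0
    · exact ⟨0, by simp, by simpa using hK'.le⟩
    have hlt : K - η ^ 2 < ‖L‖ := by have := pow_pos hη0 2; linarith
    obtain ⟨x, hx, hx'⟩ := L.exists_lt_apply_of_lt_opNorm hlt
    obtain ⟨l, hl, hl'⟩ := hphase (L x)
    refine ⟨l • x, by rw [norm_smul, hl]; linarith, ?_⟩
    rw [map_smul, smul_eq_mul, hl', Complex.ofReal_re]; exact hx'.le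
  have hψx : ∀ x, ‖ψ x‖ ≤ 1 := fun x => (ψ.norm_coe_le_norm x).trans hψ1
  have hre : ∀ w : C(X, ℂ), ∀ B : ℝ, 0 ≤ B → (∀ x, ‖w x‖ ≤ B) → (L w).re ≤ K * B := by
    intro w B hB hw
    calc (L w).re ≤ ‖L w‖ := Complex.re_le_norm _
      _ ≤ ‖L‖ * ‖w‖ := L.le_opNorm w
      _ ≤ K * B := by gcongr; exact (ContinuousMap.norm_le _ hB).2 hw
  -- (i)
  have h1 : ∀ w : C(X, ℂ), (∀ x, ‖w x‖ ≤ 1 - ‖ψ x‖) → ‖L w‖ ≤ η ^ 2 := by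
    intro w hw
    obtain ⟨l, hl, hl'⟩ := hphase (L w)
    have := hre (ψ + l • w) 1 zero_le_one (fun x => by
      calc ‖(ψ + l • w) x‖ ≤ ‖ψ x‖ + ‖l * w x‖ := norm_add_le _ _
        _ ≤ 1 := by rw [norm_mul, hl]; linarith [hw x])
    rw [map_add, map_smul, smul_eq_mul, hl', Complex.add_re, Complex.ofReal_re] at this
    linarith
  have h1' : ∀ v : C(X, ℂ), ‖v‖ ≤ 1 → ‖L ((1 - ψ * star ψ) * v)‖ ≤ 2 * η ^ 2 := by
    intro v hv
    have := h1 ((1/2 : ℂ) • ((1 - ψ * star ψ) * v)) (fun x => by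
      have e : (1 - ψ x * (starRingEnd ℂ) (ψ x)) = ((1 - ‖ψ x‖ ^ 2 : ℝ) : ℂ) := by
        rw [Complex.mul_conj, Complex.normSq_eq_norm_sq]; push_cast; ring
      have e2 : ((1/2 : ℂ) • ((1 - ψ * star ψ) * v)) x
          = (1/2 : ℂ) * ((1 - ψ x * (starRingEnd ℂ) (ψ x)) * v x) := rfl
      rw [e2, e, norm_mul, norm_mul, Complex.norm_real, Real.norm_of_nonneg
        (by nlinarith [hψx x, norm_nonneg (ψ x)])]
      have hvx : ‖v x‖ ≤ 1 := (v.norm_coe_le_norm x).trans hv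
      have : ‖(1/2 : ℂ)‖ = 1/2 := by norm_num
      rw [this]
      have h3 : 0 ≤ 1 - ‖ψ x‖ ^ 2 := by nlinarith [hψx x, norm_nonneg (ψ x)]
      have h4 := mul_le_mul_of_nonneg_left hvx h3
      nlinarith [hψx x, norm_nonneg (ψ x)])
    rw [map_smul, norm_smul] at this
    have e : ‖(1/2 : ℂ)‖ = 1/2 := by norm_num
    rw [e] at this; linarith
  -- (ii)
  have h2 : ∀ u : C(X, ℝ), (∀ x, |u x| ≤ 1) → ∀ U : C(X, ℂ), (∀ x, U x = (u x : ℂ)) →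
      |(L (ψ * U)).im| ≤ η * (1 + K / 2) := by
    intro u hu U hU
    have key : ∀ t : ℝ, t * (L (ψ * U)).im ≤ η ^ 2 + K * t ^ 2 / 2 := by
      intro t
      have := hre (ψ + (-(Complex.I * t)) • (ψ * U)) (1 + t ^ 2 / 2) (by positivity) (fun x => by
        have e : (ψ + (-(Complex.I * t)) • (ψ * U)) x = ψ x * (1 + ((-(t * u x) : ℝ) : ℂ) * Complex.I) := by
          simp [hU]; ring
        rw [e, norm_mul]
        have : ‖(1 + ((-(t * u x) : ℝ) : ℂ) * Complex.I)‖ ≤ 1 + t ^ 2 / 2 := by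
          have := Complex.norm_add_mul_I 1 (-(t * u x))
          rw [Complex.ofReal_one] at this
          rw [this]
          apply Real.sqrt_le_iff.2
          have hux : (u x) ^ 2 ≤ 1 := by rw [sq_le_one_iff_abs_le_one]; exact hu x
          have : t ^ 2 * (u x) ^ 2 ≤ t ^ 2 * 1 := by gcongr
          refine ⟨by positivity, by nlinarith [sq_nonneg (t ^ 2)]⟩
        calc _ ≤ 1 * (1 + t ^ 2 / 2) := by gcongr; exact hψx x
          _ = _ := one_mul _)
      rw [map_add, map_smul, smul_eq_mul, Complex.add_re] at this
      have e : (-(Complex.I * t) * L (ψ * U)).re = t * (L (ψ * U)).im := by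
        simp
      rw [e] at this
      nlinarith
    have a1 := key η
    have a2 := key (-η)
    rw [abs_le]
    constructor
    · by_contra hcon; push Not at hcon
      nlinarith
    · by_contra hcon; push Not at hcon
      nlinarith
  -- (iii)
  have h3 : ∀ v : C(X, ℂ), ‖v‖ ≤ 1 →
      ‖L (ψ * star v) - (starRingEnd ℂ) (L (ψ * v))‖ ≤ 4 * η * (1 + K / 2) := by
    intro v hv
    have hvx : ∀ x, ‖v x‖ ≤ 1 := fun x => (v.norm_coe_le_norm x).trans hv
    let u1 : C(X, ℝ) := ⟨fun x => (v x).re, by fun_prop⟩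
    let u2 : C(X, ℝ) := ⟨fun x => (v x).im, by fun_prop⟩
    let U1 : C(X, ℂ) := ⟨fun x => ((v x).re : ℂ), by fun_prop⟩
    let U2 : C(X, ℂ) := ⟨fun x => ((v x).im : ℂ), by fun_prop⟩
    have b1 := h2 u1 (fun x => (Complex.abs_re_le_norm _).trans (hvx x)) U1 (fun x => rfl)
    have b2 := h2 u2 (fun x => (Complex.abs_im_le_norm _).trans (hvx x)) U2 (fun x => rfl)
    have e1 : ψ * v = ψ * U1 + Complex.I • (ψ * U2) := by
      ext x
      change ψ x * v x = ψ x * ((v x).re : ℂ) + Complex.I * (ψ x * ((v x).im : ℂ))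
      conv_lhs => rw [← Complex.re_add_im (v x)]
      ring
    have e2 : ψ * star v = ψ * U1 - Complex.I • (ψ * U2) := by
      ext x
      change ψ x * (starRingEnd ℂ) (v x) = ψ x * ((v x).re : ℂ) - Complex.I * (ψ x * ((v x).im : ℂ))
      have e : (starRingEnd ℂ) (v x) = ((v x).re : ℂ) - Complex.I * ((v x).im : ℂ) := by
        apply Complex.ext <;> simp
      rw [e]
      ring
    rw [e1, e2, map_sub, map_add, map_smul, smul_eq_mul]
    set p1 := L (ψ * U1)
    set p2 := L (ψ * U2)
    have e3 : p1 - Complex.I * p2 - (starRingEnd ℂ) (p1 + Complex.I * p2)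
        = 2 * Complex.I * (p1.im : ℂ) + 2 * (p2.im : ℂ) := by
      apply Complex.ext <;> simp <;> ring
    rw [e3]
    calc _ ≤ ‖2 * Complex.I * (p1.im : ℂ)‖ + ‖2 * (p2.im : ℂ)‖ := norm_add_le _ _
      _ = 2 * |p1.im| + 2 * |p2.im| := by simp
      _ ≤ _ := by linarith
  refine ⟨ψ * ψ, fun v hv => ?_⟩
  have hv' : ‖ψ * star v‖ ≤ 1 := by
    refine (ContinuousMap.norm_le _ zero_le_one).2 fun x => ?_
    change ‖ψ x * (starRingEnd ℂ) (v x)‖ ≤ 1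
    rw [norm_mul, RCLike.norm_conj]
    exact mul_le_one₀ (hψx x) (norm_nonneg _) ((v.norm_coe_le_norm x).trans hv)
  have c1 := h1' v hv
  have c2 := h3 _ hv'
  have e1 : L v = L ((1 - ψ * star ψ) * v) + L (ψ * star (ψ * star v)) := by
    rw [← map_add]; congr 1
    rw [star_mul, star_star]; ring
  have e2 : ψ * ψ * star v = ψ * (ψ * star v) := by ring
  rw [e1, e2, add_sub_assoc]
  exact (norm_add_le _ _).trans (by linarith)

instance fact_two_pi_pos : Fact (0 < 2 * Real.pi) := ⟨Real.two_pi_pos⟩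

lemma rajchman (L : C(AddCircle (2 * Real.pi), ℂ) →L[ℂ] ℂ)
    (h : Tendsto (fun m : ℤ => L (fourier m)) atTop (nhds 0)) :
    Tendsto (fun m : ℤ => L (fourier (-m))) atTop (nhds 0) := by
  have h1 : ∀ χ : C(AddCircle (2 * Real.pi), ℂ),
      Tendsto (fun m : ℤ => L (χ * fourier m)) atTop (nhds 0) := by
    let S : Submodule ℂ C(AddCircle (2 * Real.pi), ℂ) :=
      { carrier := {χ | Tendsto (fun m : ℤ => L (χ * fourier m)) atTop (nhds 0)}
        add_mem' := by
          intro a b ha hb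
          have := Tendsto.add ha hb
          simpa [add_mul] using this
        zero_mem' := by simp
        smul_mem' := by
          intro c a ha
          have := Tendsto.const_mul c ha
          simpa [smul_mul_assoc] using this }
    have hS : Submodule.span ℂ (range (@fourier (2 * Real.pi))) ≤ S := by
      rw [Submodule.span_le]
      rintro _ ⟨n, rfl⟩
      change Tendsto (fun m : ℤ => L (fourier n * fourier m)) atTop (nhds 0)
      have := h.comp (tendsto_atTop_add_const_left atTop n tendsto_id)
      refine this.congr fun m => ?_
      simp only [Function.comp, id]
      congr 1
      ext x
      simp
    have hcl : IsClosed (S : Set C(AddCircle (2 * Real.pi), ℂ)) := by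
      rw [← isSeqClosed_iff_isClosed]
      intro x χ hx hχ
      change Tendsto _ _ _
      rw [Metric.tendsto_nhds]
      intro ε hε
      obtain ⟨j, hj⟩ : ∃ j, ‖L‖ * ‖χ - x j‖ < ε / 2 := by
        have : Tendsto (fun j => ‖L‖ * ‖χ - x j‖) atTop (nhds (‖L‖ * ‖χ - χ‖)) :=
          ((tendsto_const_nhds.sub hχ).norm).const_mul _
        simp only [sub_self, norm_zero, mul_zero] at this
        exact (this.eventually (gt_mem_nhds (half_pos hε))).exists
      have hxj : Tendsto (fun m : ℤ => L (x j * fourier m)) atTop (nhds 0) := hx j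
      filter_upwards [Metric.tendsto_nhds.1 hxj (ε / 2) (half_pos hε)] with m hm
      rw [dist_zero_right] at hm ⊢
      have e : L (χ * fourier m) = L ((χ - x j) * fourier m) + L (x j * fourier m) := by
        rw [← map_add]; congr 1; ring
      have : ‖L ((χ - x j) * fourier m)‖ ≤ ‖L‖ * ‖χ - x j‖ := by
        refine (L.le_opNorm _).trans ?_
        gcongr
        refine (norm_mul_le _ _).trans ?_
        rw [fourier_norm, mul_one]
      rw [e]
      exact (norm_add_le _ _).trans_lt (by linarith)
    have := Submodule.topologicalClosure_minimal _ hS hcl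
    rw [span_fourier_closure_eq_top] at this
    exact fun χ => this Submodule.mem_top
  rw [Metric.tendsto_nhds]
  intro ε hε
  obtain ⟨χ, hχ⟩ := near_conj L (ε / 2) (half_pos hε)
  filter_upwards [Metric.tendsto_nhds.1 (h1 χ) (ε / 2) (half_pos hε)] with m hm
  rw [dist_zero_right] at hm ⊢
  have h2 := hχ (fourier (-m)) (fourier_norm _).le
  have e : star (fourier (-m) : C(AddCircle (2 * Real.pi), ℂ)) = fourier m := by
    ext x
    change (starRingEnd ℂ) (fourier (-m) x) = _
    rw [fourier_neg]; simp
  rw [e] at h2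
  have e2 : L (fourier (-m)) = (L (fourier (-m)) - (starRingEnd ℂ) (L (χ * fourier m)))
    + (starRingEnd ℂ) (L (χ * fourier m)) := by ring
  rw [e2]
  refine (norm_add_le _ _).trans_lt ?_
  rw [RCLike.norm_conj]; linarith

lemma arc_unique (c : ℕ → ℂ) (hc : Summable (fun n => ‖c n‖)) (θ₀ δ : ℝ) (hδ : 0 < δ)
    (h : ∀ θ : ℝ, |θ - θ₀| < δ → ∑' n : ℕ, c n * Complex.exp (θ * Complex.I) ^ n = 0) :
    ∀ n, c n = 0 := by
  set g : ℂ → ℂ := fun z => ∑' n : ℕ, c n * z ^ n with hg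
  have hbd : ∀ n (z : ℂ), z ∈ closedBall (0:ℂ) 1 → ‖c n * z ^ n‖ ≤ ‖c n‖ := by
    intro n z hz
    rw [mem_closedBall_zero_iff] at hz
    rw [norm_mul, norm_pow]
    exact mul_le_of_le_one_right (norm_nonneg _) (pow_le_one₀ (norm_nonneg _) hz)
  have hcont : ContinuousOn g (closedBall 0 1) :=
    continuousOn_tsum (fun n => by fun_prop) hc hbd
  have hdiff : DifferentiableOn ℂ g (ball 0 1) :=
    Complex.differentiableOn_tsum_of_summable_norm hc (fun n => by fun_prop) isOpen_ball
      (fun n z hz => hbd n z (ball_subset_closedBall hz))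
  set ζ : ℂ := Complex.exp (θ₀ * Complex.I) with hζ
  have hζ1 : ‖ζ‖ = 1 := Complex.norm_exp_ofReal_mul_I θ₀
  have hζ0 : ζ ≠ 0 := Complex.exp_ne_zero _
  obtain ⟨ρ, hρ, hzero⟩ : ∃ ρ > 0, ∀ z : ℂ, ‖z‖ = 1 → ‖z - ζ‖ < ρ → g z = 0 := by
    have : ContinuousAt (fun z : ℂ => Complex.arg (z / ζ)) ζ := by
      apply ContinuousAt.comp (g := Complex.arg)
      · rw [div_self hζ0]; exact Complex.continuousAt_arg (by simp)
      · fun_prop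
    obtain ⟨ρ, hρ, hh⟩ := Metric.continuousAt_iff.1 this δ hδ
    refine ⟨ρ, hρ, fun z hz hzζ => ?_⟩
    have h1 := hh (by rwa [dist_eq_norm])
    rw [div_self hζ0, Complex.arg_one, dist_zero_right, Real.norm_eq_abs] at h1
    have h2 := h (θ₀ + Complex.arg (z / ζ)) (by simpa using h1)
    have e : Complex.exp ((θ₀ + Complex.arg (z / ζ) : ℝ) * Complex.I) = z := by
      have := Complex.norm_mul_exp_arg_mul_I (z / ζ)
      rw [norm_div, hz, hζ1, div_one, Complex.ofReal_one, one_mul] at this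
      push_cast
      rw [add_mul, Complex.exp_add, this, ← hζ]
      field_simp
    rw [e] at h2
    exact h2
  have hgp : ∀ η : ℝ, 0 < η → η < 1 → η + Real.sqrt (2 * η) < ρ → g ((1 - η : ℝ) * ζ) = 0 := by
    intro η h0 h1 h2
    set p : ℂ := (1 - η : ℝ) * ζ with hp
    have hpn : ‖p‖ = 1 - η := by
      rw [hp, norm_mul, hζ1, Complex.norm_real, Real.norm_of_nonneg (by linarith), mul_one]
    set D : Set ℂ := {w | ‖p + w‖ < 1} ∩ {w | ‖p - w‖ < 1} with hD
    have hDo : IsOpen D := (isOpen_lt (by fun_prop) (by fun_prop)).inter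
      (isOpen_lt (by fun_prop) (by fun_prop))
    have hDcl : closure D ⊆ {w | ‖p + w‖ ≤ 1} ∩ {w | ‖p - w‖ ≤ 1} := by
      apply closure_minimal
      · rintro w ⟨h1, h2⟩; exact ⟨(show ‖p + w‖ < 1 from h1).le, (show ‖p - w‖ < 1 from h2).le⟩
      · exact (isClosed_le (by fun_prop) (by fun_prop)).inter
          (isClosed_le (by fun_prop) (by fun_prop))
    have hsmall : ∀ w ∈ closure D, ‖w‖ ≤ Real.sqrt (2 * η) := by
      intro w hw
      obtain ⟨a1, a2⟩ := hDcl hw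
      simp only [mem_ofPred_eq] at a1 a2
      have := parallelogram_law_with_norm ℝ p w
      apply Real.le_sqrt_of_sq_le
      rw [hpn] at this
      nlinarith [norm_nonneg (p + w), norm_nonneg (p - w)]
    have hpζ : ‖p - ζ‖ = η := by
      have : p - ζ = ((-η : ℝ) : ℂ) * ζ := by rw [hp]; push_cast; ring
      rw [this, norm_mul, hζ1, Complex.norm_real, norm_neg, Real.norm_of_nonneg h0.le, mul_one]
    have hbdd : Bornology.IsBounded D := by
      rw [isBounded_iff_forall_norm_le]
      exact ⟨_, fun w hw => hsmall w (subset_closure hw)⟩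
    have hdc : DiffContOnCl ℂ (fun w => g (p + w) * g (p - w)) D := by
      constructor
      · apply DifferentiableOn.mul
        · exact hdiff.comp (by fun_prop) (fun w hw => by simpa using hw.1)
        · exact hdiff.comp (by fun_prop) (fun w hw => by simpa using hw.2)
      · apply ContinuousOn.mul
        · exact hcont.comp (by fun_prop) (fun w hw => by simpa using (hDcl hw).1)
        · exact hcont.comp (by fun_prop) (fun w hw => by simpa using (hDcl hw).2)
    have hfr : ∀ w ∈ frontier D, ‖(fun w => g (p + w) * g (p - w)) w‖ ≤ 0 := by
      intro w hw
      have hwc : w ∈ closure D := frontier_subset_closure hw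
      have hwn : w ∉ D := by rw [hDo.frontier_eq] at hw; exact hw.2
      obtain ⟨a1, a2⟩ := hDcl hwc
      have hs := hsmall w hwc
      simp only [mem_ofPred_eq] at a1 a2
      rw [norm_le_zero_iff]
      by_cases b1 : ‖p + w‖ = 1
      · have : g (p + w) = 0 := by
          apply hzero _ b1
          calc ‖p + w - ζ‖ = ‖(p - ζ) + w‖ := by congr 1; ring
            _ ≤ ‖p - ζ‖ + ‖w‖ := norm_add_le _ _
            _ < ρ := by rw [hpζ]; linarith
        simp [this]
      · have b2 : ‖p - w‖ = 1 := by
          by_contra b2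
          exact hwn ⟨lt_of_le_of_ne a1 b1, lt_of_le_of_ne a2 b2⟩
        have : g (p - w) = 0 := by
          apply hzero _ b2
          calc ‖p - w - ζ‖ = ‖(p - ζ) - w‖ := by congr 1; ring
            _ ≤ ‖p - ζ‖ + ‖w‖ := norm_sub_le _ _
            _ < ρ := by rw [hpζ]; linarith
        simp [this]
    have h0D : (0 : ℂ) ∈ closure D := by
      apply subset_closure
      constructor <;> simp [hpn, h0]
    have := Complex.norm_le_of_forall_mem_frontier_norm_le hbdd hdc hfr h0D
    have h3 : g p * g p = 0 := by simpa only [add_zero, sub_zero, norm_le_zero_iff] using this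
    exact mul_self_eq_zero.1 h3
  obtain ⟨η₀, hη₀, hη₁, hη⟩ : ∃ η₀ : ℝ, 0 < η₀ ∧ η₀ < 1 ∧ ∀ η, 0 < η → η < η₀ → η + Real.sqrt (2 * η) < ρ := by
    have : ContinuousAt (fun η : ℝ => η + Real.sqrt (2 * η)) 0 := by fun_prop
    obtain ⟨ρ', hρ', hh⟩ := Metric.continuousAt_iff.1 this ρ hρ
    refine ⟨min ρ' (1/2), by positivity, by linarith [min_le_right ρ' (1/2)], fun η h0 h1 => ?_⟩
    have := hh (x := η) (by rw [dist_zero_right, Real.norm_of_nonneg h0.le]; exact h1.trans_le (min_le_left _ _))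
    simp only [mul_zero, Real.sqrt_zero, add_zero, dist_zero_right] at this
    exact (le_abs_self _).trans_lt this
  have hgball : EqOn g 0 (ball 0 1) := by
    have han : AnalyticOnNhd ℂ g (ball 0 1) := hdiff.analyticOnNhd isOpen_ball
    refine han.eqOn_zero_of_preconnected_of_frequently_eq_zero
      (convex_ball _ _).isPreconnected (z₀ := (1 - η₀ / 2 : ℝ) * ζ) ?_ ?_
    · rw [mem_ball_zero_iff, norm_mul, hζ1, Complex.norm_real, Real.norm_of_nonneg] <;> linarith
    · have ht : Tendsto (fun t : ℝ => ((1 - t : ℝ) : ℂ) * ζ) (nhdsWithin (η₀ / 2) {η₀ / 2}ᶜ)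
          (nhdsWithin ((1 - η₀ / 2 : ℝ) * ζ) {((1 - η₀ / 2 : ℝ) : ℂ) * ζ}ᶜ) := by
        apply tendsto_nhdsWithin_of_tendsto_nhds_of_eventually_within
        · apply Tendsto.mono_left _ nhdsWithin_le_nhds
          exact Continuous.tendsto (by fun_prop) _
        · filter_upwards [self_mem_nhdsWithin] with t ht
          simp only [mem_compl_iff, mem_singleton_iff] at ht ⊢
          intro hcon
          have := mul_right_cancel₀ hζ0 hcon
          have := Complex.ofReal_injective this
          apply ht; linarith
      have hev : ∀ᶠ t : ℝ in nhdsWithin (η₀ / 2) {η₀ / 2}ᶜ, g (((1 - t : ℝ) : ℂ) * ζ) = 0 := by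
        apply Filter.Eventually.filter_mono nhdsWithin_le_nhds
        filter_upwards [Ioo_mem_nhds (half_pos hη₀) (half_lt_self hη₀)] with t ht
        exact hgp t ht.1 (ht.2.trans hη₁) (hη t ht.1 ht.2)
      exact ht.frequently hev.frequently
  have hps : HasFPowerSeriesAt g (FormalMultilinearSeries.ofScalars ℂ c) 0 := by
    rw [hasFPowerSeriesAt_iff]
    filter_upwards [ball_mem_nhds (0:ℂ) one_pos] with z hz
    have : Summable (fun n => c n * z ^ n) :=
      Summable.of_norm_bounded hc (fun n => hbd n z (ball_subset_closedBall hz))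
    have := this.hasSum
    simp only [FormalMultilinearSeries.coeff_ofScalars, smul_eq_mul, zero_add]
    simpa [mul_comm, hg] using this
  have hz : HasFPowerSeriesAt (0 : ℂ → ℂ) (FormalMultilinearSeries.ofScalars ℂ c) 0 := by
    refine hps.congr ?_
    filter_upwards [ball_mem_nhds (0:ℂ) one_pos] with z hz using hgball hz
  have := hz.eq_zero
  intro n
  rw [← FormalMultilinearSeries.coeff_ofScalars (𝕜 := ℂ) (p := c) (n := n), this]
  rfl

lemma fourier_two_pi (n : ℤ) (x : ℝ) :
    fourier n (x : AddCircle (2 * Real.pi)) = Complex.exp (Complex.I * n * x) := by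
  rw [fourier_coe_apply]
  congr 1
  have : (Real.pi : ℂ) ≠ 0 := by exact_mod_cast Real.pi_ne_zero
  push_cast
  field_simp

/-- average of `g` against a triangle of half-width `h` centred at `θ` -/
noncomputable def qOp (θ h : ℝ) : C(AddCircle (2 * Real.pi), ℂ) →L[ℂ] ℂ :=
  LinearMap.mkContinuous
    { toFun := fun g => ∫ s in (0:ℝ)..h, ∫ t in (0:ℝ)..h, g ((θ + s - t : ℝ) : AddCircle (2 * Real.pi))
      map_add' := by
        intro g₁ g₂
        have hc : ∀ g : C(AddCircle (2 * Real.pi), ℂ), Continuous (Function.uncurry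
          (fun s t : ℝ => g ((θ + s - t : ℝ) : AddCircle (2 * Real.pi)))) := fun g =>
            g.continuous.comp ((AddCircle.continuous_mk' _).comp (by fun_prop))
        rw [← intervalIntegral.integral_add]
        · refine intervalIntegral.integral_congr fun s _ => ?_
          simp only [ContinuousMap.add_apply]
          rw [intervalIntegral.integral_add]
          · exact ((hc g₁).comp (by fun_prop : Continuous fun t : ℝ => (s, t))).intervalIntegrable _ _
          · exact ((hc g₂).comp (by fun_prop : Continuous fun t : ℝ => (s, t))).intervalIntegrable _ _
        · exact (intervalIntegral.continuous_parametric_intervalIntegral_of_continuous'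
            (hc g₁) 0 h).intervalIntegrable _ _
        · exact (intervalIntegral.continuous_parametric_intervalIntegral_of_continuous'
            (hc g₂) 0 h).intervalIntegrable _ _
      map_smul' := by
        intro c g
        simp only [ContinuousMap.smul_apply, smul_eq_mul, intervalIntegral.integral_const_mul,
          RingHom.id_apply] }
    (|h| * |h|) (by
      intro g
      have : ∀ s ∈ Set.uIoc 0 h, ‖∫ t in (0:ℝ)..h, g ((θ + s - t : ℝ) : AddCircle (2 * Real.pi))‖
          ≤ ‖g‖ * |h| := by
        intro s _
        have := intervalIntegral.norm_integral_le_of_norm_le_const (a := 0) (b := h) (C := ‖g‖)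
          (f := fun t : ℝ => g ((θ + s - t : ℝ) : AddCircle (2 * Real.pi)))
          (fun t _ => g.norm_coe_le_norm _)
        simpa using this
      have := intervalIntegral.norm_integral_le_of_norm_le_const this
      simp only [LinearMap.coe_mk, AddHom.coe_mk]
      rw [sub_zero] at this
      linarith)

lemma qOp_apply (θ h : ℝ) (g : C(AddCircle (2 * Real.pi), ℂ)) :
    qOp θ h g = ∫ s in (0:ℝ)..h, ∫ t in (0:ℝ)..h, g ((θ + s - t : ℝ) : AddCircle (2 * Real.pi)) := rfl

/-- Fourier coefficients of the triangle -/
noncomputable def tri (h : ℝ) (k : ℤ) : ℂ :=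
  (∫ s in (0:ℝ)..h, Complex.exp (Complex.I * k * s)) * ∫ t in (0:ℝ)..h, Complex.exp (-(Complex.I * k) * t)

lemma qOp_fourier (θ h : ℝ) (k : ℤ) :
    qOp θ h (fourier k) = tri h k * Complex.exp (Complex.I * k * θ) := by
  rw [qOp_apply, tri, ← intervalIntegral.integral_mul_const, ← intervalIntegral.integral_mul_const]
  refine intervalIntegral.integral_congr fun s _ => ?_
  try simp only
  rw [mul_right_comm, ← intervalIntegral.integral_const_mul]
  refine intervalIntegral.integral_congr fun t _ => ?_
  try simp only
  rw [fourier_two_pi, ← Complex.exp_add, ← Complex.exp_add]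
  congr 1
  push_cast
  ring

lemma tri_eq (h : ℝ) (k : ℤ) (hk : k ≠ 0) :
    tri h k = ((Complex.exp (Complex.I * k * h) - 1) / (Complex.I * k)) *
      ((Complex.exp (-(Complex.I * k) * h) - 1) / (-(Complex.I * k))) := by
  have : (k : ℂ) ≠ 0 := by exact_mod_cast hk
  have h1 : Complex.I * k ≠ 0 := mul_ne_zero Complex.I_ne_zero this
  rw [tri, integral_exp_mul_complex h1, integral_exp_mul_complex (neg_ne_zero.2 h1)]
  simp

lemma tri_norm (h : ℝ) (k : ℤ) (hk : k ≠ 0) : ‖tri h k‖ ≤ 4 * (1 / (k:ℝ) ^ 2) := by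
  rw [tri_eq h k hk]
  have e1 : ‖Complex.exp (Complex.I * k * h) - 1‖ ≤ 2 := by
    refine (norm_sub_le _ _).trans ?_
    have : Complex.I * k * h = ((k * h : ℝ) : ℂ) * Complex.I := by push_cast; ring
    rw [this, Complex.norm_exp_ofReal_mul_I]; norm_num
  have e2 : ‖Complex.exp (-(Complex.I * k) * h) - 1‖ ≤ 2 := by
    refine (norm_sub_le _ _).trans ?_
    have : -(Complex.I * k) * h = ((-(k * h) : ℝ) : ℂ) * Complex.I := by push_cast; ring
    rw [this, Complex.norm_exp_ofReal_mul_I]; norm_num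
  have e3 : ‖Complex.I * (k:ℂ)‖ = |(k:ℝ)| := by simp
  rw [norm_mul, norm_div, norm_div, norm_neg, e3]
  have hk' : 0 < |(k:ℝ)| := by simpa using hk
  calc _ ≤ 2 / |(k:ℝ)| * (2 / |(k:ℝ)|) := by gcongr
    _ = _ := by rw [← sq_abs (k:ℝ)]; field_simp; norm_num

lemma tri_summable (h : ℝ) : Summable (fun k : ℤ => ‖tri h k‖) := by
  have h1 : Summable (fun k : ℤ => 4 * (1 / (k:ℝ) ^ 2)) :=
    (Real.summable_one_div_int_pow.2 (by norm_num)).mul_left 4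
  refine Summable.of_norm_bounded_eventually h1 ?_
  rw [Filter.eventually_cofinite]
  refine (Set.finite_singleton (0:ℤ)).subset fun k hk => ?_
  by_contra hk0
  exact hk (by rw [norm_norm]; exact tri_norm h k hk0)

lemma tri_ne_zero (q : ℚ) (hq : 0 < q) (k : ℤ) : tri (q:ℝ) k ≠ 0 := by
  by_cases hk : k = 0
  · subst hk
    have : (q:ℂ) ≠ 0 := by exact_mod_cast hq.ne'
    simp [tri, this]
  have hkc : (k : ℂ) ≠ 0 := by exact_mod_cast hk
  have h1 : Complex.I * k ≠ 0 := mul_ne_zero Complex.I_ne_zero hkc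
  have key : ∀ j : ℤ, j ≠ 0 → Complex.exp (Complex.I * j * (q:ℝ)) - 1 ≠ 0 := by
    intro j hj hcon
    rw [sub_eq_zero, Complex.exp_eq_one_iff] at hcon
    obtain ⟨n, hn⟩ := hcon
    have h2 : ((j : ℝ) * q : ℝ) = n * (2 * Real.pi) := by
      have : Complex.I * (((j : ℝ) * q : ℝ) : ℂ) = Complex.I * ((n * (2 * Real.pi) : ℝ) : ℂ) := by
        push_cast at hn ⊢
        linear_combination hn
      exact_mod_cast mul_left_cancel₀ Complex.I_ne_zero this
    have hn0 : n ≠ 0 := by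
      rintro rfl
      have : (j : ℝ) * q = 0 := by simpa using h2
      rcases mul_eq_zero.1 this with h | h
      · exact hj (by exact_mod_cast h)
      · exact hq.ne' (by exact_mod_cast h)
    apply irrational_pi
    refine ⟨(j * q) / (2 * n), ?_⟩
    have : (n : ℝ) ≠ 0 := by exact_mod_cast hn0
    push_cast
    field_simp
    linarith
  rw [tri_eq _ k hk]
  refine mul_ne_zero (div_ne_zero (key k hk) h1) (div_ne_zero ?_ (neg_ne_zero.2 h1))
  have := key (-k) (neg_ne_zero.2 hk)
  push_cast at this
  simpa using this

/-- extension by zero -/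
noncomputable def ext0 (a : ℕ → ℂ) (j : ℤ) : ℂ := if 0 ≤ j then a j.toNat else 0

lemma ext0_norm (a : ℕ → ℂ) (C : ℝ) (hC : ∀ n, ‖a n‖ ≤ C) (j : ℤ) : ‖ext0 a j‖ ≤ C := by
  unfold ext0
  split_ifs
  · exact hC _
  · simpa using (norm_nonneg _).trans (hC 0)

lemma u_tendsto (a : ℕ → ℂ) (C : ℝ) (hC : ∀ n, ‖a n‖ ≤ C)
    (f : ℂ → ℂ) (hf : ∀ z ∈ Metric.ball (0 : ℂ) 1, f z = ∑' n : ℕ, a n * z ^ n)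
    (α β M : ℝ) (hM : ∀ r : ℝ, 0 < r → r < 1 →
      (∫ θ in α..β, ‖f (r * Complex.exp (θ * Complex.I))‖) ≤ M)
    (θ h : ℝ) (hh : 0 < h) (h1 : α < θ - h) (h2 : θ + h < β) :
    Tendsto (fun m : ℤ => ∑' k : ℤ, ext0 a (k + m) * (tri h k * Complex.exp (Complex.I * k * θ)))
      atTop (nhds 0) := by
  have hC0 : 0 ≤ C := (norm_nonneg _).trans (hC 0)
  set γ : ℤ → ℂ := fun k => tri h k * Complex.exp (Complex.I * k * θ) with hγ
  have hγn : ∀ k, ‖γ k‖ = ‖tri h k‖ := by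
    intro k
    have : Complex.I * k * θ = ((k * θ : ℝ) : ℂ) * Complex.I := by push_cast; ring
    rw [hγ]; simp only
    rw [norm_mul, this, Complex.norm_exp_ofReal_mul_I, mul_one]
  have hγs : Summable (fun k => ‖γ k‖) := by simpa only [hγn] using tri_summable h
  set F : ℝ → C(AddCircle (2 * Real.pi), ℂ) := fun r => ∑' n : ℕ, (a n * (r:ℂ) ^ n) • fourier (n : ℤ)
    with hF
  have hFs : ∀ r : ℝ, 0 < r → r < 1 →
      Summable (fun n : ℕ => (a n * (r:ℂ) ^ n) • (fourier (n : ℤ) : C(AddCircle (2 * Real.pi), ℂ))) := by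
    intro r hr0 hr1
    refine Summable.of_norm_bounded ((summable_geometric_of_lt_one hr0.le hr1).mul_left C) fun n => ?_
    rw [norm_smul, fourier_norm, mul_one, norm_mul, norm_pow, Complex.norm_real, Real.norm_of_nonneg hr0.le]
    gcongr
    exact hC n
  have hFf : ∀ r : ℝ, 0 < r → r < 1 → ∀ t : ℝ, F r (t : AddCircle (2 * Real.pi)) = f (r * Complex.exp (t * Complex.I)) := by
    intro r hr0 hr1 t
    rw [hf _ (by rw [mem_ball_zero_iff, norm_mul, Complex.norm_exp_ofReal_mul_I, Complex.norm_real,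
      Real.norm_of_nonneg hr0.le, mul_one]; exact hr1)]
    rw [hF]; simp only
    rw [← ContinuousMap.tsum_apply (hFs r hr0 hr1)]
    refine tsum_congr fun n => ?_
    rw [ContinuousMap.smul_apply, smul_eq_mul, fourier_two_pi, mul_pow, ← Complex.exp_nat_mul, mul_assoc]
    congr 3
    push_cast
    ring
  set Lr : ℝ → (C(AddCircle (2 * Real.pi), ℂ) →L[ℂ] ℂ) := fun r =>
    (qOp θ h).comp (ContinuousLinearMap.mul ℂ C(AddCircle (2 * Real.pi), ℂ) (F r)) with hLr
  have hLrn : ∀ r : ℝ, 0 < r → r < 1 → ‖Lr r‖ ≤ M * h := by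
    intro r hr0 hr1
    have hcontF : Continuous (fun t : ℝ => ‖F r (t : AddCircle (2 * Real.pi))‖) :=
      ((F r).continuous.comp (AddCircle.continuous_mk' _)).norm
    have hM' : ∫ t in α..β, ‖F r (t : AddCircle (2 * Real.pi))‖ ≤ M := by
      simpa only [hFf r hr0 hr1] using hM r hr0 hr1
    have hM0 : 0 ≤ M := le_trans (intervalIntegral.integral_nonneg (by linarith) (fun _ _ => norm_nonneg _)) hM'
    refine ContinuousLinearMap.opNorm_le_bound _ (by positivity) fun ψ => ?_
    have e : Lr r ψ = qOp θ h (F r * ψ) := rfl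
    rw [e, qOp_apply]
    have inner : ∀ s ∈ Set.uIoc 0 h, ‖∫ t in (0:ℝ)..h, (F r * ψ) ((θ + s - t : ℝ) : AddCircle (2 * Real.pi))‖
        ≤ M * ‖ψ‖ := by
      intro s hs
      rw [Set.uIoc_of_le hh.le] at hs
      have hc1 : Continuous (fun t : ℝ => ((θ + s - t : ℝ) : AddCircle (2 * Real.pi))) :=
        (AddCircle.continuous_mk' _).comp (by fun_prop)
      calc _ ≤ ∫ t in (0:ℝ)..h, ‖(F r * ψ) ((θ + s - t : ℝ) : AddCircle (2 * Real.pi))‖ :=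
            intervalIntegral.norm_integral_le_integral_norm hh.le
        _ ≤ ∫ t in (0:ℝ)..h, ‖F r ((θ + s - t : ℝ) : AddCircle (2 * Real.pi))‖ * ‖ψ‖ := by
            apply intervalIntegral.integral_mono_on hh.le
            · exact (((F r * ψ).continuous.comp hc1).norm).intervalIntegrable _ _
            · exact ((((F r).continuous.comp hc1).norm).mul continuous_const).intervalIntegrable _ _
            · intro t _
              rw [ContinuousMap.mul_apply, norm_mul]
              gcongr
              exact ψ.norm_coe_le_norm _
        _ = (∫ t in (0:ℝ)..h, ‖F r ((θ + s - t : ℝ) : AddCircle (2 * Real.pi))‖) * ‖ψ‖ := by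
            rw [intervalIntegral.integral_mul_const]
        _ = (∫ t in (θ + s - h)..(θ + s - 0), ‖F r ((t : ℝ) : AddCircle (2 * Real.pi))‖) * ‖ψ‖ := by
            rw [intervalIntegral.integral_comp_sub_left (fun t : ℝ => ‖F r ((t : ℝ) : AddCircle (2 * Real.pi))‖)]
        _ ≤ (∫ t in α..β, ‖F r (t : AddCircle (2 * Real.pi))‖) * ‖ψ‖ := by
            gcongr
            apply intervalIntegral.integral_mono_interval
            · linarith [hs.1]
            · linarith
            · linarith [hs.2]
            · exact Filter.Eventually.of_forall fun _ => norm_nonneg _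
            · exact hcontF.intervalIntegrable _ _
        _ ≤ M * ‖ψ‖ := by gcongr
    have := intervalIntegral.norm_integral_le_of_norm_le_const inner
    rw [sub_zero, abs_of_pos hh] at this
    linarith
  -- value on exponentials
  have hval : ∀ r : ℝ, 0 < r → r < 1 → ∀ m : ℤ,
      Lr r (fourier (-m)) = ∑' n : ℕ, a n * (r:ℂ) ^ n * γ (n - m) := by
    intro r hr0 hr1 m
    have e : Lr r (fourier (-m)) = qOp θ h (F r * fourier (-m)) := rfl
    rw [e, hF]
    simp only
    rw [← Summable.tsum_mul_right _ (hFs r hr0 hr1),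
      ContinuousLinearMap.map_tsum _ ((hFs r hr0 hr1).mul_right _)]
    refine tsum_congr fun n => ?_
    rw [smul_mul_assoc, map_smul, smul_eq_mul]
    congr 1
    rw [hγ]; simp only
    rw [← qOp_fourier]
    congr 1
    ext x
    rw [ContinuousMap.mul_apply, ← fourier_add, sub_eq_add_neg]
  have hlim : ∀ m : ℤ, Tendsto (fun r : ℝ => Lr r (fourier (-m))) (nhdsWithin 1 (Ioo 0 1))
      (nhds (∑' k : ℤ, ext0 a (k + m) * γ k)) := by
    intro m
    have hsh : Summable (fun n : ℕ => ‖γ (n - m)‖) := by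
      have := (hγs.comp_injective (i := fun k : ℤ => k - m) (sub_left_injective)).comp_injective
        (i := fun n : ℕ => (n : ℤ)) Nat.cast_injective
      exact this
    have e : ∑' k : ℤ, ext0 a (k + m) * γ k = ∑' n : ℕ, a n * γ (n - m) := by
      rw [← (Equiv.subRight m).tsum_eq (fun k : ℤ => ext0 a (k + m) * γ k)]
      simp only [Equiv.subRight_apply, sub_add_cancel]
      rw [← Function.Injective.tsum_eq (g := fun n : ℕ => (n : ℤ)) Nat.cast_injective]
      · refine tsum_congr fun n => ?_
        simp [ext0]
      · intro j hj
        rw [Function.mem_support] at hj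
        by_cases hj0 : 0 ≤ j
        · exact ⟨j.toNat, by simp [hj0]⟩
        · exact absurd (by simp [ext0, hj0]) hj
    rw [e]
    have : Tendsto (fun r : ℝ => ∑' n : ℕ, a n * (r:ℂ) ^ n * γ (n - m)) (nhdsWithin 1 (Ioo 0 1))
        (nhds (∑' n : ℕ, a n * γ (n - m))) := by
      apply tendsto_tsum_of_dominated_convergence (hsh.mul_left C)
      · intro n
        have : Continuous (fun r : ℝ => a n * (r:ℂ) ^ n * γ (n - m)) := by fun_prop
        have := this.tendsto 1
        simp only [Complex.ofReal_one, one_pow, mul_one] at this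
        exact this.mono_left nhdsWithin_le_nhds
      · filter_upwards [self_mem_nhdsWithin] with r hr n
        rw [norm_mul, norm_mul, norm_pow, Complex.norm_real, Real.norm_of_nonneg hr.1.le]
        gcongr
        calc ‖a n‖ * r ^ n ≤ C * 1 := by
              exact mul_le_mul (hC n) (pow_le_one₀ hr.1.le hr.2.le) (pow_nonneg hr.1.le n) hC0
          _ = C := mul_one _
    refine this.congr' ?_
    filter_upwards [self_mem_nhdsWithin] with r hr
    exact (hval r hr.1 hr.2 m).symm
  have : (nhdsWithin (1:ℝ) (Ioo 0 1)).NeBot := right_nhdsWithin_Ioo_neBot one_pos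
  obtain ⟨L, hL⟩ : ∃ L : C(AddCircle (2 * Real.pi), ℂ) →L[ℂ] ℂ, ∀ m : ℤ,
      L (fourier (-m)) = ∑' k : ℤ, ext0 a (k + m) * γ k := by
    let Z : ℝ → WeakDual ℂ C(AddCircle (2 * Real.pi), ℂ) := fun r => StrongDual.toWeakDual (Lr r)
    have hK := WeakDual.isCompact_closedBall (𝕜 := ℂ) (0 : StrongDual ℂ C(AddCircle (2 * Real.pi), ℂ)) (M * h)
    let U := Ultrafilter.of (nhdsWithin (1:ℝ) (Ioo 0 1))
    have hU : (U : Filter ℝ) ≤ nhdsWithin (1:ℝ) (Ioo 0 1) := Ultrafilter.of_le _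
    obtain ⟨x, -, hx⟩ := hK.ultrafilter_le_nhds (U.map Z) (by
      rw [le_principal_iff]
      change Z ⁻¹' _ ∈ (U : Filter ℝ)
      apply hU
      filter_upwards [self_mem_nhdsWithin] with r hr
      have := hLrn r hr.1 hr.2
      simp only [mem_preimage, mem_closedBall_zero_iff]
      exact this)
    refine ⟨WeakDual.toStrongDual x, fun m => ?_⟩
    have t1 : Tendsto Z U (nhds x) := hx
    have t2 : Tendsto (fun r => Z r (fourier (-m))) U (nhds (x (fourier (-m)))) :=
      ((WeakDual.eval_continuous (fourier (-m))).tendsto x).comp t1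
    exact tendsto_nhds_unique t2 ((hlim m).mono_left hU)
  have hneg : Tendsto (fun m : ℤ => L (fourier m)) atTop (nhds 0) := by
    have e : ∀ m : ℤ, L (fourier m) = ∑' k : ℤ, ext0 a (k + -m) * γ k := by
      intro m; rw [← hL, neg_neg]
    simp only [e]
    rw [← tsum_zero (α := ℂ) (β := ℤ)]
    apply tendsto_tsum_of_dominated_convergence (hγs.mul_left C)
    · intro k
      apply tendsto_const_nhds.congr'
      filter_upwards [eventually_gt_atTop k] with m hm
      have : ¬ (0 ≤ k + -m) := by omega
      simp [ext0, this]
    · refine Filter.Eventually.of_forall fun m k => ?_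
      rw [norm_mul]
      gcongr
      exact ext0_norm a C hC _
  have := rajchman L hneg
  simpa only [hL] using this

/-- combinatorial part -/
lemma asymp_period (a : ℕ → ℂ) (C : ℝ) (hC : ∀ n, ‖a n‖ ≤ C)
    (hfin : {w : ℂ | MapClusterPt w atTop a}.Finite)
    (hdet : ∀ b b' : ℤ → ℂ,
      MapClusterPt b atTop (fun (m : ℤ) (k : ℤ) => ext0 a (k + m)) →
      MapClusterPt b' atTop (fun (m : ℤ) (k : ℤ) => ext0 a (k + m)) →
      (∀ k < 0, b k = b' k) → b 0 = b' 0) :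
    ∃ p : ℕ, 1 ≤ p ∧ Tendsto (fun n => a (n + p) - a n) atTop (nhds 0) := by
  set F := {w : ℂ | MapClusterPt w atTop a} with hF
  set A : ℤ → ℤ → ℂ := fun m k => ext0 a (k + m) with hA
  set X : Set (ℤ → ℂ) := {b | MapClusterPt b atTop A} with hX
  have hmemX : ∀ b, b ∈ X ↔ MapClusterPt b atTop A := fun b => Iff.rfl
  have hKc : IsCompact (Set.pi univ (fun _ : ℤ => closedBall (0:ℂ) C)) :=
    isCompact_univ_pi fun _ => isCompact_closedBall _ _
  have hAK : ∀ m, A m ∈ Set.pi univ (fun _ : ℤ => closedBall (0:ℂ) C) := by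
    intro m k _
    rw [mem_closedBall_zero_iff]
    exact ext0_norm a C hC _
  have hXcl : IsClosed X := isClosed_setOfPred_clusterPt
  have hXK : X ⊆ Set.pi univ (fun _ : ℤ => closedBall (0:ℂ) C) := by
    intro b hb
    obtain ⟨U, -, hU⟩ := mapClusterPt_iff_ultrafilter.1 ((hmemX b).1 hb)
    exact hKc.isClosed.mem_of_tendsto hU (Filter.Eventually.of_forall hAK)
  have hXc : IsCompact X := hKc.of_isClosed_subset hXcl hXK
  have hXF : ∀ b ∈ X, ∀ k, b k ∈ F := by
    intro b hb k
    obtain ⟨U, hU1, hU⟩ := mapClusterPt_iff_ultrafilter.1 ((hmemX b).1 hb)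
    have h1 : Tendsto (fun m => ext0 a (k + m)) U (nhds (b k)) := (tendsto_pi_nhds.1 hU) k
    have h2 : Tendsto (fun m : ℤ => (k + m).toNat) U atTop := by
      apply Tendsto.mono_left _ hU1
      rw [Filter.tendsto_atTop]
      intro n
      filter_upwards [eventually_ge_atTop ((n:ℤ) - k)] with m hm
      omega
    have h3 : Tendsto (fun m : ℤ => a (k + m).toNat) U (nhds (b k)) := by
      refine h1.congr' ?_
      apply Filter.Eventually.filter_mono hU1
      filter_upwards [eventually_ge_atTop (-k)] with m hm
      have : 0 ≤ k + m := by omega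
      simp [ext0, this]
    exact MapClusterPt.of_comp h2 h3.mapClusterPt
  have hXshift : ∀ b ∈ X, ∀ s : ℤ, (fun k => b (k + s)) ∈ X := by
    intro b hb s
    rw [hmemX]
    have h1 : MapClusterPt (fun k => b (k + s)) atTop ((fun (x : ℤ → ℂ) k => x (k + s)) ∘ A) :=
      MapClusterPt.continuousAt_comp (f := fun (x : ℤ → ℂ) k => x (k + s))
        (Continuous.continuousAt (by fun_prop)) ((hmemX b).1 hb)
    have e : ((fun (x : ℤ → ℂ) k => x (k + s)) ∘ A) = A ∘ (fun m => m + s) := by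
      funext m k
      simp only [Function.comp, hA]
      congr 1; ring
    rw [e] at h1
    exact MapClusterPt.of_comp (tendsto_atTop_add_const_right atTop s tendsto_id) h1
  -- finite window determinism
  obtain ⟨N, hN⟩ : ∃ N : ℕ, ∀ b ∈ X, ∀ b' ∈ X, (∀ k : ℤ, -(N:ℤ) ≤ k → k < 0 → b k = b' k) →
      b 0 = b' 0 := by
    by_contra hcon
    push Not at hcon
    have hoff : IsClosed {x : (ℤ → ℂ) × (ℤ → ℂ) | (x.1 0, x.2 0) ∈ (F.offDiag : Set (ℂ × ℂ))} :=
      hfin.offDiag.isClosed.preimage (by fun_prop)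
    let t : ℕ → Set ((ℤ → ℂ) × (ℤ → ℂ)) := fun N => (X ×ˢ X) ∩
      ({x | (x.1 0, x.2 0) ∈ (F.offDiag : Set (ℂ × ℂ))} ∩
        ⋂ k : ℤ, ⋂ _ : -(N:ℤ) ≤ k, ⋂ _ : k < 0, {x | x.1 k = x.2 k})
    have htcl : ∀ N, IsClosed (t N) := by
      intro N
      refine (hXcl.prod hXcl).inter (hoff.inter ?_)
      refine isClosed_iInter fun k => isClosed_iInter fun _ => isClosed_iInter fun _ => ?_
      exact isClosed_eq (by fun_prop) (by fun_prop)
    have hne := IsCompact.nonempty_iInter_of_sequence_nonempty_isCompact_isClosed t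
      (by
        rintro N x ⟨h1, h2, h3⟩
        refine ⟨h1, h2, ?_⟩
        simp only [mem_iInter] at h3 ⊢
        intro k hk hk0
        exact h3 k (by push_cast; omega) hk0)
      (by
        intro N
        obtain ⟨b, hb, b', hb', h1, h2⟩ := hcon N
        refine ⟨(b, b'), ⟨hb, hb'⟩, ⟨hXF b hb 0, hXF b' hb' 0, h2⟩, ?_⟩
        simp only [mem_iInter]
        exact h1)
      ((hXc.prod hXc).of_isClosed_subset (htcl 0) (fun x hx => hx.1)) htcl
    obtain ⟨⟨b, b'⟩, hbb⟩ := hne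
    rw [mem_iInter] at hbb
    obtain ⟨⟨hb, hb'⟩, h2, -⟩ := hbb 0
    refine h2.2.2 (hdet b b' hb hb' fun k hk => ?_)
    obtain ⟨-, -, h3⟩ := hbb (-k).toNat
    simp only [mem_iInter] at h3
    exact h3 k (by omega) hk
  have hfwd : ∀ b ∈ X, ∀ b' ∈ X, (∀ k : ℤ, -(N:ℤ) ≤ k → k < 0 → b k = b' k) →
      ∀ n : ℕ, b n = b' n := by
    intro b hb b' hb' h n
    induction n using Nat.strong_induction_on with
    | _ n ih =>
      have := hN _ (hXshift b hb n) _ (hXshift b' hb' n) (by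
        intro k hk hk0
        by_cases hkn : k + n < 0
        · exact h _ (by omega) hkn
        · have := ih (k + n).toNat (by omega)
          rwa [Int.toNat_of_nonneg (by omega)] at this)
      simpa using this
  have : Finite F := hfin.to_subtype
  have : Fintype F := Fintype.ofFinite _
  set m := Fintype.card (Fin N → F) with hm
  have hper : ∀ b ∈ X, b (m.factorial : ℤ) = b 0 := by
    intro b hb
    -- shift back by m
    let c : ℤ → ℤ → ℂ := fun i k => b (k + (i - m))
    have hc : ∀ i, c i ∈ X := fun i => hXshift b hb _
    let W : Fin (m + 1) → (Fin N → F) := fun i j => ⟨c i (-(j:ℤ) - 1), hXF _ (hc i) _⟩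
    obtain ⟨i, j, hij, hW⟩ := Fintype.exists_ne_map_eq_of_card_lt W (by simp [hm])
    wlog hlt : i < j generalizing i j
    · exact this j i hij.symm hW.symm (lt_of_le_of_ne (not_lt.1 hlt) hij.symm)
    have hagree : ∀ k : ℤ, -(N:ℤ) ≤ k → k < 0 → c i k = c j k := by
      intro k hk hk0
      have := congrFun hW ⟨(-k - 1).toNat, by omega⟩
      simp only [W, Subtype.mk.injEq] at this
      have e : (-(((-k - 1).toNat : ℕ) : ℤ) - 1) = k := by omega
      rwa [e] at this
    have hfw := hfwd _ (hc i) _ (hc j) hagree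
    have hi : (i : ℕ) < m + 1 := i.2
    have hj : (j : ℕ) < m + 1 := j.2
    have hlt' : (i : ℕ) < j := hlt
    set q : ℕ := j - i with hq
    have hq1 : ∀ n : ℕ, b n = b (n + q : ℕ) := by
      intro n
      have := hfw (n + (m - i))
      simp only [c] at this
      have e1 : (((n + (m - i) : ℕ) : ℤ) + ((i:ℕ) - m : ℤ)) = n := by omega
      have e2 : (((n + (m - i) : ℕ) : ℤ) + ((j:ℕ) - m : ℤ)) = (n + q : ℕ) := by omega
      rwa [e1, e2] at this
    have hq2 : ∀ l : ℕ, b ((q * l : ℕ) : ℤ) = b 0 := by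
      intro l
      induction l with
      | zero => simp
      | succ l ih => rw [← ih, hq1 (q * l), Nat.mul_succ]
    obtain ⟨l, hl⟩ : q ∣ m.factorial := Nat.dvd_factorial (by omega) (by omega)
    rw [hl]; exact hq2 l
  refine ⟨m.factorial, Nat.one_le_iff_ne_zero.2 (Nat.factorial_ne_zero _), ?_⟩
  set p := m.factorial
  rw [tendsto_iff_ultrafilter]
  intro U hU
  let V : Ultrafilter ℤ := U.map (fun n : ℕ => (n : ℤ))
  have hV : (V : Filter ℤ) ≤ atTop := by
    have : Tendsto (fun n : ℕ => (n : ℤ)) U atTop := tendsto_natCast_atTop_atTop.mono_left hU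
    exact this
  obtain ⟨b, -, hb⟩ := hKc.ultrafilter_le_nhds (V.map A) (by
    rw [le_principal_iff]
    exact (Filter.Eventually.of_forall hAK : ∀ᶠ i in (V : Filter ℤ), A i ∈ _))
  have hb' : Tendsto A V (nhds b) := hb
  have hbX : b ∈ X := mapClusterPt_iff_ultrafilter.2 ⟨V, hV, hb'⟩
  have h1 := (tendsto_pi_nhds.1 hb') (p : ℤ)
  have h0 := (tendsto_pi_nhds.1 hb') 0
  have h2 := h1.sub h0
  rw [hper b hbX, sub_self] at h2
  have h3 : Tendsto ((fun m : ℤ => A m p - A m 0) ∘ (fun n : ℕ => (n : ℤ))) U (nhds 0) := h2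
  refine h3.congr fun n => ?_
  simp only [hA, Function.comp, ext0]
  have e1 : (0:ℤ) ≤ (p:ℤ) + n := by positivity
  have e2 : ((p:ℤ) + n).toNat = n + p := by omega
  simp [e1, e2]

lemma final_step (a : ℕ → ℂ) (C : ℝ) (hC : ∀ n, ‖a n‖ ≤ C)
    (hfin : {w : ℂ | MapClusterPt w atTop a}.Finite)
    (p : ℕ) (hp : 1 ≤ p) (h : Tendsto (fun n => a (n + p) - a n) atTop (nhds 0)) :
    ∃ c : ℕ → ℂ, (∃ p : ℕ, 1 ≤ p ∧ ∀ n, c (n + p) = c n) ∧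
      Tendsto (fun n => ‖a n - c n‖) atTop (nhds 0) := by
  set F := {w : ℂ | MapClusterPt w atTop a} with hF
  have hKc : IsCompact (closedBall (0:ℂ) C) := isCompact_closedBall _ _
  have haK : ∀ n, a n ∈ closedBall (0:ℂ) C := fun n => by simpa using hC n
  have hcl : ∀ U : Ultrafilter ℕ, (U : Filter ℕ) ≤ atTop → ∃ w ∈ F, Tendsto a U (nhds w) := by
    intro U hU
    obtain ⟨b, -, hb⟩ := hKc.ultrafilter_le_nhds (U.map a) (by
      rw [le_principal_iff]
      exact (Filter.Eventually.of_forall haK : ∀ᶠ i in (U : Filter ℕ), a i ∈ _))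
    exact ⟨b, mapClusterPt_iff_ultrafilter.2 ⟨U, hU, hb⟩, hb⟩
  have hFne : F.Nonempty := by
    obtain ⟨w, hw, -⟩ := hcl (Ultrafilter.of atTop) (Ultrafilter.of_le _)
    exact ⟨w, hw⟩
  have hmin : ∀ n, ∃ w ∈ F, ∀ w' ∈ F, ‖a n - w‖ ≤ ‖a n - w'‖ := fun n =>
    Set.exists_min_image F (fun w => ‖a n - w‖) hfin hFne
  choose t htF htmin using hmin
  have ht : Tendsto (fun n => ‖a n - t n‖) atTop (nhds 0) := by
    rw [tendsto_iff_ultrafilter]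
    intro U hU
    obtain ⟨w, hw, hUw⟩ := hcl U hU
    have : Tendsto (fun n => ‖a n - w‖) U (nhds 0) := by
      have := (hUw.sub_const w).norm
      simpa using this
    exact squeeze_zero (fun _ => norm_nonneg _) (fun n => htmin n w hw) this
  obtain ⟨n₀, hn₀⟩ : ∃ n₀, ∀ n ≥ n₀, t (n + p) = t n := by
    rw [← eventually_atTop]
    have ht' : Tendsto (fun n => a n - t n) atTop (nhds 0) := tendsto_zero_iff_norm_tendsto_zero.2 ht
    have h1 : Tendsto (fun n => t (n + p) - t n) atTop (nhds 0) := by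
      have := (h.sub (ht'.comp (tendsto_add_atTop_nat p))).add ht'
      simp only [sub_zero, add_zero] at this
      refine this.congr fun n => ?_
      simp only [Function.comp]; ring
    have hfin2 : ((fun x : ℂ × ℂ => x.1 - x.2) '' (F ×ˢ F) \ {0}).Finite :=
      ((hfin.prod hfin).image _).subset sdiff_subset
    have h2 : ((fun x : ℂ × ℂ => x.1 - x.2) '' (F ×ˢ F) \ {0})ᶜ ∈ nhds (0:ℂ) :=
      hfin2.isClosed.isOpen_compl.mem_nhds (by simp)
    filter_upwards [h1 h2] with n hn
    by_contra hne
    exact hn ⟨⟨(t (n + p), t n), ⟨htF _, htF _⟩, rfl⟩, by simpa [sub_eq_zero] using hne⟩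
  refine ⟨fun n => t (n + p * n₀), ⟨p, hp, fun n => ?_⟩, ?_⟩
  · have : n + p + p * n₀ = n + p * n₀ + p := by ring
    simp only
    rw [this]
    apply hn₀
    nlinarith
  · refine ht.congr' ?_
    filter_upwards [eventually_ge_atTop n₀] with n hn
    have : ∀ l, t (n + p * l) = t n := by
      intro l
      induction l with
      | zero => simp
      | succ l ih => rw [← ih, Nat.mul_succ, ← add_assoc]; exact hn₀ _ (by omega)
    rw [this]

theorem stmt15 (a : ℕ → ℂ) (C : ℝ) (hC : ∀ n, ‖a n‖ ≤ C)
    (hfin : {w : ℂ | MapClusterPt w atTop a}.Finite)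
    (f : ℂ → ℂ) (hf : ∀ z ∈ Metric.ball (0 : ℂ) 1, f z = ∑' n : ℕ, a n * z ^ n) :
    StrongNaturalBoundary f ∨
    ∃ c : ℕ → ℂ, (∃ p : ℕ, 1 ≤ p ∧ ∀ n, c (n + p) = c n) ∧
      Tendsto (fun n => ‖a n - c n‖) atTop (nhds 0) := by
  by_cases hS : StrongNaturalBoundary f
  · exact Or.inl hS
  right
  unfold StrongNaturalBoundary at hS
  push Not at hS
  obtain ⟨α, β, hαβ, M, hM⟩ := hS
  have hM' : ∀ r : ℝ, 0 < r → r < 1 →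
      (∫ θ in α..β, ‖f (r * Complex.exp (θ * Complex.I))‖) ≤ M * (2 * Real.pi) := by
    intro r h0 h1
    have := hM r h0 h1
    rwa [div_le_iff₀ Real.two_pi_pos] at this
  obtain ⟨q, hq0, hq1⟩ : ∃ q : ℚ, (0:ℝ) < q ∧ (q:ℝ) < (β - α) / 4 :=
    exists_rat_btwn (by linarith)
  have hq0' : 0 < q := by exact_mod_cast hq0
  set h : ℝ := (q : ℝ) with hh
  have hvan : ∀ θ : ℝ, |θ - (α + β) / 2| < h → ∀ b : ℤ → ℂ,
      MapClusterPt b atTop (fun (m : ℤ) (k : ℤ) => ext0 a (k + m)) →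
      ∑' k : ℤ, b k * (tri h k * Complex.exp (Complex.I * k * θ)) = 0 := by
    intro θ hθ b hb
    rw [abs_lt] at hθ
    have hu := u_tendsto a C hC f hf α β _ hM' θ h hq0 (by linarith) (by linarith)
    obtain ⟨U, hU1, hU⟩ := mapClusterPt_iff_ultrafilter.1 hb
    refine tendsto_nhds_unique (f := fun m : ℤ =>
      ∑' k : ℤ, ext0 a (k + m) * (tri h k * Complex.exp (Complex.I * k * θ))) (l := (U : Filter ℤ)) ?_
      (hu.mono_left hU1)
    apply tendsto_tsum_of_dominated_convergence ((tri_summable h).mul_left C)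
    · intro k
      exact ((tendsto_pi_nhds.1 hU) k).mul_const _
    · refine Filter.Eventually.of_forall fun m k => ?_
      have : Complex.I * k * θ = ((k * θ : ℝ) : ℂ) * Complex.I := by push_cast; ring
      rw [norm_mul, norm_mul, this, Complex.norm_exp_ofReal_mul_I, mul_one]
      gcongr
      exact ext0_norm a C hC _
  have hbC : ∀ b : ℤ → ℂ, MapClusterPt b atTop (fun (m : ℤ) (k : ℤ) => ext0 a (k + m)) →
      ∀ k, ‖b k‖ ≤ C := by
    intro b hb k
    obtain ⟨U, hU1, hU⟩ := mapClusterPt_iff_ultrafilter.1 hb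
    exact le_of_tendsto ((tendsto_pi_nhds.1 hU) k).norm
      (Filter.Eventually.of_forall fun m => ext0_norm a C hC _)
  have hdet : ∀ b b' : ℤ → ℂ,
      MapClusterPt b atTop (fun (m : ℤ) (k : ℤ) => ext0 a (k + m)) →
      MapClusterPt b' atTop (fun (m : ℤ) (k : ℤ) => ext0 a (k + m)) →
      (∀ k < 0, b k = b' k) → b 0 = b' 0 := by
    intro b b' hb hb' hneg
    have hsum : ∀ b : ℤ → ℂ, MapClusterPt b atTop (fun (m : ℤ) (k : ℤ) => ext0 a (k + m)) →
        ∀ θ : ℝ, Summable (fun k : ℤ => b k * (tri h k * Complex.exp (Complex.I * k * θ))) := by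
      intro b hb θ
      refine Summable.of_norm_bounded ((tri_summable h).mul_left C) fun k => ?_
      have : Complex.I * k * θ = ((k * θ : ℝ) : ℂ) * Complex.I := by push_cast; ring
      rw [norm_mul, norm_mul, this, Complex.norm_exp_ofReal_mul_I, mul_one]
      gcongr
      exact hbC b hb k
    have key := arc_unique (fun n : ℕ => (b n - b' n) * tri h n) (by
      have h1 : Summable (fun n : ℕ => ‖tri h (n:ℤ)‖) :=
        (tri_summable h).comp_injective (i := fun n : ℕ => (n : ℤ)) Nat.cast_injective
      refine Summable.of_nonneg_of_le (fun _ => norm_nonneg _) (fun n => ?_) (h1.mul_left (C + C))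
      rw [norm_mul]
      gcongr
      exact (norm_sub_le _ _).trans (add_le_add (hbC b hb _) (hbC b' hb' _))) ((α + β) / 2) h hq0 (by
      intro θ hθ
      have h1 : ∑' k : ℤ, (b k - b' k) * (tri h k * Complex.exp (Complex.I * k * θ)) = 0 := by
        have := (hsum b hb θ).tsum_sub (hsum b' hb' θ)
        rw [hvan θ hθ b hb, hvan θ hθ b' hb', sub_zero] at this
        simpa only [sub_mul] using this
      rw [← Function.Injective.tsum_eq (g := fun n : ℕ => (n : ℤ)) Nat.cast_injective] at h1
      · rw [← h1]
        refine tsum_congr fun n => ?_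
        rw [← Complex.exp_nat_mul, mul_assoc]
        congr 3
        push_cast
        ring
      · intro j hj
        rw [Function.mem_support] at hj
        by_cases hj0 : 0 ≤ j
        · exact ⟨j.toNat, by simp [hj0]⟩
        · exact absurd (by rw [hneg j (by omega)]; simp) hj) 0
    have := (mul_eq_zero.1 key).resolve_right (tri_ne_zero q hq0' _)
    simpa [sub_eq_zero] using this
  obtain ⟨p, hp, hap⟩ := asymp_period a C hC hfin hdet
  exact final_step a C hC hfin p hp hap
end
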